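/- For every integer k ≥ 1, the limit as X → ∞ of [ Σ_{d negative odd fundamental discriminant, −X < d < 0} ( f̃(d) / 3^{ω(d)} )^k ] divided by the number of negative odd fundamental discriminants d with −X < d < 0 exists and equals (1/32)^k. -/

import Mathlib

open Finset Filter Asymptotics

open scoped Classical

noncomputable section

/-- `D` is a fundamental discriminant: either `D ≡ 1 (mod 4)` and `D` is squarefree,
or `D = 4m` with `m` squarefree and `m ≡ 2, 3 (mod 4)`. -/
def IsFundDisc (D : ℤ) : Prop :=
  (D % 4 = 1 ∧ Squarefree D) ∨
    ∃ m : ℤ, D = 4 * m ∧ Squarefree m ∧ (m % 4 = 2 ∨ m % 4 = 3)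

/-- `ω(d)`, the number of distinct primes dividing `|d|`. -/
def omegaZ (d : ℤ) : ℕ := d.natAbs.primeFactors.card

/-- The Legendre symbol `(m/p)` for odd primes `p`, and the Kronecker symbol at `p = 2`
(`0` if `m` is even, `1` if `m ≡ ±1 (mod 8)`, `-1` if `m ≡ ±3 (mod 8)`). -/
def kron (m : ℤ) (p : ℕ) : ℤ :=
  if p = 2 then
    if m % 2 = 0 then 0 else if m % 8 = 1 ∨ m % 8 = 7 then 1 else -1
  else jacobiSym m p

/-- `α(d) = 1` if `d > 0` and `α(d) = 0` if `d < 0`. -/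
def alphaFD (d : ℤ) : ℕ := if 0 < d then 1 else 0

/-- Ordered triples `(d₁, d₂, d₃)` of pairwise coprime fundamental discriminants,
each `≠ 1`, with `d₁ * d₂ * d₃ = d`. -/
def fdTriples (d : ℤ) : Finset (ℤ × ℤ × ℤ) :=
  (Finset.Icc (-(d.natAbs : ℤ)) (d.natAbs : ℤ) ×ˢ
      Finset.Icc (-(d.natAbs : ℤ)) (d.natAbs : ℤ) ×ˢ
      Finset.Icc (-(d.natAbs : ℤ)) (d.natAbs : ℤ)).filter
    fun t =>
      IsFundDisc t.1 ∧ IsFundDisc t.2.1 ∧ IsFundDisc t.2.2 ∧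
      t.1 ≠ 1 ∧ t.2.1 ≠ 1 ∧ t.2.2 ≠ 1 ∧
      IsCoprime t.1 t.2.1 ∧ IsCoprime t.1 t.2.2 ∧ IsCoprime t.2.1 t.2.2 ∧
      t.1 * t.2.1 * t.2.2 = d

/-- The summand attached to a factorization `d = d₁ d₂ d₃`:
`∏_{p ∣ d₃} (1 + (d₁d₂/p)) · ∏_{p ∣ d₂} (1 + (d₁d₃/p)) · ∏_{p ∣ d₁} (1 + (d₂d₃/p))`. -/
def tripleTerm (t : ℤ × ℤ × ℤ) : ℤ :=
  (∏ p ∈ t.2.2.natAbs.primeFactors, (1 + kron (t.1 * t.2.1) p)) *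
    (∏ p ∈ t.2.1.natAbs.primeFactors, (1 + kron (t.1 * t.2.2) p)) *
    (∏ p ∈ t.1.natAbs.primeFactors, (1 + kron (t.2.1 * t.2.2) p))

/-- `f̃(d) = 2^{-3-α(d)} Σ_{{d₁,d₂,d₃}} (…)`, the sum over *unordered* triples of
pairwise coprime fundamental discriminants `≠ 1` with product `d`.  Since the summand is
symmetric and the entries of any such triple are pairwise distinct, the unordered sum is
one sixth of the ordered sum. -/
def ftilde (d : ℤ) : ℝ :=
  (1 / 2 ^ (3 + alphaFD d) : ℝ) * ((1 : ℝ) / 6) * ∑ t ∈ fdTriples d, (tripleTerm t : ℝ)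

/-- `D⁻(X, n, m)`: fundamental discriminants `d` with `0 < -d < X` and `d ≡ n (mod m)`. -/
def Dminus (X : ℝ) (n m : ℤ) : Finset ℤ :=
  (Finset.Icc (-⌈X⌉) ⌈X⌉).filter fun d =>
    IsFundDisc d ∧ d < 0 ∧ -X < (d : ℝ) ∧ d % m = n % m

/-- `D⁺(X, n, m)`: fundamental discriminants `d` with `0 < d < X` and `d ≡ n (mod m)`. -/
def Dplus (X : ℝ) (n m : ℤ) : Finset ℤ :=
  (Finset.Icc (-⌈X⌉) ⌈X⌉).filter fun d =>
    IsFundDisc d ∧ 0 < d ∧ (d : ℝ) < X ∧ d % m = n % m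

/-- Negative odd fundamental discriminants `d` with `-X < d < 0`:
squarefree integers `d < 0` with `d ≡ 1 (mod 4)`. -/
def DnegOdd (X : ℝ) : Finset ℤ :=
  (Finset.Icc (-⌈X⌉) 0).filter fun d =>
    d < 0 ∧ Squarefree d ∧ d % 4 = 1 ∧ -X < (d : ℝ)

theorem mul_succ_rpow_le_sub {σ : ℝ} (hσ : 0 < σ) {n : ℕ} (hn : 1 ≤ n) :
    σ * ((n + 1 : ℕ) : ℝ) ^ (-(1 + σ)) ≤ (n : ℝ) ^ (-σ) - ((n + 1 : ℕ) : ℝ) ^ (-σ) := by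
  have hn0 : (0 : ℝ) < n := by exact_mod_cast hn
  have hm0 : (0 : ℝ) < (n + 1 : ℕ) := by positivity
  set m : ℝ := ((n + 1 : ℕ) : ℝ) with hm
  have hnm : (n : ℝ) = m * (1 - 1 / m) := by
    field_simp
    rw [hm]; push_cast; ring
  have h1 : 0 < 1 - 1 / m := by
    by_contra h
    have := mul_nonpos_of_nonneg_of_nonpos hm0.le (not_lt.mp h)
    linarith [hnm]
  have h2 : 1 + σ / m ≤ (1 - 1 / m) ^ (-σ) := by
    rw [Real.rpow_def_of_pos h1]
    have := Real.add_one_le_exp (Real.log (1 - 1 / m) * -σ)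
    have h3 := Real.log_le_sub_one_of_pos h1
    have h4 : σ * Real.log (1 - 1 / m) ≤ σ * (-(1 / m)) := by
      apply mul_le_mul_of_nonneg_left _ hσ.le; linarith
    have h5 : σ * (1 / m) = σ / m := by ring
    linarith
  rw [hnm, Real.mul_rpow hm0.le h1.le, neg_add, Real.rpow_add hm0, Real.rpow_neg_one]
  have h6 : 0 < m ^ (-σ) := Real.rpow_pos_of_pos hm0 _
  have h7 := mul_le_mul_of_nonneg_left h2 h6.le
  have h8 : σ * (m⁻¹ * m ^ (-σ)) = m ^ (-σ) * (σ / m) := by field_simp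
  rw [h8]; linarith

theorem sub_le_mul_rpow {σ : ℝ} (hσ : 0 < σ) {n : ℕ} (hn : 1 ≤ n) :
    (n : ℝ) ^ (-σ) - ((n + 1 : ℕ) : ℝ) ^ (-σ) ≤ σ * (n : ℝ) ^ (-(1 + σ)) := by
  have hn0 : (0 : ℝ) < n := by exact_mod_cast hn
  have hnm : ((n + 1 : ℕ) : ℝ) = n * (1 + 1 / n) := by
    field_simp
    push_cast; ring
  have h1 : (0 : ℝ) < 1 + 1 / n := by positivity
  have h2 : 1 - σ / n ≤ (1 + 1 / (n : ℝ)) ^ (-σ) := by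
    rw [Real.rpow_def_of_pos h1]
    have := Real.add_one_le_exp (Real.log (1 + 1 / (n : ℝ)) * -σ)
    have h3 := Real.log_le_sub_one_of_pos h1
    have h4 : σ * Real.log (1 + 1 / n) ≤ σ * (1 / n) := by
      apply mul_le_mul_of_nonneg_left _ hσ.le; linarith
    have h5 : σ * (1 / n) = σ / n := by ring
    linarith
  rw [hnm, Real.mul_rpow hn0.le h1.le, neg_add, Real.rpow_add hn0, Real.rpow_neg_one]
  have h6 : 0 < (n : ℝ) ^ (-σ) := Real.rpow_pos_of_pos hn0 _
  have h7 := mul_le_mul_of_nonneg_left h2 h6.le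
  have h8 : σ * ((n : ℝ)⁻¹ * (n : ℝ) ^ (-σ)) = (n : ℝ) ^ (-σ) * (σ / n) := by field_simp
  rw [h8]; linarith

theorem sum_Ioc_rpow_le {σ : ℝ} (hσ : 0 < σ) {a : ℕ} (ha : 1 ≤ a) (b : ℕ) :
    ∑ n ∈ Ioc a b, (n : ℝ) ^ (-(1 + σ)) ≤ (a : ℝ) ^ (-σ) / σ := by
  rcases le_total b a with h | h
  · rw [Finset.Ioc_eq_empty (by omega)]
    simp; positivity
  have key : ∑ n ∈ Ioc a b, (n : ℝ) ^ (-(1 + σ)) ≤ ((a : ℝ) ^ (-σ) - (b : ℝ) ^ (-σ)) / σ := by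
    induction b, h using Nat.le_induction with
    | base => simp
    | succ b hb ih =>
      rw [← Finset.insert_Ioc_right_eq_Ioc_add_one hb, Finset.sum_insert (by simp)]
      have := mul_succ_rpow_le_sub hσ (ha.trans hb)
      rw [le_div_iff₀ hσ] at ih ⊢
      linarith
  refine key.trans ?_
  gcongr
  have : (0 : ℝ) ≤ (b : ℝ) ^ (-σ) := by positivity
  linarith

theorem summable_rpow_neg {σ : ℝ} (hσ : 0 < σ) : Summable fun n : ℕ => (n : ℝ) ^ (-(1 + σ)) :=
  Real.summable_nat_rpow.mpr (by linarith)

theorem tsum_rpow_le {σ : ℝ} (hσ : 0 < σ) : ∑' n : ℕ, (n : ℝ) ^ (-(1 + σ)) ≤ 1 + 1 / σ := by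
  refine Real.tsum_le_of_sum_range_le (fun n => by positivity) fun N => ?_
  calc ∑ n ∈ range N, (n : ℝ) ^ (-(1 + σ))
      ≤ ∑ n ∈ insert 0 (insert 1 (Ioc 1 N)), (n : ℝ) ^ (-(1 + σ)) := by
        apply Finset.sum_le_sum_of_subset_of_nonneg
        · intro n; simp; omega
        · intros; positivity
    _ = 1 + ∑ n ∈ Ioc 1 N, (n : ℝ) ^ (-(1 + σ)) := by
        rw [Finset.sum_insert (by simp), Finset.sum_insert (by simp)]
        simp [Real.zero_rpow (show -σ + -1 ≠ 0 by linarith)]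
    _ ≤ 1 + 1 / σ := by
        have := sum_Ioc_rpow_le hσ (le_refl 1) N
        simpa using this

theorem le_tsum_rpow {σ : ℝ} (hσ : 0 < σ) : 1 / σ ≤ ∑' n : ℕ, (n : ℝ) ^ (-(1 + σ)) := by
  have h1 : ∀ N : ℕ, (1 - ((N + 1 : ℕ) : ℝ) ^ (-σ)) / σ ≤ ∑' n : ℕ, (n : ℝ) ^ (-(1 + σ)) := by
    intro N
    have : (1 - ((N + 1 : ℕ) : ℝ) ^ (-σ)) / σ ≤ ∑ n ∈ range (N + 1), (n : ℝ) ^ (-(1 + σ)) := by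
      induction N with
      | zero => simp [Real.zero_rpow (show -σ + -1 ≠ 0 by linarith)]
      | succ N ih =>
        rw [Finset.sum_range_succ]
        have := sub_le_mul_rpow hσ (show 1 ≤ N + 1 by omega)
        rw [div_le_iff₀ hσ] at ih ⊢
        linarith
    exact this.trans ((summable_rpow_neg hσ).sum_le_tsum _ (fun _ _ => by positivity))
  have h2 : Tendsto (fun N : ℕ => (1 - ((N + 1 : ℕ) : ℝ) ^ (-σ)) / σ) atTop (nhds ((1 - 0) / σ)) := by
    refine ((tendsto_const_nhds).sub ?_).div_const _
    exact (tendsto_rpow_neg_atTop hσ).comp (tendsto_natCast_atTop_atTop.comp (tendsto_add_atTop_nat 1))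
  simpa using le_of_tendsto h2 (Eventually.of_forall h1)

theorem sum_log_div_le (n : ℕ) (hn : 1 ≤ n) :
    ∑ p ∈ Nat.primesLE n, Real.log p / p ≤ Real.log n + Real.log 4 := by
  have hn0 : (0 : ℝ) < n := by exact_mod_cast hn
  have h1 : ∑ p ∈ Nat.primesLE n, ((n / p : ℕ) : ℝ) * Real.log p ≤ n * Real.log n := by
    calc ∑ p ∈ Nat.primesLE n, ((n / p : ℕ) : ℝ) * Real.log p
        = ∑ p ∈ Nat.primesLE n, ∑ k ∈ Ioc 0 n, if p ∣ k then Real.log p else 0 := by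
          refine Finset.sum_congr rfl fun p _ => ?_
          rw [← Finset.sum_filter, Finset.sum_const, Nat.Ioc_filter_dvd_card_eq_div, nsmul_eq_mul]
      _ = ∑ k ∈ Ioc 0 n, ∑ p ∈ Nat.primesLE n, if p ∣ k then Real.log p else 0 :=
          Finset.sum_comm
      _ ≤ ∑ k ∈ Ioc 0 n, Real.log n := by
          refine Finset.sum_le_sum fun k hk => ?_
          have hk := Finset.mem_Ioc.mp hk
          rw [← Finset.sum_filter]
          have hs : (Nat.primesLE n).filter (· ∣ k) = k.primeFactors := by
            ext p
            simp only [Finset.mem_filter, Nat.mem_primesLE, Nat.mem_primeFactors]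
            constructor
            · rintro ⟨⟨h1, h2⟩, h3⟩; exact ⟨h2, h3, by omega⟩
            · rintro ⟨h1, h2, h3⟩; exact ⟨⟨(Nat.le_of_dvd hk.1 h2).trans hk.2, h1⟩, h2⟩
          rw [hs, ← Real.log_prod (fun p hp => by
            have := (Nat.prime_of_mem_primeFactors hp).pos; positivity)]
          apply Real.log_le_log
          · exact Finset.prod_pos fun p hp => by
              have := (Nat.prime_of_mem_primeFactors hp).pos; positivity
          · have := Nat.le_of_dvd hk.1 (Nat.prod_primeFactors_dvd k)
            have : (∏ p ∈ k.primeFactors, p) ≤ n := this.trans hk.2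
            rw [← Nat.cast_prod]
            exact_mod_cast this
      _ = n * Real.log n := by simp
  have h2 : ∑ p ∈ Nat.primesLE n, Real.log p ≤ Real.log 4 * n := by
    have := Chebyshev.theta_le_log4_mul_x (x := n) (by positivity)
    rwa [Chebyshev.theta_eq_sum_primesLE_log] at this
  have h3 : n * ∑ p ∈ Nat.primesLE n, Real.log p / p ≤
      ∑ p ∈ Nat.primesLE n, ((n / p : ℕ) : ℝ) * Real.log p + ∑ p ∈ Nat.primesLE n, Real.log p := by
    rw [Finset.mul_sum, ← Finset.sum_add_distrib]
    refine Finset.sum_le_sum fun p hp => ?_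
    have hp' := (Nat.mem_primesLE.mp hp).2
    have : (n : ℝ) / p ≤ (n / p : ℕ) + 1 := by
      rw [← Nat.floor_div_eq_div (K := ℝ)]; exact (Nat.lt_floor_add_one _).le
    have hl : 0 ≤ Real.log p := Real.log_natCast_nonneg p
    calc (n : ℝ) * (Real.log p / p) = (n / p) * Real.log p := by ring
      _ ≤ ((n / p : ℕ) + 1) * Real.log p := by gcongr
      _ = _ := by ring
  have : n * ∑ p ∈ Nat.primesLE n, Real.log p / p ≤ n * (Real.log n + Real.log 4) := by linarith
  exact le_of_mul_le_mul_left this hn0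

/-- `n ↦ ψ(n) n^{-s}` as a completely multiplicative function. -/
def twistHom (ψ : ℕ →*₀ ℝ) (s : ℝ) : ℕ →*₀ ℝ where
  toFun n := ψ n * (n : ℝ) ^ (-s)
  map_zero' := by simp
  map_one' := by simp
  map_mul' a b := by
    push_cast
    rw [map_mul, Real.mul_rpow (by positivity) (by positivity)]
    ring

theorem twistHom_apply (ψ : ℕ →*₀ ℝ) (s : ℝ) (n : ℕ) : twistHom ψ s n = ψ n * (n : ℝ) ^ (-s) := rfl

theorem summable_twistHom {ψ : ℕ →*₀ ℝ} (hψ : ∀ n, |ψ n| ≤ 1) {σ : ℝ} (hσ : 0 < σ) :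
    Summable fun n => ‖twistHom ψ (1 + σ) n‖ := by
  refine Summable.of_nonneg_of_le (fun n => norm_nonneg _) (fun n => ?_) (summable_rpow_neg hσ)
  rw [twistHom_apply, norm_mul, Real.norm_eq_abs, Real.norm_eq_abs,
    abs_of_nonneg (show (0:ℝ) ≤ (n : ℝ) ^ (-(1 + σ)) by positivity)]
  exact mul_le_of_le_one_left (by positivity) (hψ n)

/-- The constant function one on positive integers. -/
def oneHom : ℕ →*₀ ℝ where
  toFun n := if n = 0 then 0 else 1
  map_zero' := by simp
  map_one' := by simp
  map_mul' a b := by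
    by_cases ha : a = 0 <;> by_cases hb : b = 0 <;> simp [ha, hb]

theorem oneHom_apply {n : ℕ} (hn : n ≠ 0) : oneHom n = 1 := by simp [oneHom, hn]

theorem tsum_twistHom_oneHom {σ : ℝ} (hσ : 0 < σ) :
    ∑' n, twistHom oneHom (1 + σ) n = ∑' n : ℕ, (n : ℝ) ^ (-(1 + σ)) := by
  congr 1; ext n
  rw [twistHom_apply]
  rcases eq_or_ne n 0 with rfl | h
  · simp [Real.zero_rpow (show -σ + -1 ≠ 0 by linarith)]
  · rw [oneHom_apply h, one_mul]

theorem abs_oneHom_le (n : ℕ) : |oneHom n| ≤ 1 := by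
  rcases eq_or_ne n 0 with rfl | h
  · simp
  · simp [oneHom_apply h]

theorem prime_rpow_le_half {σ : ℝ} (hσ : 0 < σ) {p : ℕ} (hp : p.Prime) :
    (p : ℝ) ^ (-(1 + σ)) ≤ 1 / 2 := by
  have h2 : (2 : ℝ) ≤ p := by exact_mod_cast hp.two_le
  calc (p : ℝ) ^ (-(1 + σ)) ≤ (p : ℝ) ^ (-1 : ℝ) :=
        Real.rpow_le_rpow_of_exponent_le (by linarith) (by linarith)
    _ = 1 / p := by rw [Real.rpow_neg_one, one_div]
    _ ≤ 1 / 2 := by gcongr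

theorem exists_sum_primesLE_inv_le :
    ∃ C : ℝ, ∀ n : ℕ, 2 ≤ n → ∑ p ∈ Nat.primesLE n, (1 : ℝ) / p ≤ Real.log (Real.log n) + C := by
  refine ⟨Real.log 3 + 3, fun n hn => ?_⟩
  have hlog2 : (1 : ℝ) / 2 < Real.log 2 := by linarith [Real.log_two_gt_d9]
  have hl : Real.log 2 ≤ Real.log n := Real.log_le_log (by norm_num) (by exact_mod_cast hn)
  have hl0 : 0 < Real.log n := by linarith
  set σ : ℝ := 1 / Real.log n with hσd
  have hσ : 0 < σ := by positivity
  have h1 : Real.exp (∑ p ∈ Nat.primesLE n, (p : ℝ) ^ (-(1 + σ))) ≤ 1 + 1 / σ := by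
    refine le_trans ?_ (tsum_rpow_le hσ)
    rw [← tsum_twistHom_oneHom hσ]
    have ht := EulerProduct.eulerProduct_completely_multiplicative
      (summable_twistHom abs_oneHom_le hσ)
    refine ge_of_tendsto ht ?_
    filter_upwards [eventually_ge_atTop (n + 1)] with N hN
    rw [Real.exp_sum]
    have hfac : ∀ p : ℕ, p.Prime → Real.exp ((p : ℝ) ^ (-(1 + σ))) ≤
        (1 - twistHom oneHom (1 + σ) p)⁻¹ := by
      intro p hp
      rw [twistHom_apply, oneHom_apply hp.ne_zero, one_mul]
      have := prime_rpow_le_half hσ hp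
      rw [le_inv_comm₀ (Real.exp_pos _) (by linarith), ← Real.exp_neg]
      linarith [Real.add_one_le_exp (-(p : ℝ) ^ (-(1 + σ)))]
    calc ∏ p ∈ Nat.primesLE n, Real.exp ((p : ℝ) ^ (-(1 + σ)))
        ≤ ∏ p ∈ Nat.primesLE n, (1 - twistHom oneHom (1 + σ) p)⁻¹ :=
          Finset.prod_le_prod (fun _ _ => (Real.exp_pos _).le)
            fun p hp => hfac p (Nat.mem_primesLE.mp hp).2
      _ ≤ ∏ p ∈ Nat.primesBelow N, (1 - twistHom oneHom (1 + σ) p)⁻¹ := by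
          have hsub : Nat.primesLE n ⊆ Nat.primesBelow N := by
            intro p hp
            rw [Nat.mem_primesLE] at hp
            rw [Nat.mem_primesBelow]; exact ⟨by omega, hp.2⟩
          have hone : ∀ p : ℕ, p.Prime → 1 ≤ (1 - twistHom oneHom (1 + σ) p)⁻¹ := fun p hp =>
            le_trans (Real.one_le_exp (by positivity)) (hfac p hp)
          rw [← Finset.prod_sdiff hsub]
          refine le_mul_of_one_le_left (Finset.prod_nonneg fun p hp => ?_) ?_
          · exact zero_le_one.trans (hone p (Nat.mem_primesLE.mp hp).2)
          · calc (1 : ℝ) = ∏ p ∈ Nat.primesBelow N \ Nat.primesLE n, 1 := by simp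
              _ ≤ _ := Finset.prod_le_prod (fun _ _ => zero_le_one) fun p hp =>
                hone p (Nat.mem_primesBelow.mp (Finset.mem_sdiff.mp hp).1).2
  have h2 : ∑ p ∈ Nat.primesLE n, (p : ℝ) ^ (-(1 + σ)) ≤ Real.log (Real.log n) + Real.log 3 := by
    rw [← Real.log_mul (by positivity) (by norm_num), Real.le_log_iff_exp_le (by positivity)]
    refine h1.trans ?_
    rw [hσd, one_div_one_div]; linarith
  have h3 : ∑ p ∈ Nat.primesLE n, (1 : ℝ) / p ≤
      ∑ p ∈ Nat.primesLE n, (p : ℝ) ^ (-(1 + σ)) + σ * ∑ p ∈ Nat.primesLE n, Real.log p / p := by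
    rw [Finset.mul_sum, ← Finset.sum_add_distrib]
    refine Finset.sum_le_sum fun p hp => ?_
    have hp0 : (0 : ℝ) < p := by exact_mod_cast (Nat.mem_primesLE.mp hp).2.pos
    rw [neg_add, Real.rpow_add hp0, Real.rpow_neg_one, Real.rpow_def_of_pos hp0]
    have := Real.add_one_le_exp (Real.log p * -σ)
    have hpi : (0 : ℝ) < (p : ℝ)⁻¹ := by positivity
    have := mul_le_mul_of_nonneg_left this hpi.le
    calc (1 : ℝ) / p = (p : ℝ)⁻¹ * (Real.log p * -σ + 1) + σ * (Real.log p / p) := by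
          field_simp; ring
      _ ≤ _ := by linarith
  have h4 := sum_log_div_le n (by omega)
  have h5 : σ * ∑ p ∈ Nat.primesLE n, Real.log p / p ≤ 3 := by
    rw [hσd, one_div, inv_mul_le_iff₀ hl0]
    have : Real.log 4 = 2 * Real.log 2 := by
      rw [show (4 : ℝ) = 2 ^ 2 by norm_num, Real.log_pow]; norm_num
    linarith
  linarith

theorem sum_Ico_mul_antitone_le {ψ c : ℕ → ℝ} {q : ℝ}
    (hψ : ∀ y, |∑ i ∈ range y, ψ i| ≤ q) {a : ℕ} (hc : ∀ k, a ≤ k → c (k + 1) ≤ c k)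
    (N : ℕ) (hN : a ≤ N) :
    ∑ k ∈ Ico a N, ψ k * c k ≤
      2 * q * c a + (∑ i ∈ range N, ψ i - ∑ i ∈ range a, ψ i - 2 * q) * c N := by
  induction N, hN using Nat.le_induction with
  | base => simp
  | succ N hN ih =>
    rw [Finset.sum_Ico_succ_top hN]
    have h1 := abs_le.mp (hψ (N + 1))
    have h2 := abs_le.mp (hψ a)
    have h3 : (∑ i ∈ range (N + 1), ψ i - ∑ i ∈ range a, ψ i - 2 * q) ≤ 0 := by linarith
    have h4 := mul_le_mul_of_nonpos_left (hc N hN) h3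
    have h5 : ∑ i ∈ range (N + 1), ψ i = ∑ i ∈ range N, ψ i + ψ N := Finset.sum_range_succ _ _
    rw [h5] at h4 ⊢
    linarith

theorem tsum_twistHom_le {ψ : ℕ →*₀ ℝ} (h1 : ∀ n, |ψ n| ≤ 1) {q : ℕ} (hq : 1 ≤ q)
    (hψ : ∀ y, |∑ i ∈ range y, ψ i| ≤ q) {σ : ℝ} (hσ : 0 < σ) :
    ∑' n, twistHom ψ (1 + σ) n ≤ Real.log q + 3 := by
  refine le_of_tendsto (summable_twistHom h1 hσ).of_norm.hasSum.tendsto_sum_nat ?_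
  filter_upwards [eventually_ge_atTop (q + 1)] with N hN
  rw [Finset.range_eq_Ico, ← Finset.sum_Ico_consecutive _ (Nat.zero_le (q + 1)) hN]
  have hhead : ∑ n ∈ Ico 0 (q + 1), twistHom ψ (1 + σ) n ≤ 1 + Real.log q := by
    have := harmonic_le_one_add_log q
    refine le_trans ?_ this
    rw [← Finset.range_eq_Ico, Finset.sum_range_succ', harmonic, map_zero, add_zero]
    push_cast
    refine Finset.sum_le_sum fun i _ => ?_
    rw [twistHom_apply]
    have hi : (1 : ℝ) ≤ (i + 1 : ℕ) := by exact_mod_cast Nat.succ_pos i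
    calc ψ (i + 1) * ((i + 1 : ℕ) : ℝ) ^ (-(1 + σ)) ≤ 1 * ((i + 1 : ℕ) : ℝ) ^ (-(1 : ℝ)) := by
          apply mul_le_mul ((le_abs_self _).trans (h1 _)) _ (by positivity) zero_le_one
          exact Real.rpow_le_rpow_of_exponent_le hi (by linarith)
      _ = _ := by rw [one_mul, Real.rpow_neg_one]; push_cast; rfl
  have htail := sum_Ico_mul_antitone_le (ψ := ψ) (c := fun k => (k : ℝ) ^ (-(1 + σ))) hψ
    (a := q + 1) (fun k hk => by
      apply Real.rpow_le_rpow_of_nonpos (by norm_cast; omega) (by push_cast; linarith)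
        (by linarith)) N hN
  have hneg : (∑ i ∈ range N, ψ i - ∑ i ∈ range (q + 1), ψ i - 2 * q) * (N : ℝ) ^ (-(1 + σ)) ≤ 0 := by
    have h3 := abs_le.mp (hψ N)
    have h4 := abs_le.mp (hψ (q + 1))
    exact mul_nonpos_of_nonpos_of_nonneg (by linarith) (by positivity)
  have hq1 : 2 * (q : ℝ) * ((q + 1 : ℕ) : ℝ) ^ (-(1 + σ)) ≤ 2 := by
    have hq0 : (0 : ℝ) < (q + 1 : ℕ) := by positivity
    have : ((q + 1 : ℕ) : ℝ) ^ (-(1 + σ)) ≤ ((q + 1 : ℕ) : ℝ) ^ (-(1 : ℝ)) :=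
      Real.rpow_le_rpow_of_exponent_le (by norm_cast; omega) (by linarith)
    rw [Real.rpow_neg_one] at this
    calc 2 * (q : ℝ) * ((q + 1 : ℕ) : ℝ) ^ (-(1 + σ)) ≤ 2 * q * ((q + 1 : ℕ) : ℝ)⁻¹ := by gcongr
      _ ≤ 2 := by
        rw [← div_eq_mul_inv, div_le_iff₀ hq0]; push_cast; linarith
  have : ∑ i ∈ Ico (q + 1) N, twistHom ψ (1 + σ) i = ∑ k ∈ Ico (q + 1) N, ψ k * (k : ℝ) ^ (-(1 + σ)) :=
    rfl
  linarith

theorem sum_primesBelow_le {ψ : ℕ →*₀ ℝ} (h1 : ∀ n, |ψ n| ≤ 1) {n : ℕ} (hn : 3 ≤ n) {N : ℕ}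
    (hN : n < N) {σ : ℝ} (hσ : σ = (Real.sqrt (Real.log n))⁻¹) :
    ∑ p ∈ Nat.primesBelow N, (1 - ψ p) * (p : ℝ) ^ (-(1 + σ)) ≤
      ∑ p ∈ Nat.primesLE n, (1 - ψ p) / p + 2 := by
  have hl0 : 0 < Real.log n := Real.log_pos (by norm_cast; omega)
  have hs0 : 0 < Real.sqrt (Real.log n) := Real.sqrt_pos.mpr hl0
  have hσ0 : 0 < σ := by rw [hσ]; positivity
  have hψ2 : ∀ k, 0 ≤ 1 - ψ k ∧ 1 - ψ k ≤ 2 := fun k => by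
    have := abs_le.mp (h1 k); constructor <;> linarith
  have hsub : Nat.primesLE n ⊆ Nat.primesBelow N := by
    intro p hp
    rw [Nat.mem_primesLE] at hp
    rw [Nat.mem_primesBelow]; exact ⟨by omega, hp.2⟩
  rw [← Finset.sum_sdiff hsub, add_comm]
  gcongr with p hp
  · rw [div_eq_mul_inv]
    have hp' := (Nat.mem_primesLE.mp hp).2
    apply mul_le_mul_of_nonneg_left _ (hψ2 p).1
    rw [← Real.rpow_neg_one]
    exact Real.rpow_le_rpow_of_exponent_le (by exact_mod_cast hp'.one_le) (by linarith)
  · calc ∑ p ∈ Nat.primesBelow N \ Nat.primesLE n, (1 - ψ p) * (p : ℝ) ^ (-(1 + σ))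
        ≤ ∑ p ∈ Nat.primesBelow N \ Nat.primesLE n, 2 * (p : ℝ) ^ (-(1 + σ)) := by
          refine Finset.sum_le_sum fun p _ => ?_
          exact mul_le_mul_of_nonneg_right (hψ2 p).2 (by positivity)
      _ ≤ ∑ p ∈ Ioc n N, 2 * (p : ℝ) ^ (-(1 + σ)) := by
          refine Finset.sum_le_sum_of_subset_of_nonneg ?_ fun _ _ _ => by positivity
          intro p hp
          rw [Finset.mem_sdiff, Nat.mem_primesBelow, Nat.mem_primesLE] at hp
          rw [Finset.mem_Ioc]
          refine ⟨?_, hp.1.1.le⟩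
          by_contra h
          exact hp.2 ⟨by omega, hp.1.2⟩
      _ ≤ 2 * ((n : ℝ) ^ (-σ) / σ) := by
          rw [← Finset.mul_sum]
          exact mul_le_mul_of_nonneg_left (sum_Ioc_rpow_le hσ0 (by omega) N) (by norm_num)
      _ ≤ 2 := by
          have hn0 : (0 : ℝ) < n := by norm_cast; omega
          have : (n : ℝ) ^ (-σ) = Real.exp (-Real.sqrt (Real.log n)) := by
            rw [Real.rpow_def_of_pos hn0]
            congr 1
            rw [hσ]
            nth_rewrite 1 [← Real.mul_self_sqrt hl0.le]
            field_simp
          rw [this, hσ, div_inv_eq_mul, Real.exp_neg, inv_mul_eq_div]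
          have : Real.sqrt (Real.log n) / Real.exp (Real.sqrt (Real.log n)) ≤ 1 := by
            rw [div_le_one (Real.exp_pos _)]
            linarith [Real.add_one_le_exp (Real.sqrt (Real.log n))]
          linarith

theorem le_sum_primesLE_one_sub {ψ : ℕ →*₀ ℝ} (h1 : ∀ n, |ψ n| ≤ 1) {q : ℕ} (hq : 1 ≤ q)
    (hψ : ∀ y, |∑ i ∈ range y, ψ i| ≤ q) {n : ℕ} (hn : 3 ≤ n) :
    1 / 2 * (1 / 2 * Real.log (Real.log n) - Real.log (Real.log q + 3)) - 2 ≤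
      ∑ p ∈ Nat.primesLE n, (1 - ψ p) / p := by
  have hl0 : 0 < Real.log n := Real.log_pos (by norm_cast; omega)
  have hs0 : 0 < Real.sqrt (Real.log n) := Real.sqrt_pos.mpr hl0
  set P := ∑ p ∈ Nat.primesLE n, (1 - ψ p) / p with hP
  obtain ⟨σ, hσ⟩ : ∃ σ, σ = (Real.sqrt (Real.log n))⁻¹ := ⟨_, rfl⟩
  have hσ0 : 0 < σ := by rw [hσ]; positivity
  have hlq : 0 ≤ Real.log q := Real.log_natCast_nonneg q
  have hZ := EulerProduct.eulerProduct_completely_multiplicative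
    (summable_twistHom abs_oneHom_le hσ0)
  have hL := EulerProduct.eulerProduct_completely_multiplicative (summable_twistHom h1 hσ0)
  have hcmp : ∑' n, twistHom oneHom (1 + σ) n ≤
      (∑' n, twistHom ψ (1 + σ) n) * Real.exp (2 * (P + 2)) := by
    refine le_of_tendsto_of_tendsto hZ (hL.mul_const _) ?_
    filter_upwards [eventually_ge_atTop (n + 1)] with N hN
    have hterm : ∀ p ∈ Nat.primesBelow N, (1 - twistHom oneHom (1 + σ) p)⁻¹ ≤
        (1 - twistHom ψ (1 + σ) p)⁻¹ * Real.exp (2 * ((1 - ψ p) * (p : ℝ) ^ (-(1 + σ)))) := by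
      intro p hp
      have hp' := (Nat.mem_primesBelow.mp hp).2
      rw [twistHom_apply, twistHom_apply, oneHom_apply hp'.ne_zero, one_mul]
      have ht := prime_rpow_le_half hσ0 hp'
      have ht0 : (0 : ℝ) ≤ (p : ℝ) ^ (-(1 + σ)) := by positivity
      set t := (p : ℝ) ^ (-(1 + σ))
      have hψp := abs_le.mp (h1 p)
      have hψt : ψ p * t ≤ t := mul_le_of_le_one_left ht0 hψp.2
      have he := Real.add_one_le_exp (2 * ((1 - ψ p) * t))
      rw [inv_mul_eq_div, le_div_iff₀ (by linarith), inv_mul_le_iff₀ (by linarith)]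
      have h3 : (1 - t) * (2 * ((1 - ψ p) * t) + 1) ≤ (1 - t) * Real.exp (2 * ((1 - ψ p) * t)) :=
        mul_le_mul_of_nonneg_left he (by linarith)
      refine le_trans ?_ h3
      have h5 : 0 ≤ (1 - ψ p) * t := mul_nonneg (by linarith) ht0
      nlinarith
    calc ∏ p ∈ Nat.primesBelow N, (1 - twistHom oneHom (1 + σ) p)⁻¹
        ≤ ∏ p ∈ Nat.primesBelow N, ((1 - twistHom ψ (1 + σ) p)⁻¹ *
            Real.exp (2 * ((1 - ψ p) * (p : ℝ) ^ (-(1 + σ))))) := by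
          refine Finset.prod_le_prod (fun p hp => ?_) hterm
          have := prime_rpow_le_half hσ0 (Nat.mem_primesBelow.mp hp).2
          rw [twistHom_apply, oneHom_apply (Nat.mem_primesBelow.mp hp).2.ne_zero, one_mul]
          exact inv_nonneg.mpr (by linarith)
      _ = (∏ p ∈ Nat.primesBelow N, (1 - twistHom ψ (1 + σ) p)⁻¹) *
            Real.exp (2 * ∑ p ∈ Nat.primesBelow N, (1 - ψ p) * (p : ℝ) ^ (-(1 + σ))) := by
          rw [Finset.prod_mul_distrib, Finset.mul_sum, Real.exp_sum]
      _ ≤ _ := by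
          refine mul_le_mul_of_nonneg_left ?_ ?_
          · apply Real.exp_le_exp.mpr
            have := sum_primesBelow_le h1 hn (show n < N by omega) hσ
            linarith
          · refine Finset.prod_nonneg fun p hp => ?_
            have hp' := (Nat.mem_primesBelow.mp hp).2
            have ht := prime_rpow_le_half hσ0 hp'
            have ht0 : (0 : ℝ) ≤ (p : ℝ) ^ (-(1 + σ)) := by positivity
            have := mul_le_of_le_one_left ht0 (abs_le.mp (h1 p)).2
            rw [twistHom_apply]
            exact inv_nonneg.mpr (by linarith)
  have h5 : Real.sqrt (Real.log n) ≤ (Real.log q + 3) * Real.exp (2 * (P + 2)) := by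
    have h6 := le_tsum_rpow hσ0
    rw [← tsum_twistHom_oneHom hσ0, hσ, one_div, inv_inv, ← hσ] at h6
    refine h6.trans (hcmp.trans ?_)
    exact mul_le_mul_of_nonneg_right (tsum_twistHom_le h1 hq hψ hσ0) (Real.exp_pos _).le
  have h7 := Real.log_le_log hs0 h5
  rw [Real.log_mul (by positivity) (Real.exp_pos _).ne', Real.log_exp, Real.log_sqrt hl0.le] at h7
  linarith

/-- The squarefree numbers less than `N`. -/
def sqfreeLT (N : ℕ) : Finset ℕ := (range N).filter Squarefree

theorem mem_sqfreeLT {N n : ℕ} : n ∈ sqfreeLT N ↔ n < N ∧ Squarefree n := by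
  simp [sqfreeLT]

theorem primeFactors_subset_primesLE {N n : ℕ} (hn : n ≤ N) : n.primeFactors ⊆ Nat.primesLE N := by
  intro p hp
  rw [Nat.mem_primesLE]
  exact ⟨(Nat.le_of_mem_primeFactors hp).trans hn, Nat.prime_of_mem_primeFactors hp⟩

theorem cast_eq_prod_primeFactors {n : ℕ} (hn : Squarefree n) :
    (n : ℝ) = ∏ p ∈ n.primeFactors, (p : ℝ) := by
  rw [← Nat.cast_prod, Nat.prod_primeFactors_of_squarefree hn]

theorem sum_sqfree_div_le {h : ℕ → ℝ} (h0 : ∀ p, p.Prime → 0 ≤ h p) (N : ℕ) :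
    ∑ n ∈ sqfreeLT N, (∏ p ∈ n.primeFactors, h p) / n ≤
      Real.exp (∑ p ∈ Nat.primesLE N, h p / p) := by
  calc ∑ n ∈ sqfreeLT N, (∏ p ∈ n.primeFactors, h p) / n
      = ∑ n ∈ sqfreeLT N, ∏ p ∈ n.primeFactors, (h p / p) := by
        refine Finset.sum_congr rfl fun n hn => ?_
        rw [Finset.prod_div_distrib, ← cast_eq_prod_primeFactors (mem_sqfreeLT.mp hn).2]
    _ = ∑ s ∈ (sqfreeLT N).image Nat.primeFactors, ∏ p ∈ s, (h p / p) := by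
        rw [Finset.sum_image]
        intro a ha b hb hab
        rw [← Nat.prod_primeFactors_of_squarefree (mem_sqfreeLT.mp ha).2, hab,
          Nat.prod_primeFactors_of_squarefree (mem_sqfreeLT.mp hb).2]
    _ ≤ ∑ s ∈ (Nat.primesLE N).powerset, ∏ p ∈ s, (h p / p) := by
        refine Finset.sum_le_sum_of_subset_of_nonneg ?_ ?_
        · intro s hs
          obtain ⟨n, hn, rfl⟩ := Finset.mem_image.mp hs
          exact Finset.mem_powerset.mpr (primeFactors_subset_primesLE (mem_sqfreeLT.mp hn).1.le)
        · intro s hs _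
          refine Finset.prod_nonneg fun p hp => ?_
          exact div_nonneg (h0 p (Nat.mem_primesLE.mp (Finset.mem_powerset.mp hs hp)).2) (by positivity)
    _ = ∏ p ∈ Nat.primesLE N, (1 + h p / p) := by rw [Finset.prod_one_add]
    _ ≤ _ := by
        rw [Real.exp_sum]
        refine Finset.prod_le_prod (fun p hp => ?_) (fun p hp => ?_)
        · have := h0 p (Nat.mem_primesLE.mp hp).2; positivity
        · linarith [Real.add_one_le_exp (h p / p)]

theorem log_eq_sum_primeFactors {n : ℕ} (hn : Squarefree n) :
    Real.log n = ∑ p ∈ n.primeFactors, Real.log p := by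
  rw [cast_eq_prod_primeFactors hn, Real.log_prod]
  intro p hp
  exact_mod_cast (Nat.prime_of_mem_primeFactors hp).ne_zero

theorem sum_sqfree_mul_log_le {h : ℕ → ℝ} (h0 : ∀ p, p.Prime → 0 ≤ h p)
    {M : ℝ} (hM : 0 ≤ M) (h1 : ∀ p, p.Prime → h p ≤ M) (N : ℕ) :
    ∑ n ∈ sqfreeLT N, (∏ p ∈ n.primeFactors, h p) * Real.log n ≤
      M * Real.log 4 * N * ∑ n ∈ sqfreeLT N, (∏ p ∈ n.primeFactors, h p) / n := by
  have hH : ∀ n : ℕ, 0 ≤ ∏ p ∈ n.primeFactors, h p := fun n =>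
    Finset.prod_nonneg fun p hp => h0 p (Nat.prime_of_mem_primeFactors hp)
  calc ∑ n ∈ sqfreeLT N, (∏ p ∈ n.primeFactors, h p) * Real.log n
      = ∑ n ∈ sqfreeLT N, ∑ p ∈ n.primeFactors, (∏ p ∈ n.primeFactors, h p) * Real.log p := by
        refine Finset.sum_congr rfl fun n hn => ?_
        rw [log_eq_sum_primeFactors (mem_sqfreeLT.mp hn).2, Finset.mul_sum]
    _ = ∑ p ∈ Nat.primesLE N, ∑ n ∈ (sqfreeLT N).filter (p ∣ ·),
          (∏ p ∈ n.primeFactors, h p) * Real.log p := by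
        refine Finset.sum_comm' fun n p => ?_
        rw [Finset.mem_filter, Nat.mem_primesLE, mem_sqfreeLT, Nat.mem_primeFactors]
        constructor
        · rintro ⟨⟨h1, h2⟩, h3, h4, h5⟩
          exact ⟨⟨⟨h1, h2⟩, h4⟩, (Nat.le_of_dvd h5.bot_lt h4).trans h1.le, h3⟩
        · rintro ⟨⟨⟨h1, h2⟩, h4⟩, h5, h6⟩
          exact ⟨⟨h1, h2⟩, h6, h4, h2.ne_zero⟩
    _ ≤ ∑ p ∈ Nat.primesLE N, ∑ m ∈ (sqfreeLT N).filter (fun m => p * m < N),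
          M * (∏ p ∈ m.primeFactors, h p) * Real.log p := by
        refine Finset.sum_le_sum fun p hp => ?_
        have hpp := (Nat.mem_primesLE.mp hp).2
        have hlp := Real.log_natCast_nonneg p
        have hdecomp : ∀ n ∈ (sqfreeLT N).filter (p ∣ ·), Squarefree (n / p) ∧ n = p * (n / p) ∧
            ∏ p ∈ n.primeFactors, h p = h p * ∏ p ∈ (n / p).primeFactors, h p := by
          intro n hn
          obtain ⟨hn, hd⟩ := Finset.mem_filter.mp hn
          have hsq := (mem_sqfreeLT.mp hn).2
          have hnp : n = p * (n / p) := (Nat.mul_div_cancel' hd).symm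
          have hsq' : Squarefree (p * (n / p)) := by rwa [← hnp]
          have hco : p.Coprime (n / p) := (Nat.squarefree_mul_iff.mp hsq').1
          refine ⟨(Nat.squarefree_mul_iff.mp hsq').2.2, hnp, ?_⟩
          conv_lhs => rw [hnp, hco.primeFactors_mul]
          rw [Finset.prod_union hco.disjoint_primeFactors, hpp.primeFactors, Finset.prod_singleton]
        calc ∑ n ∈ (sqfreeLT N).filter (p ∣ ·), (∏ p ∈ n.primeFactors, h p) * Real.log p
            ≤ ∑ n ∈ (sqfreeLT N).filter (p ∣ ·),
              M * (∏ p ∈ (n / p).primeFactors, h p) * Real.log p := by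
              refine Finset.sum_le_sum fun n hn => ?_
              rw [(hdecomp n hn).2.2]
              exact mul_le_mul_of_nonneg_right
                (mul_le_mul_of_nonneg_right (h1 p hpp) (hH _)) hlp
          _ = ∑ m ∈ ((sqfreeLT N).filter (p ∣ ·)).image (· / p),
              M * (∏ p ∈ m.primeFactors, h p) * Real.log p := by
              rw [Finset.sum_image]
              intro a ha b hb hab
              rw [(hdecomp a ha).2.1, (hdecomp b hb).2.1]
              simp only at hab
              rw [hab]
          _ ≤ _ := by
              refine Finset.sum_le_sum_of_subset_of_nonneg ?_
                fun m _ _ => mul_nonneg (mul_nonneg hM (hH m)) hlp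
              intro m hm
              obtain ⟨n, hn, rfl⟩ := Finset.mem_image.mp hm
              obtain ⟨hs, he, -⟩ := hdecomp n hn
              have hnN := (mem_sqfreeLT.mp (Finset.mem_filter.mp hn).1).1
              rw [Finset.mem_filter, mem_sqfreeLT, ← he]
              exact ⟨⟨(Nat.div_le_self _ _).trans_lt hnN, hs⟩, hnN⟩
    _ = ∑ m ∈ sqfreeLT N, ∑ p ∈ (Nat.primesLE N).filter (fun p => p * m < N),
          M * (∏ p ∈ m.primeFactors, h p) * Real.log p := by
        refine Finset.sum_comm' fun p m => ?_
        rw [Finset.mem_filter, Finset.mem_filter]; tauto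
    _ ≤ _ := by
        rw [Finset.mul_sum]
        refine Finset.sum_le_sum fun m hm => ?_
        obtain ⟨hmN, hms⟩ := mem_sqfreeLT.mp hm
        have hm0 : (0 : ℝ) < m := by exact_mod_cast hms.ne_zero.bot_lt
        rw [← Finset.mul_sum]
        have hth : ∑ p ∈ (Nat.primesLE N).filter (fun p => p * m < N), Real.log p ≤
            Real.log 4 * (N / m) := by
          have := Chebyshev.theta_le_log4_mul_x (x := (N / m : ℕ)) (by positivity)
          rw [Chebyshev.theta_eq_sum_primesLE_log] at this
          calc _ ≤ ∑ p ∈ Nat.primesLE (N / m), Real.log p := by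
                refine Finset.sum_le_sum_of_subset_of_nonneg ?_
                  fun p _ _ => Real.log_natCast_nonneg p
                intro p hp
                rw [Finset.mem_filter, Nat.mem_primesLE] at hp
                rw [Nat.mem_primesLE, Nat.le_div_iff_mul_le hms.ne_zero.bot_lt]
                exact ⟨hp.2.le, hp.1.2⟩
            _ ≤ Real.log 4 * (N / m : ℕ) := this
            _ ≤ _ := by
                have := Nat.cast_div_le (α := ℝ) (m := N) (n := m)
                gcongr
        calc _ ≤ M * (∏ p ∈ m.primeFactors, h p) * (Real.log 4 * (N / m)) :=
              mul_le_mul_of_nonneg_left hth (mul_nonneg hM (hH m))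
          _ = _ := by ring

theorem exists_sum_sqfree_le {M : ℝ} (hM : 0 ≤ M) :
    ∃ C : ℝ, 0 < C ∧ ∀ (h : ℕ → ℝ), (∀ p, p.Prime → 0 ≤ h p) → (∀ p, p.Prime → h p ≤ M) →
      ∀ N : ℕ, 2 ≤ N → ∑ n ∈ sqfreeLT N, ∏ p ∈ n.primeFactors, h p ≤
        C * N * Real.exp (-∑ p ∈ Nat.primesLE N, (1 - h p) / p) := by
  obtain ⟨C, hC⟩ := exists_sum_primesLE_inv_le
  refine ⟨(M * Real.log 4 + 1) * Real.exp C, by positivity, fun h h0 h1 N hN => ?_⟩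
  have hH : ∀ n : ℕ, 0 ≤ ∏ p ∈ n.primeFactors, h p := fun n =>
    Finset.prod_nonneg fun p hp => h0 p (Nat.prime_of_mem_primeFactors hp)
  have hl0 : 0 < Real.log N := Real.log_pos (by norm_cast)
  have hN0 : (0 : ℝ) < N := by norm_cast; omega
  set T := ∑ n ∈ sqfreeLT N, (∏ p ∈ n.primeFactors, h p) / n with hT
  have hlow : ∑ n ∈ sqfreeLT N, (∏ p ∈ n.primeFactors, h p) * (Real.log N - Real.log n) ≤
      N * T := by
    rw [hT, Finset.mul_sum]
    refine Finset.sum_le_sum fun n hn => ?_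
    obtain ⟨hnN, hs⟩ := mem_sqfreeLT.mp hn
    have hn0 : (0 : ℝ) < n := by exact_mod_cast hs.ne_zero.bot_lt
    have : Real.log N - Real.log n ≤ N / n := by
      rw [← Real.log_div hN0.ne' hn0.ne']
      exact (Real.log_le_sub_one_of_pos (by positivity)).trans (by linarith)
    calc _ ≤ (∏ p ∈ n.primeFactors, h p) * (N / n) := mul_le_mul_of_nonneg_left this (hH n)
      _ = _ := by ring
  have hlog := sum_sqfree_mul_log_le h0 hM h1 N
  rw [← hT] at hlog
  have hsum : (∑ n ∈ sqfreeLT N, ∏ p ∈ n.primeFactors, h p) * Real.log N ≤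
      (M * Real.log 4 + 1) * N * T := by
    have : (∑ n ∈ sqfreeLT N, ∏ p ∈ n.primeFactors, h p) * Real.log N =
        ∑ n ∈ sqfreeLT N, (∏ p ∈ n.primeFactors, h p) * (Real.log N - Real.log n) +
        ∑ n ∈ sqfreeLT N, (∏ p ∈ n.primeFactors, h p) * Real.log n := by
      rw [← Finset.sum_add_distrib, Finset.sum_mul]
      exact Finset.sum_congr rfl fun n _ => by ring
    rw [this]; linarith
  have hTle : T ≤ Real.exp C * Real.log N * Real.exp (-∑ p ∈ Nat.primesLE N, (1 - h p) / p) := by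
    refine (sum_sqfree_div_le h0 N).trans ?_
    rw [show Real.log N = Real.exp (Real.log (Real.log N)) from (Real.exp_log hl0).symm]
    rw [← Real.exp_add, ← Real.exp_add]
    apply Real.exp_le_exp.mpr
    have h2 : ∑ p ∈ Nat.primesLE N, (1 - h p) / p =
        ∑ p ∈ Nat.primesLE N, (1 : ℝ) / p - ∑ p ∈ Nat.primesLE N, h p / p := by
      rw [← Finset.sum_sub_distrib]
      exact Finset.sum_congr rfl fun p _ => by ring
    rw [h2]
    linarith [hC N hN]
  refine le_of_mul_le_mul_right (hsum.trans ?_) hl0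
  calc (M * Real.log 4 + 1) * N * T ≤ (M * Real.log 4 + 1) * N *
        (Real.exp C * Real.log N * Real.exp (-∑ p ∈ Nat.primesLE N, (1 - h p) / p)) := by gcongr
    _ = _ := by ring

theorem sum_range_eq_zero_of_periodic {f : ℕ → ℝ} {q b : ℕ} (hq : 0 < q)
    (hmul : ∀ m n, f (m * n) = f m * f n) (hper : ∀ n, f (n % q) = f n) (hb : f b = -1)
    (hbq : b.Coprime q) : ∑ i ∈ range q, f i = 0 := by
  have hinj : Set.InjOn (fun i => b * i % q) (range q : Set ℕ) := by
    intro i hi j hj hij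
    have hi := Finset.mem_range.mp (Finset.mem_coe.mp hi)
    have hj := Finset.mem_range.mp (Finset.mem_coe.mp hj)
    have : i ≡ j [MOD q] := Nat.ModEq.cancel_left_of_coprime hbq.symm hij
    rwa [Nat.ModEq, Nat.mod_eq_of_lt hi, Nat.mod_eq_of_lt hj] at this
  have himg : (range q).image (fun i => b * i % q) = range q := by
    apply Finset.eq_of_subset_of_card_le
    · intro x hx
      obtain ⟨i, -, rfl⟩ := Finset.mem_image.mp hx
      exact Finset.mem_range.mpr (Nat.mod_lt _ hq)
    · rw [Finset.card_image_of_injOn hinj]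
  have h : ∑ i ∈ range q, f i = -∑ i ∈ range q, f i := by
    conv_lhs => rw [← himg]
    rw [Finset.sum_image hinj, ← Finset.sum_neg_distrib]
    refine Finset.sum_congr rfl fun i _ => ?_
    rw [hper, hmul, hb]; ring
  linarith

theorem abs_sum_range_le_of_periodic {f : ℕ → ℝ} {q : ℕ} (hq : 0 < q) (h1 : ∀ n, |f n| ≤ 1)
    (hper : ∀ n, f (n % q) = f n) (h0 : ∑ i ∈ range q, f i = 0) (y : ℕ) :
    |∑ i ∈ range y, f i| ≤ q := by
  induction y using Nat.strong_induction_on with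
  | _ y ih =>
    rcases lt_or_ge y q with h | h
    · calc |∑ i ∈ range y, f i| ≤ ∑ i ∈ range y, |f i| := Finset.abs_sum_le_sum_abs _ _
        _ ≤ ∑ i ∈ range y, 1 := Finset.sum_le_sum fun i _ => h1 i
        _ = y := by simp
        _ ≤ q := by exact_mod_cast h.le
    · obtain ⟨m, rfl⟩ := Nat.exists_eq_add_of_le h
      rw [Finset.sum_range_add, h0, zero_add]
      have : ∀ x, f (q + x) = f x := fun x => by
        rw [← hper (q + x), Nat.add_mod_left, hper]
      simp only [this]
      exact ih m (by omega)

theorem exists_jacobiSym_eq_neg_one {p r : ℕ} (hp : p.Prime) (hp2 : p ≠ 2) (hr : Odd r)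
    (hpr : ¬ p ∣ r) :
    ∃ b : ℕ, b % 4 = 1 ∧ jacobiSym b (p * r) = -1 ∧ b.Coprime (4 * (p * r)) := by
  have : Fact p.Prime := ⟨hp⟩
  have : NeZero r := ⟨by rintro rfl; simp at hr⟩
  obtain ⟨c, hc⟩ := FiniteField.exists_nonsquare (F := ZMod p) (by rwa [ZMod.ringChar_zmod_n])
  have hodd : Odd p := hp.odd_of_ne_two hp2
  have hco : p.Coprime (4 * r) := by
    apply Nat.Coprime.mul_right
    · have : p.Coprime (2 ^ 2) := (Nat.coprime_primes hp Nat.prime_two |>.mpr hp2).pow_right 2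
      simpa using this
    · exact (hp.coprime_iff_not_dvd).mpr hpr
  obtain ⟨b, hb1, hb2⟩ := Nat.chineseRemainder hco c.val 1
  have hb4 : b % 4 = 1 := by
    have := hb2.of_mul_right r
    simpa [Nat.ModEq] using this
  have hbr : b ≡ 1 [MOD r] := hb2.of_mul_left 4
  have hJ1 : jacobiSym b p = -1 := by
    rw [← jacobiSym.legendreSym.to_jacobiSym, legendreSym.eq_neg_one_iff]
    have : ((b : ℤ) : ZMod p) = c := by
      have := (ZMod.natCast_eq_natCast_iff _ _ _).mpr hb1
      rw [Int.cast_natCast, this, ZMod.natCast_zmod_val]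
    rwa [this]
  have hJ2 : jacobiSym b r = 1 := by
    rw [jacobiSym.mod_left, show ((b : ℤ) % r) = (1 : ℤ) % r by exact_mod_cast hbr,
      ← jacobiSym.mod_left, jacobiSym.one_left]
  have hJ : jacobiSym b (p * r) = -1 := by
    have : NeZero p := ⟨hp.ne_zero⟩
    rw [jacobiSym.mul_right, hJ1, hJ2, mul_one]
  refine ⟨b, hb4, hJ, ?_⟩
  apply Nat.Coprime.mul_right
  · have h : b.Coprime (2 ^ 2) := by
      apply Nat.Coprime.pow_right
      exact Nat.coprime_two_right.mpr (Nat.odd_iff.mpr (by omega))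
    simpa using h
  · have h0 : ¬ jacobiSym b (p * r) = 0 := by rw [hJ]; norm_num
    have : NeZero (p * r) := ⟨mul_ne_zero hp.ne_zero (NeZero.ne r)⟩
    rw [jacobiSym.eq_zero_iff_not_coprime, not_not] at h0
    rwa [Int.gcd_natCast_natCast] at h0

theorem abs_jacobiSym_le (a : ℤ) (b : ℕ) : |(jacobiSym a b : ℝ)| ≤ 1 := by
  rcases jacobiSym.trichotomy a b with h | h | h <;> rw [h] <;> norm_num

/-- The character `n ↦ χ₄(n)^η (n / Q)`, supported on odd numbers. -/
def oddChar (η : Bool) (Q : ℕ) : ℕ →*₀ ℝ where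
  toFun n := ((if η then ZMod.χ₄ n else ZMod.χ₄ n ^ 2 : ℤ) : ℝ) * (jacobiSym n Q : ℝ)
  map_zero' := by cases η <;> simp
  map_one' := by cases η <;> simp [jacobiSym.one_left]
  map_mul' m n := by
    have hm : ZMod.χ₄ ((m * n : ℕ) : ZMod 4) = ZMod.χ₄ m * ZMod.χ₄ n := by
      rw [Nat.cast_mul, map_mul]
    rw [hm, Nat.cast_mul, jacobiSym.mul_left]
    cases η
    · simp only [Bool.false_eq_true, if_false]; push_cast; ring
    · simp only [if_true]; push_cast; ring

theorem oddChar_apply (η : Bool) (Q n : ℕ) : oddChar η Q n =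
    ((if η then ZMod.χ₄ n else ZMod.χ₄ n ^ 2 : ℤ) : ℝ) * (jacobiSym n Q : ℝ) := rfl

theorem abs_chi_four_le (n : ℕ) : |((ZMod.χ₄ n : ℤ) : ℝ)| ≤ 1 := by
  have : ∀ x : ZMod 4, ZMod.χ₄ x = 0 ∨ ZMod.χ₄ x = 1 ∨ ZMod.χ₄ x = -1 := by decide
  rcases this n with h | h | h <;> rw [h] <;> norm_num

theorem abs_oddChar_le (η : Bool) (Q n : ℕ) : |oddChar η Q n| ≤ 1 := by
  rw [oddChar_apply, abs_mul]
  refine mul_le_one₀ ?_ (abs_nonneg _) (abs_jacobiSym_le _ _)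
  cases η
  · have := abs_chi_four_le n
    simp only [Bool.false_eq_true, if_false]
    push_cast
    rw [abs_pow]
    exact pow_le_one₀ (abs_nonneg _) this
  · exact abs_chi_four_le n

theorem oddChar_mod (η : Bool) (Q n : ℕ) : oddChar η Q (n % (4 * Q)) = oddChar η Q n := by
  rw [oddChar_apply, oddChar_apply, jacobiSym.mod_left n, jacobiSym.mod_left (n % (4 * Q) : ℕ)]
  have h1 : (((n % (4 * Q) : ℕ) : ℤ)) % Q = (n : ℤ) % Q := by
    exact_mod_cast Nat.mod_mul_left_mod n 4 Q
  have h2 : ((n % (4 * Q) : ℕ) : ZMod 4) = n := by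
    rw [ZMod.natCast_eq_natCast_iff]
    exact Nat.mod_mul_right_mod n 4 Q
  rw [h1, h2]

theorem abs_sum_oddChar_le (η : Bool) {Q : ℕ} (hQ : Odd Q) (hs : Squarefree Q) (h1 : Q ≠ 1)
    (y : ℕ) : |∑ i ∈ range y, oddChar η Q i| ≤ (4 * Q : ℕ) := by
  obtain ⟨p, hp, hd⟩ := Nat.exists_prime_and_dvd h1
  obtain ⟨r, rfl⟩ := hd
  have hsq := Nat.squarefree_mul_iff.mp hs
  obtain ⟨b, hb4, hbJ, hbc⟩ := exists_jacobiSym_eq_neg_one hp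
    (by rintro rfl; exact (Nat.not_odd_iff_even.mpr (even_two_mul r)) hQ)
    (Nat.Odd.of_mul_right hQ) ((hp.coprime_iff_not_dvd).mp hsq.1)
  have hq : 0 < 4 * (p * r) := Nat.mul_pos (by norm_num) hs.ne_zero.bot_lt
  refine abs_sum_range_le_of_periodic hq (abs_oddChar_le η _) (oddChar_mod η _) ?_ y
  refine sum_range_eq_zero_of_periodic hq (fun m n => map_mul _ m n) (oddChar_mod η _) ?_ hbc
  have h4 : (b : ZMod 4) = 1 := by
    have : ((b : ℕ) : ZMod 4) = (1 : ℕ) := (ZMod.natCast_eq_natCast_iff _ _ _).mpr hb4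
    simpa using this
  rw [oddChar_apply, hbJ, h4]
  cases η <;> simp

theorem abs_sum_oddChar_one_le (y : ℕ) : |∑ i ∈ range y, oddChar true 1 i| ≤ (4 : ℕ) := by
  refine abs_sum_range_le_of_periodic (by norm_num) (abs_oddChar_le _ _)
    (fun n => oddChar_mod true 1 n) ?_ y
  refine sum_range_eq_zero_of_periodic (b := 3) (by norm_num) (fun m n => map_mul _ m n)
    (fun n => oddChar_mod true 1 n) ?_ (by norm_num)
  rw [oddChar_apply, jacobiSym.one_right]
  have : ZMod.χ₄ ((3 : ℕ) : ZMod 4) = -1 := by decide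
  simp only [if_true, this]
  norm_num

theorem card_divisors_mul_le (a b : ℕ) :
    (a * b).divisors.card ≤ a.divisors.card * b.divisors.card := by
  rw [Nat.divisors_mul]
  exact Finset.card_mul_le

theorem sum_Ioc_zero_eq_sum_range (f : ℕ → ℝ) (x : ℕ) :
    ∑ n ∈ Ioc 0 x, f n = ∑ n ∈ range x, f (n + 1) := by
  rw [Finset.range_eq_Ico, Finset.sum_Ico_add' f 0 x 1]
  exact Finset.sum_congr (by ext; simp [Nat.lt_iff_add_one_le]) fun _ _ => rfl

theorem sum_card_divisors_pow_div_le (x j : ℕ) :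
    ∑ n ∈ Ioc 0 x, (n.divisors.card : ℝ) ^ j / n ≤ (1 + Real.log x) ^ 2 ^ j := by
  induction j with
  | zero =>
    have := harmonic_le_one_add_log x
    rw [harmonic] at this
    push_cast at this
    simp only [pow_zero, pow_one, one_div]
    rw [sum_Ioc_zero_eq_sum_range]
    push_cast
    exact this
  | succ j ih =>
    have h0 : 0 ≤ ∑ n ∈ Ioc 0 x, (n.divisors.card : ℝ) ^ j / n :=
      Finset.sum_nonneg fun n _ => by positivity
    calc ∑ n ∈ Ioc 0 x, (n.divisors.card : ℝ) ^ (j + 1) / n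
        = ∑ n ∈ Ioc 0 x, ∑ ab ∈ n.divisorsAntidiagonal, (n.divisors.card : ℝ) ^ j / n := by
          refine Finset.sum_congr rfl fun n _ => ?_
          rw [Finset.sum_const, nsmul_eq_mul, ← Nat.map_div_right_divisors, Finset.card_map]
          ring
      _ ≤ ∑ n ∈ Ioc 0 x, ∑ ab ∈ n.divisorsAntidiagonal,
            ((ab.1.divisors.card : ℝ) ^ j / ab.1) * ((ab.2.divisors.card : ℝ) ^ j / ab.2) := by
          refine Finset.sum_le_sum fun n _ => Finset.sum_le_sum fun ab hab => ?_
          have hab := (Nat.mem_divisorsAntidiagonal.mp hab).1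
          rw [← hab, div_mul_div_comm, ← mul_pow, Nat.cast_mul]
          gcongr
          exact_mod_cast card_divisors_mul_le _ _
      _ = ∑ ab ∈ (Ioc 0 x).biUnion Nat.divisorsAntidiagonal,
            ((ab.1.divisors.card : ℝ) ^ j / ab.1) * ((ab.2.divisors.card : ℝ) ^ j / ab.2) := by
          rw [Finset.sum_biUnion]
          intro a _ b _ hab
          rw [Function.onFun, Finset.disjoint_left]
          intro t ha hb
          exact hab ((Nat.mem_divisorsAntidiagonal.mp ha).1.symm.trans
            (Nat.mem_divisorsAntidiagonal.mp hb).1)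
      _ ≤ ∑ ab ∈ Ioc 0 x ×ˢ Ioc 0 x,
            ((ab.1.divisors.card : ℝ) ^ j / ab.1) * ((ab.2.divisors.card : ℝ) ^ j / ab.2) := by
          refine Finset.sum_le_sum_of_subset_of_nonneg ?_ fun _ _ _ => by positivity
          intro ab hab
          obtain ⟨n, hn, hab⟩ := Finset.mem_biUnion.mp hab
          obtain ⟨h1, h2⟩ := Nat.mem_divisorsAntidiagonal.mp hab
          have hn := Finset.mem_Ioc.mp hn
          have ha : ab.1 ≠ 0 := by rintro h; rw [h, zero_mul] at h1; exact h2 h1.symm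
          have hb : ab.2 ≠ 0 := by rintro h; rw [h, mul_zero] at h1; exact h2 h1.symm
          have := Nat.le_of_dvd hn.1 (Dvd.intro _ h1)
          have := Nat.le_of_dvd hn.1 (Dvd.intro_left _ h1)
          rw [Finset.mem_product, Finset.mem_Ioc, Finset.mem_Ioc]
          omega
      _ = (∑ n ∈ Ioc 0 x, (n.divisors.card : ℝ) ^ j / n) ^ 2 := by
          rw [Finset.sum_product, sq, Finset.sum_mul_sum]
      _ ≤ ((1 + Real.log x) ^ 2 ^ j) ^ 2 := by gcongr
      _ = _ := by rw [← pow_mul, pow_succ 2 j]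

theorem abs_sum_jacobiSym_le {a b : ℕ} (ha : Odd a) (hb : Odd b) (ha' : Squarefree a)
    (hb' : Squarefree b) (hab : a ≠ b) (K : ℕ) :
    |∑ k ∈ Ioc 0 K, (jacobiSym k a : ℝ) * jacobiSym k b| ≤ a * b := by
  have key : ∀ {a b : ℕ}, Odd a → Odd b → Squarefree a → Squarefree b → ∀ p, p.Prime → p ∣ a →
      ¬ p ∣ b → |∑ k ∈ Ioc 0 K, (jacobiSym k a : ℝ) * jacobiSym k b| ≤ a * b := by
    intro a b ha hb ha' hb' p hp hpa hpb
    have : NeZero a := ⟨ha'.ne_zero⟩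
    have : NeZero b := ⟨hb'.ne_zero⟩
    obtain ⟨r, rfl⟩ := hpa
    have : NeZero p := ⟨hp.ne_zero⟩
    have : NeZero r := ⟨right_ne_zero_of_mul ha'.ne_zero⟩
    have hsq := Nat.squarefree_mul_iff.mp ha'
    have hr := Nat.Odd.of_mul_right ha
    obtain ⟨c, -, hcJ, hcc⟩ := exists_jacobiSym_eq_neg_one hp
      (by rintro rfl; exact (Nat.not_odd_iff_even.mpr (even_two_mul r)) ha)
      (hr.mul hb) (hp.dvd_mul.not.mpr (not_or.mpr ⟨(hp.coprime_iff_not_dvd).mp hsq.1, hpb⟩))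
    have hq : 0 < p * (r * b) := by
      rw [← mul_assoc]; exact Nat.mul_pos ha'.ne_zero.bot_lt hb'.ne_zero.bot_lt
    have hper : ∀ n : ℕ, (jacobiSym (n % (p * (r * b)) : ℕ) (p * (r * b)) : ℝ) =
        jacobiSym n (p * (r * b)) := by
      intro n
      rw [jacobiSym.mod_left n]; norm_cast
    have h := abs_sum_range_le_of_periodic hq (f := fun n : ℕ => (jacobiSym n (p * (r * b)) : ℝ))
      (fun n => abs_jacobiSym_le n _) hper
      (sum_range_eq_zero_of_periodic hq
        (fun m n => by push_cast; rw [jacobiSym.mul_left]; push_cast; rfl) hper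
        (by rw [hcJ]; norm_num) (Nat.Coprime.coprime_mul_left_right hcc)) (K + 1)
    have h1 : 1 < p * (r * b) := lt_of_lt_of_le hp.one_lt
      (Nat.le_mul_of_pos_right _ (Nat.pos_of_mul_pos_left hq))
    rw [Finset.sum_range_succ', Nat.cast_zero, jacobiSym.zero_left h1, Int.cast_zero, add_zero] at h
    calc |∑ k ∈ Ioc 0 K, (jacobiSym k (p * r) : ℝ) * jacobiSym k b|
        = |∑ k ∈ range K, (jacobiSym (k + 1 : ℕ) (p * (r * b)) : ℝ)| := by
          congr 1
          rw [sum_Ioc_zero_eq_sum_range]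
          refine Finset.sum_congr rfl fun k _ => ?_
          rw [← mul_assoc, jacobiSym.mul_right _ (p * r) b]; push_cast; rfl
      _ ≤ _ := h
      _ = _ := by push_cast; ring
  have hex : (∃ p, p.Prime ∧ p ∣ a ∧ ¬ p ∣ b) ∨ ∃ p, p.Prime ∧ p ∣ b ∧ ¬ p ∣ a := by
    by_contra hcon
    push Not at hcon
    apply hab
    rw [← Nat.prod_primeFactors_of_squarefree ha', ← Nat.prod_primeFactors_of_squarefree hb']
    congr 1
    ext p
    simp only [Nat.mem_primeFactors]
    constructor
    · rintro ⟨h1, h2, -⟩; exact ⟨h1, hcon.1 p h1 h2, hb'.ne_zero⟩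
    · rintro ⟨h1, h2, -⟩; exact ⟨h1, hcon.2 p h1 h2, ha'.ne_zero⟩
  rcases hex with ⟨p, h1, h2, h3⟩ | ⟨p, h1, h2, h3⟩
  · exact key ha hb ha' hb' p h1 h2 h3
  · have := key hb ha hb' ha' p h1 h2 h3
    rw [mul_comm (b : ℝ)] at this
    simpa only [mul_comm] using this

theorem sq_sum_jacobiSym {ι : Type*} (I : Finset ι) (w : ι → ℝ) (κ : ι → ℕ) (n : ℕ) :
    (∑ i ∈ I, w i * (jacobiSym (κ i) n : ℝ)) ^ 2 =
      ∑ i ∈ I ×ˢ I, w i.1 * w i.2 * (jacobiSym (κ i.1 * κ i.2 : ℕ) n : ℝ) := by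
  rw [sq, Finset.sum_mul_sum, Finset.sum_product]
  refine Finset.sum_congr rfl fun i _ => Finset.sum_congr rfl fun j _ => ?_
  push_cast
  rw [jacobiSym.mul_left]
  push_cast
  ring

theorem sum_fourth_pow_le {A B : Finset ℕ} {M : ℕ} (hA : ∀ a ∈ A, 0 < a ∧ a ≤ M) {α : ℕ → ℝ}
    (hα : ∀ a, |α a| ≤ 1) :
    ∑ n ∈ B, (∑ m ∈ A, α m * (jacobiSym m n : ℝ)) ^ 4 ≤
      ∑ k ∈ Ioc 0 (M ^ 4), (k.divisors.card : ℝ) ^ 4 * |∑ n ∈ B, (jacobiSym k n : ℝ)| := by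
  set P := (A ×ˢ A) ×ˢ (A ×ˢ A) with hP
  have hS : ∀ n, (∑ m ∈ A, α m * (jacobiSym m n : ℝ)) ^ 4 = ∑ i ∈ P,
      (α i.1.1 * α i.1.2) * (α i.2.1 * α i.2.2) *
        (jacobiSym ((i.1.1 * i.1.2) * (i.2.1 * i.2.2) : ℕ) n : ℝ) := by
    intro n
    rw [show 4 = 2 * 2 by norm_num, pow_mul, sq_sum_jacobiSym A α (fun m => m),
      sq_sum_jacobiSym (A ×ˢ A) (fun i => α i.1 * α i.2) (fun i => i.1 * i.2)]
  have hmem : ∀ i ∈ P, (i.1.1 * i.1.2) * (i.2.1 * i.2.2) ∈ Ioc 0 (M ^ 4) := by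
    intro i hi
    simp only [hP, Finset.mem_product] at hi
    have h1 := hA _ hi.1.1
    have h2 := hA _ hi.1.2
    have h3 := hA _ hi.2.1
    have h4 := hA _ hi.2.2
    rw [Finset.mem_Ioc]
    constructor
    · exact Nat.mul_pos (Nat.mul_pos h1.1 h2.1) (Nat.mul_pos h3.1 h4.1)
    · calc _ ≤ (M * M) * (M * M) :=
            Nat.mul_le_mul (Nat.mul_le_mul h1.2 h2.2) (Nat.mul_le_mul h3.2 h4.2)
        _ = M ^ 4 := by ring
  have hcard : ∀ k ∈ Ioc 0 (M ^ 4),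
      (P.filter (fun i => (i.1.1 * i.1.2) * (i.2.1 * i.2.2) = k)).card ≤ k.divisors.card ^ 4 := by
    intro k hk
    have hk0 := (Finset.mem_Ioc.mp hk).1.ne'
    calc _ ≤ ((k.divisors ×ˢ k.divisors) ×ˢ (k.divisors ×ˢ k.divisors)).card := by
          refine Finset.card_le_card fun i hi => ?_
          obtain ⟨-, hi⟩ := Finset.mem_filter.mp hi
          simp only [Finset.mem_product, Nat.mem_divisors]
          rw [← hi]
          rw [← hi] at hk0
          exact ⟨⟨⟨((dvd_mul_right _ _).mul_right _), hk0⟩, ((dvd_mul_left _ _).mul_right _), hk0⟩,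
            ⟨((dvd_mul_right _ _).mul_left _), hk0⟩, ((dvd_mul_left _ _).mul_left _), hk0⟩
      _ = _ := by simp only [Finset.card_product]; ring
  calc ∑ n ∈ B, (∑ m ∈ A, α m * (jacobiSym m n : ℝ)) ^ 4
      = ∑ i ∈ P, (α i.1.1 * α i.1.2) * (α i.2.1 * α i.2.2) *
          ∑ n ∈ B, (jacobiSym ((i.1.1 * i.1.2) * (i.2.1 * i.2.2) : ℕ) n : ℝ) := by
        simp only [hS]
        rw [Finset.sum_comm]
        exact Finset.sum_congr rfl fun i _ => by rw [Finset.mul_sum]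
    _ ≤ ∑ i ∈ P, |∑ n ∈ B, (jacobiSym ((i.1.1 * i.1.2) * (i.2.1 * i.2.2) : ℕ) n : ℝ)| := by
        refine Finset.sum_le_sum fun i _ => (le_abs_self _).trans ?_
        rw [abs_mul]
        refine mul_le_of_le_one_left (abs_nonneg _) ?_
        simp only [abs_mul]
        exact mul_le_one₀ (mul_le_one₀ (hα _) (abs_nonneg _) (hα _)) (by positivity)
          (mul_le_one₀ (hα _) (abs_nonneg _) (hα _))
    _ = ∑ k ∈ Ioc 0 (M ^ 4), ∑ i ∈ P with (i.1.1 * i.1.2) * (i.2.1 * i.2.2) = k,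
          |∑ n ∈ B, (jacobiSym ((i.1.1 * i.1.2) * (i.2.1 * i.2.2) : ℕ) n : ℝ)| :=
        (Finset.sum_fiberwise_of_maps_to hmem _).symm
    _ = ∑ k ∈ Ioc 0 (M ^ 4), ((P.filter (fun i => (i.1.1 * i.1.2) * (i.2.1 * i.2.2) = k)).card : ℝ) *
          |∑ n ∈ B, (jacobiSym k n : ℝ)| := by
        refine Finset.sum_congr rfl fun k _ => ?_
        rw [← nsmul_eq_mul, ← Finset.sum_const]
        refine Finset.sum_congr rfl fun i hi => ?_
        rw [(Finset.mem_filter.mp hi).2]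
    _ ≤ _ := by
        refine Finset.sum_le_sum fun k hk => mul_le_mul_of_nonneg_right ?_ (abs_nonneg _)
        exact_mod_cast hcard k hk

theorem sum_sq_jacobiSym_le {B : Finset ℕ} {N : ℕ}
    (hB : ∀ b ∈ B, b ≤ N ∧ Odd b ∧ Squarefree b) (K : ℕ) :
    ∑ k ∈ Ioc 0 K, (∑ n ∈ B, (jacobiSym k n : ℝ)) ^ 2 ≤ N * K + N ^ 4 := by
  have hcardB : (B.card : ℝ) ≤ N := by
    have : B ⊆ Ioc 0 N := fun b hb => Finset.mem_Ioc.mpr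
      ⟨(hB b hb).2.2.ne_zero.bot_lt, (hB b hb).1⟩
    exact_mod_cast (Finset.card_le_card this).trans_eq (Nat.card_Ioc 0 N)
  calc ∑ k ∈ Ioc 0 K, (∑ n ∈ B, (jacobiSym k n : ℝ)) ^ 2
      = ∑ a ∈ B, ∑ b ∈ B, ∑ k ∈ Ioc 0 K, (jacobiSym k a : ℝ) * jacobiSym k b := by
        simp only [sq, Finset.sum_mul_sum]
        rw [Finset.sum_comm]
        exact Finset.sum_congr rfl fun a _ => Finset.sum_comm
    _ ≤ ∑ a ∈ B, ∑ b ∈ B, ((if a = b then (K : ℝ) else 0) + N ^ 2) := by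
        refine Finset.sum_le_sum fun a ha => Finset.sum_le_sum fun b hb => ?_
        obtain ⟨a1, a2, a3⟩ := hB a ha
        obtain ⟨b1, b2, b3⟩ := hB b hb
        split_ifs with h
        · have : ∑ k ∈ Ioc 0 K, (jacobiSym k a : ℝ) * jacobiSym k b ≤ ∑ k ∈ Ioc 0 K, (1 : ℝ) := by
            refine Finset.sum_le_sum fun k _ => (le_abs_self _).trans ?_
            rw [abs_mul]
            exact mul_le_one₀ (abs_jacobiSym_le _ _) (abs_nonneg _) (abs_jacobiSym_le _ _)
          rw [Finset.sum_const, Nat.card_Ioc, nsmul_eq_mul] at this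
          simp only [tsub_zero, mul_one] at this
          nlinarith
        · refine (le_abs_self _).trans ((abs_sum_jacobiSym_le a2 b2 a3 b3 h K).trans ?_)
          have : (a : ℝ) ≤ N := by exact_mod_cast a1
          have : (b : ℝ) ≤ N := by exact_mod_cast b1
          rw [zero_add, sq]; gcongr
    _ = B.card * K + B.card ^ 2 * N ^ 2 := by
        simp only [Finset.sum_add_distrib, Finset.sum_const, Finset.sum_ite_eq, nsmul_eq_mul]
        rw [Finset.sum_ite_mem, Finset.inter_self, Finset.sum_const, nsmul_eq_mul]
        ring
    _ ≤ N * K + N ^ 2 * N ^ 2 := by gcongr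
    _ = _ := by ring

theorem sum_jacobiSym_pow_eight_le {A B : Finset ℕ} {M N : ℕ} (hNM : N ≤ M)
    (hA : ∀ a ∈ A, 0 < a ∧ a ≤ M) (hB : ∀ b ∈ B, b ≤ N ∧ Odd b ∧ Squarefree b) {α β : ℕ → ℝ}
    (hα : ∀ a, |α a| ≤ 1) (hβ : ∀ b, |β b| ≤ 1) :
    (∑ m ∈ A, ∑ n ∈ B, α m * β n * (jacobiSym m n : ℝ)) ^ 8 ≤
      2 * (M : ℝ) ^ 8 * N ^ 7 * (1 + Real.log (M ^ 4 : ℕ)) ^ 256 := by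
  rcases Nat.eq_zero_or_pos M with hM | hM
  · have : A = ∅ := Finset.eq_empty_of_forall_notMem fun a ha => by have := hA a ha; omega
    rw [this, Finset.sum_empty, zero_pow (by norm_num)]
    have : 0 ≤ Real.log (M ^ 4 : ℕ) := Real.log_natCast_nonneg _
    positivity
  set H := 1 + Real.log (M ^ 4 : ℕ) with hH
  have hH0 : 0 ≤ H := by
    have : 0 ≤ Real.log (M ^ 4 : ℕ) := Real.log_natCast_nonneg _
    positivity
  have hE0 : 0 ≤ H ^ 256 := pow_nonneg hH0 _
  obtain ⟨E, hE⟩ : ∃ E, E = H ^ 256 := ⟨_, rfl⟩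
  rw [← hE] at hE0 ⊢
  set S : ℕ → ℝ := fun n => ∑ m ∈ A, α m * (jacobiSym m n : ℝ) with hSdef
  have hcardB : (B.card : ℝ) ≤ N := by
    have : B ⊆ Ioc 0 N := fun b hb => Finset.mem_Ioc.mpr
      ⟨(hB b hb).2.2.ne_zero.bot_lt, (hB b hb).1⟩
    exact_mod_cast (Finset.card_le_card this).trans_eq (Nat.card_Ioc 0 N)
  have hT : ∑ m ∈ A, ∑ n ∈ B, α m * β n * (jacobiSym m n : ℝ) = ∑ n ∈ B, β n * S n := by
    rw [Finset.sum_comm]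
    refine Finset.sum_congr rfl fun n _ => ?_
    rw [hSdef, Finset.mul_sum]
    exact Finset.sum_congr rfl fun m _ => by ring
  have h2 : (∑ n ∈ B, β n * S n) ^ 2 ≤ N * ∑ n ∈ B, S n ^ 2 := by
    refine (sq_sum_le_card_mul_sum_sq).trans ?_
    refine mul_le_mul hcardB (Finset.sum_le_sum fun n _ => ?_)
      (Finset.sum_nonneg fun _ _ => sq_nonneg _) (by positivity)
    rw [mul_pow]
    exact mul_le_of_le_one_left (sq_nonneg _) ((sq_le_one_iff_abs_le_one _).mpr (hβ n))
  have h4 : (∑ n ∈ B, S n ^ 2) ^ 2 ≤ N * ∑ n ∈ B, S n ^ 4 := by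
    refine (sq_sum_le_card_mul_sum_sq).trans ?_
    have h22 : ∀ n, (S n ^ 2) ^ 2 = S n ^ 4 := fun n => by ring
    simp only [h22]
    exact mul_le_mul_of_nonneg_right hcardB
      (Finset.sum_nonneg fun n _ => by rw [← h22]; exact sq_nonneg _)
  set F := ∑ k ∈ Ioc 0 (M ^ 4), (k.divisors.card : ℝ) ^ 4 * |∑ n ∈ B, (jacobiSym k n : ℝ)| with hF
  have hSF : ∑ n ∈ B, S n ^ 4 ≤ F := sum_fourth_pow_le hA hα
  have hF2 : F ^ 2 ≤ ((M : ℝ) ^ 4 * E) * (N * M ^ 4 + N ^ 4) := by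
    refine (Finset.sum_mul_sq_le_sq_mul_sq _ _ _).trans ?_
    have ha : ∑ k ∈ Ioc 0 (M ^ 4), ((k.divisors.card : ℝ) ^ 4) ^ 2 ≤ (M : ℝ) ^ 4 * E := by
      have h := sum_card_divisors_pow_div_le (M ^ 4) 8
      rw [show 2 ^ 8 = 256 by norm_num, ← hH, ← hE] at h
      refine le_trans ?_ (mul_le_mul_of_nonneg_left h (by positivity))
      rw [Finset.mul_sum]
      refine Finset.sum_le_sum fun k hk => ?_
      obtain ⟨hk0, hk⟩ := Finset.mem_Ioc.mp hk
      have hk0 : (0 : ℝ) < k := by exact_mod_cast hk0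
      have hk : (k : ℝ) ≤ M ^ 4 := by exact_mod_cast hk
      rw [← pow_mul, ← mul_div_assoc, le_div_iff₀ hk0, mul_comm]
      gcongr
    have hb := sum_sq_jacobiSym_le hB (M ^ 4)
    push_cast at hb
    simp only [sq_abs]
    exact mul_le_mul ha hb (Finset.sum_nonneg fun _ _ => sq_nonneg _) (by positivity)
  have hS4 : 0 ≤ ∑ n ∈ B, S n ^ 4 := Finset.sum_nonneg fun _ _ => by positivity
  have hS2 : 0 ≤ ∑ n ∈ B, S n ^ 2 := Finset.sum_nonneg fun _ _ => by positivity
  have hN7 : (N : ℝ) ^ 10 * M ^ 4 ≤ N ^ 7 * M ^ 8 := by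
    have h : (N : ℝ) ≤ M := by exact_mod_cast hNM
    have h1 : (1 : ℝ) ≤ M := by exact_mod_cast hM
    have h3 : (N : ℝ) ^ 3 ≤ M ^ 4 := by
      calc (N : ℝ) ^ 3 ≤ (M : ℝ) ^ 3 := by gcongr
        _ ≤ (M : ℝ) ^ 4 := pow_le_pow_right₀ h1 (by norm_num)
    calc (N : ℝ) ^ 10 * (M : ℝ) ^ 4 = (N : ℝ) ^ 7 * (M : ℝ) ^ 4 * (N : ℝ) ^ 3 := by ring
      _ ≤ (N : ℝ) ^ 7 * (M : ℝ) ^ 4 * (M : ℝ) ^ 4 := by gcongr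
      _ = _ := by ring
  rw [hT]
  calc (∑ n ∈ B, β n * S n) ^ 8 = (((∑ n ∈ B, β n * S n) ^ 2) ^ 2) ^ 2 := by ring
    _ ≤ ((N * ∑ n ∈ B, S n ^ 2) ^ 2) ^ 2 := by gcongr
    _ = (N ^ 2 * (∑ n ∈ B, S n ^ 2) ^ 2) ^ 2 := by ring
    _ ≤ (N ^ 2 * (N * F)) ^ 2 := by
        have : (∑ n ∈ B, S n ^ 2) ^ 2 ≤ N * F := h4.trans (by gcongr)
        gcongr
    _ = N ^ 6 * F ^ 2 := by ring
    _ ≤ N ^ 6 * (((M : ℝ) ^ 4 * E) * (N * M ^ 4 + N ^ 4)) := by gcongr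
    _ = (N ^ 7 * M ^ 8 + N ^ 10 * M ^ 4) * E := by ring
    _ ≤ (N ^ 7 * M ^ 8 + N ^ 7 * M ^ 8) * E := by gcongr
    _ = _ := by ring

theorem le_of_pow_eight_le {T M N z H : ℝ} {E : ℝ} (hM : 0 < M) (hN : 0 < N) (hz : 0 < z)
    (hzN : z ≤ N) (hE : E = H ^ 256)
    (h : T ^ 8 ≤ 2 * M ^ 8 * N ^ 7 * E) :
    |T| ≤ 2 * (M * N) * z ^ (-(1 / 8) : ℝ) * H ^ 32 := by
  have hz8 : (z ^ (-(1 / 8) : ℝ)) ^ 8 = z⁻¹ := by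
    rw [← Real.rpow_natCast, ← Real.rpow_mul hz.le, ← Real.rpow_neg_one]; norm_num
  have hzp : 0 ≤ z ^ (-(1 / 8) : ℝ) := by positivity
  obtain ⟨F, hF⟩ : ∃ F, F = H ^ 32 := ⟨_, rfl⟩
  have hEF : E = F ^ 8 := by rw [hE, hF, ← pow_mul]
  have hF0 : 0 ≤ F := by rw [hF]; positivity
  rw [← hF]
  refine abs_le_of_sq_le_sq' ?_ (by positivity) |> abs_le.mpr
  refine le_of_pow_le_pow_left₀ (n := 4) (by norm_num) (by positivity) ?_
  have hN1 : N ^ 7 ≤ N ^ 8 * z⁻¹ := by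
    rw [le_mul_inv_iff₀ hz, pow_succ N 7]; gcongr
  calc (T ^ 2) ^ 4 = T ^ 8 := by ring
    _ ≤ 2 * M ^ 8 * N ^ 7 * E := h
    _ ≤ 2 * M ^ 8 * (N ^ 8 * z⁻¹) * F ^ 8 := by rw [hEF]; gcongr
    _ ≤ 256 * M ^ 8 * (N ^ 8 * z⁻¹) * F ^ 8 := by gcongr; norm_num
    _ = 256 * M ^ 8 * (N ^ 8 * (z ^ (-(1 / 8) : ℝ)) ^ 8) * F ^ 8 := by rw [hz8]
    _ = _ := by ring

theorem abs_sum_jacobiSym_le_of_le {A B : Finset ℕ} {M N : ℕ} {z H : ℝ} (hz : 0 < z)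
    (hzN : z ≤ N) (hNM : N ≤ M) (hM : 0 < M) (hH : 1 + Real.log (M ^ 4 : ℕ) ≤ H)
    (hA : ∀ a ∈ A, 0 < a ∧ a ≤ M) (hB : ∀ b ∈ B, b ≤ N ∧ Odd b ∧ Squarefree b) {α β : ℕ → ℝ}
    (hα : ∀ a, |α a| ≤ 1) (hβ : ∀ b, |β b| ≤ 1) :
    |∑ m ∈ A, ∑ n ∈ B, α m * β n * (jacobiSym m n : ℝ)| ≤
      2 * (M * N) * z ^ (-(1 / 8) : ℝ) * H ^ 32 := by
  have hl : 0 ≤ Real.log (M ^ 4 : ℕ) := Real.log_natCast_nonneg _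
  have hH0 : 0 ≤ H := by linarith
  refine le_of_pow_eight_le (by exact_mod_cast hM) (hz.trans_le hzN) hz hzN rfl ?_
  refine (sum_jacobiSym_pow_eight_le hNM hA hB hα hβ).trans ?_
  have : (1 + Real.log (M ^ 4 : ℕ)) ^ 256 ≤ H ^ 256 := pow_le_pow_left₀ (by linarith) hH _
  exact mul_le_mul_of_nonneg_left this (by positivity)

theorem abs_sum_jacobiSym_le_bilinear {A B : Finset ℕ} {M N : ℕ} {z H : ℝ} (hz : 0 < z)
    (hzM : z ≤ M) (hzN : z ≤ N) (hHM : 1 + Real.log (M ^ 4 : ℕ) ≤ H)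
    (hHN : 1 + Real.log (N ^ 4 : ℕ) ≤ H)
    (hA : ∀ a ∈ A, a ≤ M ∧ Odd a ∧ Squarefree a) (hB : ∀ b ∈ B, b ≤ N ∧ Odd b ∧ Squarefree b)
    {α β : ℕ → ℝ} (hα : ∀ a, |α a| ≤ 1) (hβ : ∀ b, |β b| ≤ 1) :
    |∑ m ∈ A, ∑ n ∈ B, α m * β n * (jacobiSym m n : ℝ)| ≤
      4 * (M * N) * z ^ (-(1 / 8) : ℝ) * H ^ 32 := by
  have hM : 0 < M := by exact_mod_cast hz.trans_le hzM
  have hN : 0 < N := by exact_mod_cast hz.trans_le hzN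
  have hl : 0 ≤ Real.log (M ^ 4 : ℕ) := Real.log_natCast_nonneg _
  have hH0 : 0 ≤ H := by linarith
  have hzp : 0 ≤ z ^ (-(1 / 8) : ℝ) := by positivity
  rcases le_total N M with h | h
  · refine (abs_sum_jacobiSym_le_of_le hz hzN h hM hHM
      (fun a ha => ⟨(hA a ha).2.2.ne_zero.bot_lt, (hA a ha).1⟩) hB hα hβ).trans ?_
    gcongr; norm_num
  · have hrec : ∑ m ∈ A, ∑ n ∈ B, α m * β n * (jacobiSym m n : ℝ) =
        ∑ n ∈ B, ∑ m ∈ A, β n * (if m % 4 = 3 then 0 else α m) * (jacobiSym n m : ℝ) +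
        ∑ n ∈ B, ∑ m ∈ A, (if n % 4 = 3 then -β n else β n) * (if m % 4 = 3 then α m else 0) *
          (jacobiSym n m : ℝ) := by
      rw [Finset.sum_comm, ← Finset.sum_add_distrib]
      refine Finset.sum_congr rfl fun n hn => ?_
      rw [← Finset.sum_add_distrib]
      refine Finset.sum_congr rfl fun m hm => ?_
      rw [← jacobiSym.quadratic_reciprocity_if (Nat.odd_iff.mp (hA m hm).2.1)
        (Nat.odd_iff.mp (hB n hn).2.1)]
      by_cases h1 : m % 4 = 3 <;> by_cases h2 : n % 4 = 3 <;>
        simp only [h1, h2, and_self, and_true, and_false, if_true, if_false] <;> push_cast <;> ring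
    rw [hrec]
    refine (abs_add_le _ _).trans ?_
    have h1 := abs_sum_jacobiSym_le_of_le hz hzM h hN hHN (α := β)
      (β := fun m => if m % 4 = 3 then 0 else α m)
      (fun a ha => ⟨(hB a ha).2.2.ne_zero.bot_lt, (hB a ha).1⟩) hA hβ
      (fun m => by split_ifs <;> simp [hα])
    have h2 := abs_sum_jacobiSym_le_of_le hz hzM h hN hHN
      (α := fun n => if n % 4 = 3 then -β n else β n)
      (β := fun m => if m % 4 = 3 then α m else 0)
      (fun a ha => ⟨(hB a ha).2.2.ne_zero.bot_lt, (hB a ha).1⟩) hA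
      (fun n => by split_ifs <;> simp [hβ]) (fun m => by split_ifs <;> simp [hα])
    refine (add_le_add h1 h2).trans (le_of_eq ?_)
    obtain ⟨F, hF⟩ : ∃ F, F = H ^ 32 := ⟨_, rfl⟩
    rw [← hF]; ring

theorem sum_card_divisors_Ioc_le {Y Z : ℕ} (hY : Y ≤ Z) :
    (∑ d ∈ Ioc Y Z, (d.divisors.card : ℝ)) ^ 2 ≤
      (Z - Y) * (Z * (1 + Real.log Z) ^ 4) := by
  refine sq_sum_le_card_mul_sum_sq.trans ?_
  rw [Nat.card_Ioc, Nat.cast_sub hY]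
  refine mul_le_mul_of_nonneg_left ?_ (sub_nonneg.mpr (by exact_mod_cast hY))
  have h := sum_card_divisors_pow_div_le Z 2
  norm_num at h
  refine le_trans ?_ (mul_le_mul_of_nonneg_left h (by positivity))
  rw [Finset.mul_sum]
  refine (Finset.sum_le_sum_of_subset_of_nonneg (Finset.Ioc_subset_Ioc_left (Nat.zero_le Y))
    fun _ _ _ => by positivity).trans ?_
  refine Finset.sum_le_sum fun k hk => ?_
  obtain ⟨hk0, hk⟩ := Finset.mem_Ioc.mp hk
  have hk0 : (0 : ℝ) < k := by exact_mod_cast hk0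
  have hk : (k : ℝ) ≤ Z := by exact_mod_cast hk
  rw [← mul_div_assoc, le_div_iff₀ hk0, mul_comm]
  gcongr

theorem card_hyperbola_excess_le (Y Z : ℕ) (f : ℕ → ℕ) (hf : ∀ a ∈ Ioc 0 Y, a * f a ≤ Z) :
    ∑ a ∈ Ioc 0 Y, ((Ioc (Y / a) (f a)).card : ℝ) ≤ ∑ d ∈ Ioc Y Z, (d.divisors.card : ℝ) := by
  have h : ∑ a ∈ Ioc 0 Y, (Ioc (Y / a) (f a)).card ≤ ∑ d ∈ Ioc Y Z, d.divisors.card := by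
    rw [← Finset.card_sigma, ← Finset.card_sigma]
    refine Finset.card_le_card_of_injOn (fun t => ⟨t.1 * t.2, t.1⟩) ?_ ?_
    · rintro ⟨a, b⟩ hab
      simp only [Finset.mem_coe, Finset.mem_sigma] at hab ⊢
      have ha := hab.1
      have hb := Finset.mem_Ioc.mp hab.2
      have ha0 := (Finset.mem_Ioc.mp ha).1
      have h1 : Y < a * b := by
        have := (Nat.div_lt_iff_lt_mul ha0).mp hb.1
        rwa [mul_comm] at this
      have h2 : a * b ≤ Z := (Nat.mul_le_mul_left a hb.2).trans (hf a ha)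
      exact ⟨Finset.mem_Ioc.mpr ⟨h1, h2⟩, Nat.mem_divisors.mpr ⟨dvd_mul_right _ _, by omega⟩⟩
    · rintro ⟨a, b⟩ hab ⟨c, d⟩ hcd heq
      simp only [Finset.mem_coe, Finset.mem_sigma] at hab hcd
      have ha0 := (Finset.mem_Ioc.mp hab.1).1
      simp only [Sigma.mk.injEq, heq_eq_eq] at heq
      obtain ⟨h1, rfl⟩ := heq
      simp [Nat.eq_of_mul_eq_mul_left ha0 h1]
  exact_mod_cast h

theorem exp_floor_mul_le {l : ℝ} (hl : 0 < l) {a : ℕ} (ha : 0 < a) :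
    Real.exp (⌊Real.log a / l⌋₊ * l) ≤ a ∧ (a : ℝ) ≤ Real.exp (⌊Real.log a / l⌋₊ * l) * Real.exp l := by
  have ha0 : (0 : ℝ) < a := by exact_mod_cast ha
  have h0 : 0 ≤ Real.log a / l := div_nonneg (Real.log_natCast_nonneg a) hl.le
  constructor
  · rw [← Real.le_log_iff_exp_le ha0, ← le_div_iff₀ hl]
    exact Nat.floor_le h0
  · rw [← Real.exp_add, ← Real.log_le_iff_le_exp ha0, ← add_one_mul, ← div_le_iff₀ hl]
    exact (Nat.lt_floor_add_one _).le

theorem abs_sum_box_le {z H E : ℝ} (hz : 1 ≤ z) {Y : ℕ} (hH : 1 + Real.log ((3 * Y) ^ 4) ≤ H)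
    {α β : ℕ → ℝ} (hα : ∀ a, |α a| ≤ 1) (hβ : ∀ b, |β b| ≤ 1)
    (hα' : ∀ a, α a ≠ 0 → z < a ∧ Odd a ∧ Squarefree a)
    (hβ' : ∀ b, β b ≠ 0 → z < b ∧ Odd b ∧ Squarefree b) (hE0 : 0 < E) (hE3 : E ≤ 3)
    (R : ℝ) (hR : 0 < R) (A : Finset ℕ) (hA : ∀ a ∈ A, a ≤ Y ∧ R ≤ a ∧ a ≤ R * E) :
    |∑ a ∈ A, ∑ b ∈ Ioc 0 ⌊Y / R⌋₊, α a * β b * (jacobiSym a b : ℝ)| ≤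
      12 * Y * z ^ (-(1 / 8) : ℝ) * H ^ 32 := by
  have hz0 : 0 < z := by linarith
  have hzp : 0 ≤ z ^ (-(1 / 8) : ℝ) := by positivity
  have heq : ∑ a ∈ A, ∑ b ∈ Ioc 0 ⌊Y / R⌋₊, α a * β b * (jacobiSym a b : ℝ) =
      ∑ a ∈ A.filter (fun a => α a ≠ 0), ∑ b ∈ (Ioc 0 ⌊Y / R⌋₊).filter (fun b => β b ≠ 0),
        α a * β b * (jacobiSym a b : ℝ) := by
    rw [Finset.sum_filter]
    refine Finset.sum_congr rfl fun a _ => ?_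
    rw [Finset.sum_filter]
    split_ifs with h
    · refine Finset.sum_congr rfl fun b _ => ?_
      split_ifs with h'
      · rfl
      · simp [not_not.mp h']
    · simp [not_not.mp h]
  have hH32 : 0 ≤ H ^ 32 := Even.pow_nonneg (by decide) H
  rw [heq]
  rcases (A.filter (fun a => α a ≠ 0)).eq_empty_or_nonempty with hAe | ⟨a, ha⟩
  · rw [hAe, Finset.sum_empty, abs_zero]; positivity
  rcases ((Ioc 0 ⌊Y / R⌋₊).filter (fun b => β b ≠ 0)).eq_empty_or_nonempty with hBe | ⟨b, hb⟩
  · rw [hBe]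
    simp only [Finset.sum_empty, Finset.sum_const_zero, abs_zero]; positivity
  obtain ⟨haA, haα⟩ := Finset.mem_filter.mp ha
  obtain ⟨hbB, hbβ⟩ := Finset.mem_filter.mp hb
  obtain ⟨haY, haR, haE⟩ := hA a haA
  have hbB := Finset.mem_Ioc.mp hbB
  have hza := (hα' a haα).1
  have hzb := (hβ' b hbβ).1
  have hY1 : (1 : ℝ) ≤ Y := by
    have : (a : ℝ) ≤ Y := by exact_mod_cast haY
    linarith
  have hzN : z ≤ (⌊Y / R⌋₊ : ℝ) := by
    have : (b : ℝ) ≤ (⌊Y / R⌋₊ : ℝ) := by exact_mod_cast hbB.2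
    linarith
  have hzM : z ≤ (⌊R * E⌋₊ : ℝ) := by
    have : (a : ℝ) ≤ (⌊R * E⌋₊ : ℝ) := by exact_mod_cast Nat.le_floor haE
    linarith
  have hMR : (⌊R * E⌋₊ : ℝ) ≤ R * E := Nat.floor_le (by positivity)
  have hNR : (⌊Y / R⌋₊ : ℝ) ≤ Y / R := Nat.floor_le (by positivity)
  have haY' : (a : ℝ) ≤ Y := by exact_mod_cast haY
  have hM3 : (⌊R * E⌋₊ : ℝ) ≤ 3 * Y := by
    calc (⌊R * E⌋₊ : ℝ) ≤ R * E := hMR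
      _ ≤ a * 3 := mul_le_mul haR hE3 hE0.le (by linarith)
      _ ≤ 3 * Y := by linarith
  have hprod : (⌊R * E⌋₊ : ℝ) * (⌊Y / R⌋₊ : ℝ) ≤ 3 * Y := by
    calc (⌊R * E⌋₊ : ℝ) * (⌊Y / R⌋₊ : ℝ) ≤ (R * E) * (Y / R) := by gcongr
      _ = E * Y := by field_simp
      _ ≤ 3 * Y := by gcongr
  have hM1 : (1 : ℝ) ≤ (⌊R * E⌋₊ : ℝ) := hz.trans hzM
  have hN1 : (1 : ℝ) ≤ (⌊Y / R⌋₊ : ℝ) := hz.trans hzN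
  have hN3 : (⌊Y / R⌋₊ : ℝ) ≤ 3 * Y := le_trans (by nlinarith) hprod
  have hlog : ∀ K : ℕ, (1 : ℝ) ≤ K → (K : ℝ) ≤ 3 * Y → 1 + Real.log (K ^ 4 : ℕ) ≤ H := by
    intro K h1 h2
    refine le_trans ?_ hH
    push_cast
    gcongr
  refine (abs_sum_jacobiSym_le_bilinear (M := ⌊R * E⌋₊) (N := ⌊Y / R⌋₊) hz0 hzM hzN
    (hlog _ hM1 hM3) (hlog _ hN1 hN3) ?_ ?_ hα hβ).trans ?_
  · intro a ha
    obtain ⟨h1, h2⟩ := Finset.mem_filter.mp ha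
    exact ⟨Nat.le_floor (hA a h1).2.2, (hα' a h2).2⟩
  · intro b hb
    obtain ⟨h1, h2⟩ := Finset.mem_filter.mp hb
    exact ⟨(Finset.mem_Ioc.mp h1).2, (hβ' b h2).2⟩
  · have : 4 * ((⌊R * E⌋₊ : ℝ) * (⌊Y / R⌋₊ : ℝ)) ≤ 12 * Y := by linarith
    gcongr

theorem abs_sum_hyperbola_le {z H : ℝ} (hz : 1 ≤ z) {Y : ℕ} (hY : 1 ≤ Y)
    (hH : 1 + Real.log ((3 * Y) ^ 4) ≤ H)
    {α β : ℕ → ℝ} (hα : ∀ a, |α a| ≤ 1) (hβ : ∀ b, |β b| ≤ 1)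
    (hα' : ∀ a, α a ≠ 0 → z < a ∧ Odd a ∧ Squarefree a)
    (hβ' : ∀ b, β b ≠ 0 → z < b ∧ Odd b ∧ Squarefree b) :
    |∑ a ∈ Ioc 0 Y, ∑ b ∈ Ioc 0 (Y / a), α a * β b * (jacobiSym a b : ℝ)| ≤
      15 * Y * H ^ 33 * z ^ (-(1 / 32) : ℝ) := by
  have hz0 : 0 < z := by linarith
  have hY1 : (1 : ℝ) ≤ Y := by exact_mod_cast hY
  have hYH : 1 + Real.log Y ≤ H := by
    refine le_trans ?_ hH
    have : (Y : ℝ) ≤ (3 * Y) ^ 4 := by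
      calc (Y : ℝ) ≤ 3 * Y := by linarith
        _ ≤ (3 * Y) ^ 4 := le_self_pow₀ (by linarith) (by norm_num)
    gcongr
  have hH1 : 1 ≤ H := by linarith [Real.log_natCast_nonneg Y]
  obtain ⟨l, hl⟩ : ∃ l, l = z ^ (-(1 / 16) : ℝ) := ⟨_, rfl⟩
  have hl0 : 0 < l := by rw [hl]; positivity
  have hl1 : l ≤ 1 := by rw [hl]; exact Real.rpow_le_one_of_one_le_of_nonpos hz (by norm_num)
  have hexp : Real.exp l - 1 ≤ 2 * l := by
    have := Real.abs_exp_sub_one_le (x := l) (by rwa [abs_of_pos hl0])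
    rw [abs_of_pos hl0] at this
    exact (le_abs_self _).trans this
  have hE3 : Real.exp l ≤ 3 := by linarith
  have hE1 : 1 ≤ Real.exp l := Real.one_le_exp hl0.le
  set i : ℕ → ℕ := fun a => ⌊Real.log a / l⌋₊ with hi
  set f : ℕ → ℕ := fun a => ⌊Y / Real.exp (i a * l)⌋₊ with hf
  set Z : ℕ := ⌊Real.exp l * Y⌋₊ with hZ
  have hYZ : Y ≤ Z := Nat.le_floor (by nlinarith)
  have hZle : (Z : ℝ) ≤ Real.exp l * Y := Nat.floor_le (by positivity)
  have hfZ : ∀ a ∈ Ioc 0 Y, a * f a ≤ Z := by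
    intro a ha
    have h2 := (exp_floor_mul_le hl0 (Finset.mem_Ioc.mp ha).1).2
    apply Nat.le_floor
    push_cast
    have h3 : (f a : ℝ) ≤ Y / Real.exp (i a * l) := Nat.floor_le (by positivity)
    calc (a : ℝ) * f a ≤ (Real.exp (i a * l) * Real.exp l) * (Y / Real.exp (i a * l)) := by gcongr
      _ = Real.exp l * Y := by field_simp
  have hfle : ∀ a ∈ Ioc 0 Y, Y / a ≤ f a := by
    intro a ha
    have ha0 : (0 : ℝ) < a := by exact_mod_cast (Finset.mem_Ioc.mp ha).1
    have h2 := (exp_floor_mul_le hl0 (Finset.mem_Ioc.mp ha).1).1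
    apply Nat.le_floor
    calc ((Y / a : ℕ) : ℝ) ≤ Y / a := Nat.cast_div_le
      _ ≤ _ := by gcongr
  have hsplit : ∑ a ∈ Ioc 0 Y, ∑ b ∈ Ioc 0 (Y / a), α a * β b * (jacobiSym a b : ℝ) =
      ∑ a ∈ Ioc 0 Y, ∑ b ∈ Ioc 0 (f a), α a * β b * (jacobiSym a b : ℝ) -
      ∑ a ∈ Ioc 0 Y, ∑ b ∈ Ioc (Y / a) (f a), α a * β b * (jacobiSym a b : ℝ) := by
    rw [← Finset.sum_sub_distrib]
    refine Finset.sum_congr rfl fun a ha => ?_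
    rw [eq_sub_iff_add_eq]
    exact Finset.sum_Ioc_consecutive _ (Nat.zero_le _) (hfle a ha)
  have hexcess : |∑ a ∈ Ioc 0 Y, ∑ b ∈ Ioc (Y / a) (f a), α a * β b * (jacobiSym a b : ℝ)| ≤
      3 * Y * H ^ 2 * z ^ (-(1 / 32) : ℝ) := by
    have h1 : |∑ a ∈ Ioc 0 Y, ∑ b ∈ Ioc (Y / a) (f a), α a * β b * (jacobiSym a b : ℝ)| ≤
        ∑ d ∈ Ioc Y Z, (d.divisors.card : ℝ) := by
      refine le_trans ?_ (card_hyperbola_excess_le Y Z f hfZ)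
      refine (Finset.abs_sum_le_sum_abs _ _).trans (Finset.sum_le_sum fun a _ => ?_)
      refine (Finset.abs_sum_le_sum_abs _ _).trans ?_
      have hcard : ((Ioc (Y / a) (f a)).card : ℝ) = ∑ b ∈ Ioc (Y / a) (f a), (1 : ℝ) := by simp
      rw [hcard]
      refine Finset.sum_le_sum fun b _ => ?_
      rw [abs_mul, abs_mul]
      exact mul_le_one₀ (mul_le_one₀ (hα _) (abs_nonneg _) (hβ _)) (abs_nonneg _)
        (abs_jacobiSym_le _ _)
    refine h1.trans (le_of_sq_le_sq ?_ (by positivity))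
    have hZ0 : (1 : ℝ) ≤ Z := by exact_mod_cast hY.trans hYZ
    have hZH : 1 + Real.log Z ≤ H := by
      refine le_trans ?_ hH
      have : (Z : ℝ) ≤ (3 * Y) ^ 4 := by
        calc (Z : ℝ) ≤ 3 * Y := hZle.trans (by gcongr)
          _ ≤ (3 * Y) ^ 4 := le_self_pow₀ (by linarith) (by norm_num)
      gcongr
    have hz16 : (z ^ (-(1 / 32) : ℝ)) ^ 2 = l := by
      rw [hl, ← Real.rpow_natCast, ← Real.rpow_mul hz0.le]; norm_num
    have hlZ : 0 ≤ 1 + Real.log (Z : ℝ) := by linarith [Real.log_natCast_nonneg Z]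
    calc _ ≤ (Z - Y : ℝ) * (Z * (1 + Real.log Z) ^ 4) := sum_card_divisors_Ioc_le hYZ
      _ ≤ (2 * l * Y) * ((3 * Y) * H ^ 4) := by
          have : (Z - Y : ℝ) ≤ 2 * l * Y := by nlinarith
          have h3 : (Z : ℝ) ≤ 3 * Y := hZle.trans (by gcongr)
          gcongr
      _ ≤ 9 * Y ^ 2 * H ^ 4 * l := by
          have : 0 ≤ (Y : ℝ) ^ 2 * H ^ 4 * l := by positivity
          nlinarith
      _ = _ := by rw [← hz16]; ring
  have hmain : |∑ a ∈ Ioc 0 Y, ∑ b ∈ Ioc 0 (f a), α a * β b * (jacobiSym a b : ℝ)| ≤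
      12 * Y * H ^ 33 * z ^ (-(1 / 32) : ℝ) := by
    set K := ⌊Real.log Y / l⌋₊ + 1 with hK
    have hmaps : ∀ a ∈ Ioc 0 Y, i a ∈ range K := by
      intro a ha
      have ha := Finset.mem_Ioc.mp ha
      have ha0 : (0 : ℝ) < a := by exact_mod_cast ha.1
      have : (a : ℝ) ≤ Y := by exact_mod_cast ha.2
      rw [Finset.mem_range, hK, Nat.lt_succ_iff]
      apply Nat.floor_le_floor
      gcongr
    rw [← Finset.sum_fiberwise_of_maps_to hmaps]
    have hKle : (K : ℝ) ≤ H * l⁻¹ := by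
      have h1 : (⌊Real.log Y / l⌋₊ : ℝ) ≤ Real.log Y / l :=
        Nat.floor_le (div_nonneg (Real.log_natCast_nonneg Y) hl0.le)
      rw [hK]; push_cast
      have h2 : (1 : ℝ) ≤ l⁻¹ := (one_le_inv₀ hl0).mpr hl1
      calc (⌊Real.log Y / l⌋₊ : ℝ) + 1 ≤ Real.log Y / l + l⁻¹ := add_le_add h1 h2
        _ = (1 + Real.log Y) * l⁻¹ := by ring
        _ ≤ H * l⁻¹ := by gcongr
    calc _ ≤ ∑ j ∈ range K, (12 * Y * z ^ (-(1 / 8) : ℝ) * H ^ 32) := by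
          refine (Finset.abs_sum_le_sum_abs _ _).trans (Finset.sum_le_sum fun j _ => ?_)
          have := abs_sum_box_le hz hH hα hβ hα' hβ' (Real.exp_pos l) hE3 (Real.exp (j * l))
            (Real.exp_pos _) ((Ioc 0 Y).filter fun a => i a = j) (by
              intro a ha
              obtain ⟨h1, h2⟩ := Finset.mem_filter.mp ha
              have h1 := Finset.mem_Ioc.mp h1
              rw [← h2]
              exact ⟨h1.2, exp_floor_mul_le hl0 h1.1⟩)
          refine le_trans (le_of_eq ?_) this
          congr 1
          refine Finset.sum_congr rfl fun a ha => ?_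
          rw [← (Finset.mem_filter.mp ha).2]
      _ = K * (12 * Y * z ^ (-(1 / 8) : ℝ) * H ^ 32) := by
          rw [Finset.sum_const, Finset.card_range, nsmul_eq_mul]
      _ ≤ (H * l⁻¹) * (12 * Y * z ^ (-(1 / 8) : ℝ) * H ^ 32) := by gcongr
      _ = 12 * Y * H ^ 33 * (l⁻¹ * z ^ (-(1 / 8) : ℝ)) := by ring
      _ = 12 * Y * H ^ 33 * z ^ (-(1 / 16) : ℝ) := by
          rw [hl, ← Real.rpow_neg hz0.le, ← Real.rpow_add hz0]; norm_num
      _ ≤ _ := by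
          have : z ^ (-(1 / 16) : ℝ) ≤ z ^ (-(1 / 32) : ℝ) :=
            Real.rpow_le_rpow_of_exponent_le hz (by norm_num)
          gcongr
  rw [hsplit]
  refine (abs_sub _ _).trans ((add_le_add hmain hexcess).trans ?_)
  have hzp : 0 ≤ z ^ (-(1 / 32) : ℝ) := by positivity
  have : H ^ 2 ≤ H ^ 33 := pow_le_pow_right₀ hH1 (by norm_num)
  calc _ ≤ 12 * Y * H ^ 33 * z ^ (-(1 / 32) : ℝ) + 3 * Y * H ^ 33 * z ^ (-(1 / 32) : ℝ) := by gcongr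
    _ = _ := by
      obtain ⟨F, hF⟩ : ∃ F, F = H ^ 33 := ⟨_, rfl⟩
      rw [← hF]; ring

theorem jacobiSym_prod_left {ι : Type*} (s : Finset ι) (f : ι → ℤ) (b : ℕ) :
    jacobiSym (∏ i ∈ s, f i) b = ∏ i ∈ s, jacobiSym (f i) b := by
  induction s using Finset.induction_on with
  | empty => simp
  | insert i s hi ih => rw [Finset.prod_insert hi, Finset.prod_insert hi, jacobiSym.mul_left, ih]

theorem jacobiSym_prod_right {ι : Type*} (s : Finset ι) (a : ℤ) {f : ι → ℕ}
    (hf : ∀ i ∈ s, f i ≠ 0) : jacobiSym a (∏ i ∈ s, f i) = ∏ i ∈ s, jacobiSym a (f i) := by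
  induction s using Finset.induction_on with
  | empty => simp
  | insert i s hi ih =>
    rw [Finset.prod_insert hi, Finset.prod_insert hi, jacobiSym.mul_right' a
      (hf i (Finset.mem_insert_self _ _))
      (Finset.prod_ne_zero_iff.mpr fun j hj => hf j (Finset.mem_insert_of_mem hj)),
      ih fun j hj => hf j (Finset.mem_insert_of_mem hj)]

section

variable {I : Type*} [Fintype I]

theorem coprime_of_squarefree_prod {D : I → ℕ} (h : Squarefree (∏ t, D t)) {u v : I}
    (huv : u ≠ v) : (D u).Coprime (D v) := by
  have h1 : D u * D v ∣ ∏ t, D t := by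
    rw [← Finset.mul_prod_erase univ D (Finset.mem_univ u)]
    exact mul_dvd_mul_left _ (Finset.dvd_prod_of_mem _ (Finset.mem_erase.mpr ⟨huv.symm, mem_univ v⟩))
  exact (Nat.squarefree_mul_iff.mp (h.squarefree_of_dvd h1)).1

theorem squarefree_of_squarefree_prod {D : I → ℕ} (h : Squarefree (∏ t, D t)) (u : I) :
    Squarefree (D u) :=
  h.squarefree_of_dvd (Finset.dvd_prod_of_mem _ (mem_univ u))

/-- The factorization `∏ u, D u` of a squarefree `n` in which `a` prescribes, for each prime
divisor of `n`, the index of the factor it divides. -/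
def facTuple (n : ℕ) (a : n.primeFactors → I) (u : I) : ℕ := ∏ p, if a p = u then (p : ℕ) else 1

/-- The product of Jacobi symbols `(D x | D y)` raised to the powers `Φ x y`. -/
def symbProd (Φ : I → I → ℕ) (D : I → ℕ) : ℝ :=
  ∏ x, ∏ y, (jacobiSym (D x) (D y) : ℝ) ^ Φ x y

/-- Tuples of positive integers with squarefree product less than `N`. -/
def tuplesLT (I : Type*) [Fintype I] (N : ℕ) : Finset (I → ℕ) :=
  (Fintype.piFinset fun _ => Ioc 0 N).filter fun D => Squarefree (∏ t, D t) ∧ ∏ t, D t < N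

theorem mem_tuplesLT {N : ℕ} {D : I → ℕ} :
    D ∈ tuplesLT I N ↔ Squarefree (∏ t, D t) ∧ ∏ t, D t < N := by
  rw [tuplesLT, Finset.mem_filter, and_iff_right_iff_imp, Fintype.mem_piFinset]
  rintro ⟨h1, h2⟩ t
  rw [Finset.mem_Ioc]
  exact ⟨(squarefree_of_squarefree_prod h1 t).ne_zero.bot_lt,
    (Nat.le_of_dvd h1.ne_zero.bot_lt (Finset.dvd_prod_of_mem _ (mem_univ t))).trans h2.le⟩

theorem prod_facTuple {n : ℕ} (hn : Squarefree n) (a : n.primeFactors → I) :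
    ∏ u, facTuple n a u = n := by
  simp only [facTuple]
  rw [Finset.prod_comm]
  simp only [Finset.prod_ite_eq, Finset.mem_univ, if_true]
  rw [Finset.prod_coe_sort n.primeFactors (fun p => p)]
  exact Nat.prod_primeFactors_of_squarefree hn

theorem dvd_facTuple_iff {J : Type*} {n : ℕ} (a : n.primeFactors → J) (p : n.primeFactors) (u : J) :
    (p : ℕ) ∣ facTuple n a u ↔ a p = u := by
  have hp := Nat.prime_of_mem_primeFactors p.2
  rw [facTuple, hp.prime.dvd_finsetProd_iff]
  constructor
  · rintro ⟨q, -, hq⟩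
    split_ifs at hq with h
    · rw [Nat.prime_dvd_prime_iff_eq hp (Nat.prime_of_mem_primeFactors q.2)] at hq
      rwa [Subtype.ext hq]
    · exact absurd (Nat.dvd_one.mp hq) hp.one_lt.ne'
  · intro h
    exact ⟨p, mem_univ _, by rw [if_pos h]⟩

theorem facTuple_injective {J : Type*} (n : ℕ) :
    Function.Injective (facTuple n : (n.primeFactors → J) → J → ℕ) := by
  intro a b hab
  funext p
  rw [eq_comm, ← dvd_facTuple_iff, ← hab, dvd_facTuple_iff]

theorem eq_of_dvd_of_dvd {D : I → ℕ} (h : Squarefree (∏ t, D t)) {p : ℕ} (hp : p.Prime) {u v : I}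
    (hu : p ∣ D u) (hv : p ∣ D v) : u = v := by
  by_contra huv
  exact Nat.not_coprime_of_dvd_of_dvd hp.one_lt hu hv (coprime_of_squarefree_prod h huv)

theorem exists_facTuple_eq {n : ℕ} {D : I → ℕ} (hn : Squarefree n) (hD : ∏ t, D t = n) :
    ∃ a, facTuple n a = D := by
  subst hD
  have : ∀ p : (∏ t, D t).primeFactors, ∃ u, (p : ℕ) ∣ D u := fun p => by
    obtain ⟨u, -, hu⟩ := (Nat.prime_of_mem_primeFactors p.2).prime.dvd_finsetProd_iff _ |>.mp
      (Nat.dvd_of_mem_primeFactors p.2)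
    exact ⟨u, hu⟩
  choose a ha using this
  refine ⟨a, funext fun u => ?_⟩
  have hiff : ∀ p : (∏ t, D t).primeFactors, a p = u ↔ (p : ℕ) ∣ D u := fun p =>
    ⟨fun h => h ▸ ha p, fun h => eq_of_dvd_of_dvd hn (Nat.prime_of_mem_primeFactors p.2) (ha p) h⟩
  have hu := squarefree_of_squarefree_prod hn u
  simp only [facTuple, hiff]
  rw [Finset.prod_coe_sort (∏ t, D t).primeFactors (fun p => if p ∣ D u then p else 1),
    ← Finset.prod_filter]
  conv_rhs => rw [← Nat.prod_primeFactors_of_squarefree hu]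
  refine Finset.prod_congr ?_ fun _ _ => rfl
  ext p
  rw [Finset.mem_filter, Nat.mem_primeFactors, Nat.mem_primeFactors]
  exact ⟨fun h => ⟨h.1.1, h.2, hu.ne_zero⟩, fun h =>
    ⟨⟨h.1, h.2.1.trans (Finset.dvd_prod_of_mem _ (mem_univ u)), hn.ne_zero⟩, h.2.1⟩⟩

theorem sum_facTuple (F : (I → ℕ) → ℝ) (N : ℕ) :
    ∑ n ∈ sqfreeLT N, ∑ a : n.primeFactors → I, F (facTuple n a) = ∑ D ∈ tuplesLT I N, F D := by
  rw [← Finset.sum_fiberwise_of_maps_to (t := sqfreeLT N) (g := fun D : I → ℕ => ∏ t, D t)]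
  · refine Finset.sum_congr rfl fun n hn => ?_
    obtain ⟨hnN, hs⟩ := mem_sqfreeLT.mp hn
    refine Finset.sum_nbij (facTuple n) ?_ ?_ ?_ fun _ _ => rfl
    · intro a _
      rw [Finset.mem_filter, mem_tuplesLT, prod_facTuple hs]
      exact ⟨⟨hs, hnN⟩, rfl⟩
    · exact (facTuple_injective n).injOn
    · intro D hD
      obtain ⟨a, ha⟩ := exists_facTuple_eq hs (Finset.mem_filter.mp hD).2
      exact ⟨a, mem_coe.mpr (mem_univ _), ha⟩
  · intro D hD
    have := mem_tuplesLT.mp hD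
    exact mem_sqfreeLT.mpr ⟨this.2, this.1⟩

theorem prod_prod_primeFactors {n : ℕ} {D : I → ℕ} (hn : Squarefree n) (hD : ∏ t, D t = n)
    (y : I → ℕ → ℝ) :
    ∏ t, ∏ p ∈ (D t).primeFactors, y t p =
      ∏ p ∈ n.primeFactors, ∏ t, if p ∣ D t then y t p else 1 := by
  subst hD
  rw [Finset.prod_comm]
  refine Finset.prod_congr rfl fun t _ => ?_
  rw [← Finset.prod_filter]
  refine Finset.prod_congr ?_ fun _ _ => rfl
  ext p
  rw [Finset.mem_filter, Nat.mem_primeFactors, Nat.mem_primeFactors]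
  exact ⟨fun h => ⟨⟨h.1, h.2.1.trans (Finset.dvd_prod_of_mem _ (mem_univ t)), hn.ne_zero⟩, h.2.1⟩,
    fun h => ⟨h.1.1, h.2, (squarefree_of_squarefree_prod hn t).ne_zero⟩⟩

theorem prod_prod_primeFactors_facTuple {n : ℕ} (hn : Squarefree n) (a : n.primeFactors → I)
    (y : I → ℕ → ℝ) :
    ∏ t, ∏ p ∈ (facTuple n a t).primeFactors, y t p = ∏ p, y (a p) p := by
  rw [prod_prod_primeFactors hn (prod_facTuple hn a), ← Finset.prod_coe_sort]
  refine Finset.prod_congr rfl fun p _ => ?_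
  simp only [dvd_facTuple_iff, Finset.prod_ite_eq, Finset.mem_univ, if_true]

theorem sum_prod_facTuple {n : ℕ} (hn : Squarefree n) (y : I → ℕ → ℝ) :
    ∑ a : n.primeFactors → I, ∏ t, ∏ p ∈ (facTuple n a t).primeFactors, y t p =
      ∏ p ∈ n.primeFactors, ∑ t, y t p := by
  simp only [prod_prod_primeFactors_facTuple hn]
  rw [← Finset.prod_coe_sort, Fintype.prod_sum]

theorem sum_tuplesLT_prod (y : I → ℕ → ℝ) (N : ℕ) :
    ∑ D ∈ tuplesLT I N, ∏ t, ∏ p ∈ (D t).primeFactors, y t p =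
      ∑ n ∈ sqfreeLT N, ∏ p ∈ n.primeFactors, ∑ t, y t p := by
  rw [← sum_facTuple]
  exact Finset.sum_congr rfl fun n hn => sum_prod_facTuple (mem_sqfreeLT.mp hn).2 y

theorem prod_primeFactors_prod {D : I → ℕ} (h : Squarefree (∏ t, D t)) (y : ℕ → ℝ) :
    ∏ p ∈ (∏ t, D t).primeFactors, y p = ∏ t, ∏ p ∈ (D t).primeFactors, y p := by
  rw [prod_prod_primeFactors h rfl (fun _ p => y p)]
  refine Finset.prod_congr rfl fun p hp => ?_
  have hpp := Nat.prime_of_mem_primeFactors hp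
  obtain ⟨u, -, hu⟩ := hpp.prime.dvd_finsetProd_iff _ |>.mp (Nat.dvd_of_mem_primeFactors hp)
  rw [Finset.prod_eq_single u, if_pos hu]
  · exact fun v _ hv => if_neg fun h' => hv (eq_of_dvd_of_dvd h hpp h' hu)
  · simp

theorem symbProd_facTuple (Φ : I → I → ℕ) {n : ℕ} (a : n.primeFactors → I) :
    symbProd Φ (facTuple n a) =
      ∏ p : n.primeFactors, ∏ q : n.primeFactors, (jacobiSym (p : ℕ) (q : ℕ) : ℝ) ^ Φ (a p) (a q) := by
  have h : ∀ x y, (jacobiSym (facTuple n a x) (facTuple n a y) : ℝ) =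
      ∏ p : n.primeFactors, ∏ q : n.primeFactors, if a p = x then if a q = y then (jacobiSym (p : ℕ) (q : ℕ) : ℝ) else 1 else 1 := by
    intro x y
    conv_lhs => rw [facTuple]
    push_cast
    rw [jacobiSym_prod_left]
    push_cast
    refine Finset.prod_congr rfl fun p _ => ?_
    rw [facTuple, jacobiSym_prod_right]
    · push_cast
      refine Finset.prod_congr rfl fun q _ => ?_
      split_ifs <;> simp
    · intro q _
      split_ifs
      · exact (Nat.prime_of_mem_primeFactors q.2).ne_zero
      · exact one_ne_zero
  calc symbProd Φ (facTuple n a) = ∏ x, ∏ y, ∏ p : n.primeFactors, ∏ q : n.primeFactors,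
        (if a p = x then if a q = y then (jacobiSym (p : ℕ) (q : ℕ) : ℝ) ^ Φ x y else 1 else 1) := by
        refine Finset.prod_congr rfl fun x _ => Finset.prod_congr rfl fun y _ => ?_
        rw [h, ← Finset.prod_pow]
        refine Finset.prod_congr rfl fun p _ => ?_
        rw [← Finset.prod_pow]
        refine Finset.prod_congr rfl fun q _ => ?_
        split_ifs <;> simp
    _ = ∏ p : n.primeFactors, ∏ q : n.primeFactors, ∏ x, ∏ y,
        (if a p = x then if a q = y then (jacobiSym (p : ℕ) (q : ℕ) : ℝ) ^ Φ x y else 1 else 1) := by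
        simp_rw [Finset.prod_comm (s := (univ : Finset I)) (t := (univ : Finset n.primeFactors))]
    _ = _ := by
        refine Finset.prod_congr rfl fun p _ => Finset.prod_congr rfl fun q _ => ?_
        rw [Finset.prod_eq_single (a p), Finset.prod_eq_single (a q)]
        · simp
        · intro y _ hy; rw [if_pos rfl, if_neg hy.symm]
        · simp
        · intro x _ hx; exact Finset.prod_eq_one fun y _ => if_neg hx.symm
        · simp

end

section

variable {I : Type*} [Fintype I]

theorem chi_three_mod_four {n : ℕ} (h : n % 4 = 3) : oddChar true 1 n = -1 := by
  simp [oddChar_apply, ZMod.χ₄_nat_three_mod_four h]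

theorem chi_one_mod_four {n : ℕ} (h : n % 4 = 1) : oddChar true 1 n = 1 := by
  simp [oddChar_apply, ZMod.χ₄_nat_one_mod_four h]

theorem abs_sum_mul_residues_le (A : Finset (I → ℕ)) (g : (I → ℕ) → ℝ) (κ : Finset I → ℝ)
    (hκ : ∀ R, |κ R| ≤ 1) (hg : ∀ D ∈ A, g D ≠ 0 → ∀ t, Odd (D t)) :
    |∑ D ∈ A, g D * κ (univ.filter fun t => D t % 4 = 3)| ≤
      ∑ T : Finset I, |∑ D ∈ A, g D * ∏ t ∈ T, oddChar true 1 (D t)| := by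
  have hind : ∀ D ∈ A, g D * κ (univ.filter fun t => D t % 4 = 3) =
      ∑ R : Finset I, ∑ T : Finset I, (κ R * (∏ t ∈ T, if t ∈ R then -1 else 1) *
        (2⁻¹ : ℝ) ^ Fintype.card I) * (g D * ∏ t ∈ T, oddChar true 1 (D t)) := by
    intro D hD
    by_cases hgD : g D = 0
    · simp [hgD]
    have hodd := hg D hD hgD
    have hR : ∀ R : Finset I, ∑ T : Finset I, (κ R * (∏ t ∈ T, if t ∈ R then -1 else 1) *
        (2⁻¹ : ℝ) ^ Fintype.card I) * (g D * ∏ t ∈ T, oddChar true 1 (D t)) =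
        κ R * g D * ∏ t, ((1 + (if t ∈ R then -1 else 1) * oddChar true 1 (D t)) * 2⁻¹) := by
      intro R
      rw [Finset.prod_mul_distrib, Finset.prod_one_add, Finset.prod_const, Finset.powerset_univ,
        Finset.sum_mul, Finset.mul_sum, Finset.card_univ]
      refine Finset.sum_congr rfl fun T _ => ?_
      rw [Finset.prod_mul_distrib]
      ring
    rw [Finset.sum_congr rfl fun R _ => hR R,
      Finset.sum_eq_single (univ.filter fun t => D t % 4 = 3)]
    · rw [Finset.prod_eq_one, mul_one, mul_comm]
      intro t _
      rcases Nat.odd_mod_four_iff.mp (Nat.odd_iff.mp (hodd t)) with h | h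
      · rw [chi_one_mod_four h, if_neg (by simp [h])]; norm_num
      · rw [chi_three_mod_four h, if_pos (by simp [h])]; norm_num
    · intro R _ hR
      rw [mul_eq_zero]; right
      obtain ⟨t, ht⟩ : ∃ t, ¬(t ∈ R ↔ D t % 4 = 3) := by
        by_contra! h
        exact hR (Finset.ext fun t => by simp [h t])
      refine Finset.prod_eq_zero (mem_univ t) ?_
      rcases Nat.odd_mod_four_iff.mp (Nat.odd_iff.mp (hodd t)) with h | h
      · rw [chi_one_mod_four h, if_pos (by by_contra h'; exact ht (by simp [h', h]))]; norm_num
      · rw [chi_three_mod_four h, if_neg (fun h' => ht (by simp [h', h]))]; norm_num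
    · simp
  rw [Finset.sum_congr rfl hind, Finset.sum_comm]
  have h2 : ∀ R : Finset I, |∑ D ∈ A, ∑ T : Finset I, (κ R * (∏ t ∈ T, if t ∈ R then -1 else 1) *
        (2⁻¹ : ℝ) ^ Fintype.card I) * (g D * ∏ t ∈ T, oddChar true 1 (D t))| ≤
        (2⁻¹ : ℝ) ^ Fintype.card I *
          ∑ T : Finset I, |∑ D ∈ A, g D * ∏ t ∈ T, oddChar true 1 (D t)| := by
    intro R
    rw [Finset.sum_comm, Finset.mul_sum]
    refine (Finset.abs_sum_le_sum_abs _ _).trans (Finset.sum_le_sum fun T _ => ?_)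
    rw [← Finset.mul_sum, abs_mul]
    refine mul_le_mul_of_nonneg_right ?_ (abs_nonneg _)
    rw [abs_mul, abs_mul, abs_of_pos (by positivity : (0 : ℝ) < 2⁻¹ ^ Fintype.card I),
      Finset.abs_prod, Finset.prod_eq_one (fun t _ => by split_ifs <;> simp), mul_one]
    exact mul_le_of_le_one_left (by positivity) (hκ R)
  refine (Finset.abs_sum_le_sum_abs _ _).trans ((Finset.sum_le_sum fun R _ => h2 R).trans ?_)
  rw [Finset.sum_const, Finset.card_univ, Fintype.card_finset, nsmul_eq_mul, ← mul_assoc]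
  push_cast
  rw [← mul_pow]
  norm_num

/-- The sign in quadratic reciprocity, as a function of the set of indices of entries `≡ 3 mod 4`. -/
def recipSign (R : Finset I) (x y : I) : ℝ := if x ∈ R ∧ y ∈ R then -1 else 1

theorem jacobiSym_eq_recipSign_mul {D : I → ℕ} (hD : ∀ t, Odd (D t)) (x y : I) :
    (jacobiSym (D y) (D x) : ℝ) =
      recipSign (univ.filter fun t => D t % 4 = 3) x y * jacobiSym (D x) (D y) := by
  rw [← jacobiSym.quadratic_reciprocity_if (Nat.odd_iff.mp (hD y)) (Nat.odd_iff.mp (hD x)),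
    recipSign]
  simp only [Finset.mem_filter, Finset.mem_univ, true_and]
  by_cases h : D x % 4 = 3 ∧ D y % 4 = 3
  · rw [if_pos h, if_pos ⟨h.2, h.1⟩]; push_cast; ring
  · rw [if_neg h, if_neg fun h' => h ⟨h'.2, h'.1⟩, one_mul]

theorem symbProd_eq_recipSign_mul {Φ : I → I → ℕ} (hΦ : ∀ x, Φ x x = 0) {rk : I → ℕ}
    (hrk : Function.Injective rk) {D : I → ℕ} (hD : ∀ t, Odd (D t)) :
    symbProd Φ D = (∏ x, ∏ y, if rk x < rk y then (jacobiSym (D x) (D y) : ℝ) ^ (Φ x y + Φ y x)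
      else 1) * ∏ x, ∏ y, if rk x < rk y then
        recipSign (univ.filter fun t => D t % 4 = 3) x y ^ Φ y x else 1 := by
  have h1 : symbProd Φ D = (∏ x, ∏ y, if rk x < rk y then
      (jacobiSym (D x) (D y) : ℝ) ^ Φ x y else 1) *
      ∏ x, ∏ y, if rk y < rk x then (jacobiSym (D x) (D y) : ℝ) ^ Φ x y else 1 := by
    rw [symbProd, ← Finset.prod_mul_distrib]
    refine Finset.prod_congr rfl fun x _ => ?_
    rw [← Finset.prod_mul_distrib]
    refine Finset.prod_congr rfl fun y _ => ?_
    rcases lt_trichotomy (rk x) (rk y) with h | h | h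
    · rw [if_pos h, if_neg h.asymm, mul_one]
    · rw [hrk h, hΦ]; simp
    · rw [if_pos h, if_neg h.asymm, one_mul]
  rw [h1, Finset.prod_comm (f := fun x y => if rk y < rk x then
    (jacobiSym (D x) (D y) : ℝ) ^ Φ x y else 1), ← Finset.prod_mul_distrib,
    ← Finset.prod_mul_distrib]
  refine Finset.prod_congr rfl fun x _ => ?_
  rw [← Finset.prod_mul_distrib, ← Finset.prod_mul_distrib]
  refine Finset.prod_congr rfl fun y _ => ?_
  split_ifs
  · rw [jacobiSym_eq_recipSign_mul hD x y, mul_pow, pow_add]; ring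
  · rfl

theorem abs_prod_recipSign_le (Φ : I → I → ℕ) (rk : I → ℕ) (R : Finset I) :
    |∏ x, ∏ y, if rk x < rk y then recipSign R x y ^ Φ y x else 1| ≤ 1 := by
  rw [Finset.abs_prod]
  refine (Finset.prod_eq_one fun x _ => ?_).le
  rw [Finset.abs_prod]
  refine Finset.prod_eq_one fun y _ => ?_
  rw [recipSign]
  split_ifs <;> simp

theorem sum_tuplesLT_split (S : Finset I) (F : (I → ℕ) → ℝ) (N : ℕ) :
    ∑ D ∈ tuplesLT I N, F D =
      ∑ E ∈ (tuplesLT I N).filter (fun E => ∀ t ∈ S, E t = 1),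
        ∑ D ∈ (tuplesLT I N).filter (fun D => ∀ t ∉ S, D t = 1),
          if E * D ∈ tuplesLT I N then F (E * D) else 0 := by
  rw [← Finset.sum_product', ← Finset.sum_filter]
  symm
  refine Finset.sum_nbij' (fun P => P.1 * P.2)
    (fun D => (fun t => if t ∈ S then 1 else D t, fun t => if t ∈ S then D t else 1)) ?_ ?_ ?_ ?_ ?_
  · intro P hP; exact (Finset.mem_filter.mp hP).2
  · intro D hD
    have heq : (fun t => if t ∈ S then 1 else D t) * (fun t => if t ∈ S then D t else 1) = D := by
      funext t; simp only [Pi.mul_apply]; split_ifs <;> simp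
    have hp : (∏ t, if t ∈ S then 1 else D t) * (∏ t, if t ∈ S then D t else 1) = ∏ t, D t := by
      rw [← Finset.prod_mul_distrib]
      exact Finset.prod_congr rfl fun t _ => congrFun heq t
    obtain ⟨hs, hN⟩ := mem_tuplesLT.mp hD
    simp only [Finset.mem_filter, Finset.mem_product, heq]
    refine ⟨⟨⟨?_, fun t ht => by simp [ht]⟩, ?_, fun t ht => by simp [ht]⟩, hD⟩
    · rw [mem_tuplesLT]
      have hd := Dvd.intro _ hp
      exact ⟨hs.squarefree_of_dvd hd, (Nat.le_of_dvd hs.ne_zero.bot_lt hd).trans_lt hN⟩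
    · rw [mem_tuplesLT]
      have hd := Dvd.intro_left _ hp
      exact ⟨hs.squarefree_of_dvd hd, (Nat.le_of_dvd hs.ne_zero.bot_lt hd).trans_lt hN⟩
  · intro P hP
    obtain ⟨hP, -⟩ := Finset.mem_filter.mp hP
    obtain ⟨h1, h2⟩ := Finset.mem_product.mp hP
    have h1 := (Finset.mem_filter.mp h1).2
    have h2 := (Finset.mem_filter.mp h2).2
    refine Prod.ext (funext fun t => ?_) (funext fun t => ?_)
    · by_cases ht : t ∈ S
      · simp [ht, h1 t ht]
      · simp [ht, h2 t ht]
    · by_cases ht : t ∈ S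
      · simp [ht, h1 t ht]
      · simp [ht, h2 t ht]
  · intro D _
    funext t; simp only [Pi.mul_apply]; split_ifs <;> simp
  · intro P _; rfl

/-- The indices of the entries exceeding `z`. -/
def bigSet (z : ℕ) (D : I → ℕ) : Finset I := univ.filter fun t => z < D t

/-- The indices of the entries different from `1`. -/
def suppSet (D : I → ℕ) : Finset I := univ.filter fun t => D t ≠ 1

theorem exists_sum_bigSet_subset_le (I : Type*) [Fintype I] {m : ℝ} (hm : 1 ≤ m) :
    ∃ C : ℝ, 0 < C ∧ ∀ N z : ℕ, 2 ≤ N → 2 ≤ z → ∀ B : Finset I, (B.card : ℝ) + 1 ≤ m →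
      ∑ D ∈ (tuplesLT I N).filter (fun D => bigSet z D ⊆ B),
        ∏ _p ∈ (∏ t, D t).primeFactors, m⁻¹ ≤
      C * N * Real.exp (Fintype.card I + 1) ^ Real.log (Real.log z) *
        Real.exp (-(m⁻¹ * ∑ p ∈ Nat.primesLE N, (1 : ℝ) / p)) := by
  obtain ⟨C, hC, h⟩ := exists_sum_sqfree_le (M := (Fintype.card I : ℝ)) (by positivity)
  obtain ⟨C', hC'⟩ := exists_sum_primesLE_inv_le
  refine ⟨C * Real.exp ((Fintype.card I + 1) * C'), by positivity, fun N z hN hz B hB => ?_⟩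
  have hm0 : 0 < m := by linarith
  have hmi : m⁻¹ ≤ 1 := inv_le_one_of_one_le₀ hm
  have hmi0 : 0 < m⁻¹ := by positivity
  set y : I → ℕ → ℝ := fun t p => if t ∈ B ∨ p ≤ z then m⁻¹ else 0 with hy
  have hy0 : ∀ t p, 0 ≤ y t p := fun t p => by rw [hy]; dsimp only; split_ifs <;> positivity
  have hY0 : ∀ p, 0 ≤ ∑ t, y t p := fun p => Finset.sum_nonneg fun t _ => hy0 t p
  have hY1 : ∀ p, ∑ t, y t p ≤ Fintype.card I := fun p => by
    calc ∑ t, y t p ≤ ∑ t : I, (1 : ℝ) := Finset.sum_le_sum fun t _ => by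
          rw [hy]; dsimp only; split_ifs <;> linarith
      _ = _ := by simp
  have hY2 : ∀ p, z < p → ∑ t, y t p ≤ 1 - m⁻¹ := fun p hp => by
    have : ∑ t, y t p = B.card * m⁻¹ := by
      simp only [hy, not_le.mpr hp, or_false]
      rw [Finset.sum_ite_mem, Finset.univ_inter, Finset.sum_const, nsmul_eq_mul]
    rw [this]
    calc (B.card : ℝ) * m⁻¹ ≤ (m - 1) * m⁻¹ := by gcongr; linarith
      _ = _ := by rw [sub_mul, mul_inv_cancel₀ hm0.ne', one_mul]
  have hstep : ∑ D ∈ (tuplesLT I N).filter (fun D => bigSet z D ⊆ B),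
      ∏ _p ∈ (∏ t, D t).primeFactors, m⁻¹ ≤ ∑ n ∈ sqfreeLT N, ∏ p ∈ n.primeFactors, ∑ t, y t p := by
    rw [← sum_tuplesLT_prod]
    calc _ = ∑ D ∈ (tuplesLT I N).filter (fun D => bigSet z D ⊆ B),
          ∏ t, ∏ p ∈ (D t).primeFactors, y t p := by
          refine Finset.sum_congr rfl fun D hD => ?_
          obtain ⟨hD, hDB⟩ := Finset.mem_filter.mp hD
          rw [prod_primeFactors_prod (mem_tuplesLT.mp hD).1 fun _ => m⁻¹]
          refine Finset.prod_congr rfl fun t _ => Finset.prod_congr rfl fun p hp => ?_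
          rw [hy]; dsimp only
          rw [if_pos]
          by_cases ht : t ∈ B
          · exact Or.inl ht
          · right
            have : ¬ z < D t := fun h' => ht (hDB (by simp [bigSet, h']))
            exact (Nat.le_of_mem_primeFactors hp).trans (not_lt.mp this)
      _ ≤ _ := Finset.sum_le_sum_of_subset_of_nonneg (Finset.filter_subset _ _) fun D _ _ =>
          Finset.prod_nonneg fun t _ => Finset.prod_nonneg fun p _ => hy0 t p
  refine hstep.trans ((h _ (fun p _ => hY0 p) (fun p _ => hY1 p) N hN).trans ?_)
  have hexp : -∑ p ∈ Nat.primesLE N, (1 - ∑ t, y t p) / p ≤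
      (Fintype.card I + 1) * (Real.log (Real.log z) + C') -
        m⁻¹ * ∑ p ∈ Nat.primesLE N, (1 : ℝ) / p := by
    have h3 : ∑ p ∈ (Nat.primesLE N).filter (· ≤ z), (1 : ℝ) / p ≤ Real.log (Real.log z) + C' := by
      refine le_trans (Finset.sum_le_sum_of_subset_of_nonneg ?_ fun _ _ _ => by positivity) (hC' z hz)
      intro p hp
      rw [Finset.mem_filter, Nat.mem_primesLE] at hp
      exact Nat.mem_primesLE.mpr ⟨hp.2, hp.1.2⟩
    have h4 : ∑ p ∈ Nat.primesLE N, (m⁻¹ / p - if p ≤ z then ((Fintype.card I + 1 : ℝ)) * (1 / p) else 0) ≤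
        ∑ p ∈ Nat.primesLE N, (1 - ∑ t, y t p) / p := by
      refine Finset.sum_le_sum fun p _ => ?_
      split_ifs with hp
      · have := hY1 p
        rw [mul_one_div, ← sub_div]
        gcongr
        linarith
      · have := hY2 p (not_le.mp hp)
        rw [sub_zero]
        gcongr
        linarith
    rw [Finset.sum_sub_distrib, ← Finset.sum_filter, ← Finset.mul_sum] at h4
    have h5 : ((Fintype.card I : ℝ) + 1) * ∑ p ∈ (Nat.primesLE N).filter (· ≤ z), (1 : ℝ) / p ≤
        (Fintype.card I + 1) * (Real.log (Real.log z) + C') := by gcongr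
    have h6 : ∑ p ∈ Nat.primesLE N, m⁻¹ / p = m⁻¹ * ∑ p ∈ Nat.primesLE N, (1 : ℝ) / p := by
      rw [Finset.mul_sum]; exact Finset.sum_congr rfl fun p _ => by ring
    linarith
  calc C * N * Real.exp (-∑ p ∈ Nat.primesLE N, (1 - ∑ t, y t p) / p)
      ≤ C * N * Real.exp ((Fintype.card I + 1) * (Real.log (Real.log z) + C') -
        m⁻¹ * ∑ p ∈ Nat.primesLE N, (1 : ℝ) / p) := by gcongr
    _ = _ := by
        rw [← Real.exp_mul, mul_add, sub_eq_add_neg, Real.exp_add, Real.exp_add]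
        ring

end

section

variable {I : Type*} [Fintype I]

theorem prod_primeFactors_apply (f : ℕ →* ℝ) {n : ℕ} (hn : Squarefree n) :
    ∏ p ∈ n.primeFactors, f p = f n := by
  rw [← map_prod, Nat.prod_primeFactors_of_squarefree hn]

theorem sum_piFinset_inv_le (z : ℕ) :
    ∑ E ∈ Fintype.piFinset (fun _ : I => Ioc 0 z), ((∏ t, E t : ℕ) : ℝ)⁻¹ ≤
      (1 + Real.log z) ^ Fintype.card I := by
  have h : ∑ i ∈ Ioc 0 z, ((i : ℝ))⁻¹ ≤ 1 + Real.log z := by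
    have := harmonic_le_one_add_log z
    rw [harmonic_eq_sum_Icc] at this
    push_cast at this
    exact this
  calc _ = ∏ _t : I, ∑ i ∈ Ioc 0 z, ((i : ℝ))⁻¹ := by
        rw [Finset.prod_univ_sum]
        refine Finset.sum_congr rfl fun E _ => ?_
        push_cast
        rw [Finset.prod_inv_distrib]
    _ ≤ ∏ _t : I, (1 + Real.log z) :=
        Finset.prod_le_prod (fun _ _ => Finset.sum_nonneg fun _ _ => by positivity) fun _ _ => h
    _ = _ := by simp

/-- The Jacobi symbol `(· | b)` on natural numbers. -/
def jacobiHom (b : ℕ) : ℕ →* ℝ where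
  toFun n := (jacobiSym n b : ℝ)
  map_one' := by simp [jacobiSym.one_left]
  map_mul' m n := by rw [Nat.cast_mul, jacobiSym.mul_left]; push_cast; rfl

/-- The character attached to the index `t ∈ S` when the entries outside `S` are fixed to be `E`. -/
def cellHom (Φ : I → I → ℕ) (S T : Finset I) (E : I → ℕ) (t : I) : ℕ →* ℝ :=
  (if t ∈ T then (oddChar true 1 : ℕ →* ℝ) else 1) *
    ∏ x ∈ Sᶜ, jacobiHom (E x) ^ (Φ t x + Φ x t)

theorem cellHom_apply (Φ : I → I → ℕ) (S T : Finset I) (E : I → ℕ) (t : I) (n : ℕ) :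
    cellHom Φ S T E t n = (if t ∈ T then oddChar true 1 n else 1) *
      ∏ x ∈ Sᶜ, (jacobiSym n (E x) : ℝ) ^ (Φ t x + Φ x t) := by
  rw [cellHom, MonoidHom.mul_apply, MonoidHom.finsetProd_apply]
  congr 1
  split_ifs <;> rfl

theorem abs_cellHom_le (Φ : I → I → ℕ) (S T : Finset I) (E : I → ℕ) (t : I) (n : ℕ) :
    |cellHom Φ S T E t n| ≤ 1 := by
  rw [cellHom_apply, abs_mul, Finset.abs_prod]
  refine mul_le_one₀ ?_ (Finset.prod_nonneg fun _ _ => abs_nonneg _)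
    (Finset.prod_le_one (fun _ _ => abs_nonneg _) fun x _ => ?_)
  · split_ifs
    · exact abs_oddChar_le _ _ _
    · simp
  · rw [abs_pow]; exact pow_le_one₀ (abs_nonneg _) (abs_jacobiSym_le _ _)

theorem pow_eq_ite_of_sq_eq_one {a : ℝ} (ha : a ^ 2 = 1) (e : ℕ) :
    a ^ e = if Odd e then a else 1 := by
  split_ifs with h
  · obtain ⟨k, rfl⟩ := h
    rw [pow_add, pow_mul, ha]; simp
  · obtain ⟨k, rfl⟩ := Nat.not_odd_iff_even.mp h
    rw [← two_mul, pow_mul, ha]; simp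

theorem jacobiSym_cast_sq_eq_one {a b : ℕ} (h : a.Coprime b) : (jacobiSym a b : ℝ) ^ 2 = 1 := by
  have := jacobiSym.sq_one (a := a) (b := b) (by simpa [Int.gcd_natCast_natCast] using h)
  exact_mod_cast this

theorem cellHom_mul_cellHom (Φ : I → I → ℕ) (S T : Finset I) {E : I → ℕ} (v w : I) {p : ℕ}
    (hE : ∀ t, E t ≠ 0) (hp : p.Prime) (h2 : p ≠ 2) (hpE : ¬ p ∣ ∏ t, E t) :
    cellHom Φ S T E v p * cellHom Φ S T E w p =
      oddChar (decide ¬(v ∈ T ↔ w ∈ T))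
        (∏ x ∈ Sᶜ with Odd (Φ x v + Φ v x + Φ x w + Φ w x), E x) p := by
  have hχ : oddChar true 1 p ^ 2 = 1 := by
    rcases Nat.odd_mod_four_iff.mp (Nat.odd_iff.mp (hp.odd_of_ne_two h2)) with h | h
    · rw [chi_one_mod_four h]; norm_num
    · rw [chi_three_mod_four h]; norm_num
  have hχ' : ((ZMod.χ₄ p : ℤ) : ℝ) = oddChar true 1 p := by simp [oddChar_apply]
  have hJ : ∀ x, (jacobiSym p (E x) : ℝ) ^ 2 = 1 := fun x =>
    jacobiSym_cast_sq_eq_one ((Nat.Prime.coprime_iff_not_dvd hp).mpr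
      fun h => hpE (h.trans (Finset.dvd_prod_of_mem _ (mem_univ x))))
  rw [cellHom_apply, cellHom_apply, oddChar_apply (decide _), jacobiSym_prod_right _ _ (fun x _ => hE x),
    mul_mul_mul_comm, ← Finset.prod_mul_distrib]
  congr 1
  · rw [← hχ'] at hχ ⊢
    obtain ⟨c, hc⟩ : ∃ c : ℤ, c = ZMod.χ₄ p := ⟨_, rfl⟩
    rw [← hc] at hχ ⊢
    by_cases hv : v ∈ T <;> by_cases hw : w ∈ T <;> simp [hv, hw, ← sq, hχ]
  · push_cast
    rw [Finset.prod_filter]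
    refine Finset.prod_congr rfl fun x _ => ?_
    rw [← pow_add, pow_eq_ite_of_sq_eq_one (hJ x)]
    congr 2
    ring

theorem abs_add_le_one_add_mul {a b : ℝ} (ha : |a| ≤ 1) (hb : |b| ≤ 1) : |a + b| ≤ 1 + a * b := by
  rw [abs_le] at *
  constructor <;> nlinarith

/-- The weight of a prime `p` in the factor indexed by `t ∈ S`. -/
def cellWeight (Φ : I → I → ℕ) (θ : ℕ →*₀ ℝ) (m : ℝ) (S T : Finset I) (E : I → ℕ) (t : I) (p : ℕ) :
    ℝ :=
  if t ∈ S ∧ ¬ p ∣ ∏ t, E t then m⁻¹ * (θ p * cellHom Φ S T E t p) else 0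

theorem abs_sum_cellWeight_le (Φ : I → I → ℕ) {θ : ℕ →*₀ ℝ} (hθ : ∀ n, |θ n| ≤ 1) (hθ2 : θ 2 = 0)
    {m : ℕ} (S T : Finset I) (hS : S.card = m) {E : I → ℕ} (hE : ∀ t, E t ≠ 0) {v w : I}
    (hv : v ∈ S) (hw : w ∈ S) (hvw : v ≠ w) {p : ℕ} (hp : p.Prime) :
    |∑ t, cellWeight Φ θ m S T E t p| ≤ 1 - (m : ℝ)⁻¹ * (1 - oddChar (decide ¬(v ∈ T ↔ w ∈ T))
        (∏ x ∈ Sᶜ with Odd (Φ x v + Φ v x + Φ x w + Φ w x), E x) p) := by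
  have hm2 : 2 ≤ m := by
    rw [← hS, ← Finset.card_pair hvw]
    exact Finset.card_le_card (by intro x; simp only [Finset.mem_insert, Finset.mem_singleton]; rintro (rfl | rfl) <;> assumption)
  have hm0 : (0 : ℝ) < m := by norm_cast; omega
  have hm2' : (2 : ℝ) ≤ m := by exact_mod_cast hm2
  set ψ := oddChar (decide ¬(v ∈ T ↔ w ∈ T))
        (∏ x ∈ Sᶜ with Odd (Φ x v + Φ v x + Φ x w + Φ w x), E x) p with hψ
  have hψ1 : |ψ| ≤ 1 := abs_oddChar_le _ _ _
  have htriv : 0 ≤ 1 - (m : ℝ)⁻¹ * (1 - ψ) := by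
    have h1 : (m : ℝ)⁻¹ * (1 - ψ) ≤ (m : ℝ)⁻¹ * m := by
      gcongr; linarith [(abs_le.mp hψ1).1]
    rw [inv_mul_cancel₀ hm0.ne'] at h1
    linarith
  by_cases hpq : p ∣ ∏ t, E t
  · simp only [cellWeight, hpq, not_true, and_false, if_false, Finset.sum_const_zero, abs_zero]
    exact htriv
  by_cases h2 : p = 2
  · simp only [cellWeight, h2, hθ2, zero_mul, mul_zero, ite_self, Finset.sum_const_zero, abs_zero]
    exact htriv
  have heq : ∑ t, cellWeight Φ θ m S T E t p =
      (m : ℝ)⁻¹ * (θ p * ∑ t ∈ S, cellHom Φ S T E t p) := by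
    simp only [cellWeight, hpq, not_false_iff, and_true]
    rw [Finset.sum_ite_mem, Finset.univ_inter, Finset.mul_sum, Finset.mul_sum]
  have hsum : |∑ t ∈ S, cellHom Φ S T E t p| ≤ (m : ℝ) - (1 - ψ) := by
    rw [← Finset.add_sum_erase S _ hv, ← Finset.add_sum_erase (S.erase v) _
      (Finset.mem_erase.mpr ⟨hvw.symm, hw⟩), ← add_assoc]
    refine (abs_add_le _ _).trans ?_
    have h1 := abs_add_le_one_add_mul (abs_cellHom_le Φ S T E v p) (abs_cellHom_le Φ S T E w p)
    rw [cellHom_mul_cellHom Φ S T v w hE hp h2 hpq, ← hψ] at h1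
    have h3 : |∑ t ∈ (S.erase v).erase w, cellHom Φ S T E t p| ≤ m - 2 := by
      refine (Finset.abs_sum_le_sum_abs _ _).trans
        ((Finset.sum_le_sum fun t _ => abs_cellHom_le Φ S T E t p).trans ?_)
      rw [Finset.sum_const, nsmul_one, Finset.card_erase_of_mem (Finset.mem_erase.mpr ⟨hvw.symm, hw⟩),
        Finset.card_erase_of_mem hv, hS, Nat.sub_sub, Nat.cast_sub hm2]
      norm_num
    linarith
  rw [heq, abs_mul, abs_mul, abs_of_pos (inv_pos.mpr hm0)]
  calc (m : ℝ)⁻¹ * (|θ p| * |∑ t ∈ S, cellHom Φ S T E t p|)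
      ≤ (m : ℝ)⁻¹ * (1 * (m - (1 - ψ))) := by
        gcongr
        exact hθ p
    _ = _ := by rw [one_mul, mul_sub, inv_mul_cancel₀ hm0.ne']

end

section

variable {I : Type*} [Fintype I]

/-- The part of a summand that remains after quadratic reciprocity has been used to order the
symbols according to `rk`, twisted by the characters mod `4` of the entries in `T`. -/
def orderedTerm (Φ : I → I → ℕ) (θ : ℕ →*₀ ℝ) (m : ℝ) (rk : I → ℕ) (T : Finset I) (D : I → ℕ) : ℝ :=
  θ (∏ t, D t) * (∏ _p ∈ (∏ t, D t).primeFactors, m⁻¹) *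
    (∏ x, ∏ y, if rk x < rk y then (jacobiSym (D x) (D y) : ℝ) ^ (Φ x y + Φ y x) else 1) *
    ∏ t ∈ T, oddChar true 1 (D t)

theorem prod_cellWeight (Φ : I → I → ℕ) (θ : ℕ →*₀ ℝ) (m : ℝ) (S T : Finset I) {E D : I → ℕ}
    (hD : ∀ t ∉ S, D t = 1) (hs : Squarefree (∏ t, (E * D) t)) :
    ∏ t, ∏ p ∈ (D t).primeFactors, cellWeight Φ θ m S T E t p =
      (∏ t, ∏ _p ∈ (D t).primeFactors, m⁻¹) * θ (∏ t, D t) * (∏ t ∈ T, oddChar true 1 (D t)) *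
        ∏ t ∈ S, ∏ x ∈ Sᶜ, (jacobiSym (D t) (E x) : ℝ) ^ (Φ t x + Φ x t) := by
  have hs' : Squarefree ((∏ t, E t) * ∏ t, D t) := by
    rw [← Finset.prod_mul_distrib]; exact hs
  obtain ⟨hco, -, hsD⟩ := Nat.squarefree_mul_iff.mp hs'
  have h1 : ∀ t, ∏ p ∈ (D t).primeFactors, cellWeight Φ θ m S T E t p =
      (∏ _p ∈ (D t).primeFactors, m⁻¹) * (θ (D t) * cellHom Φ S T E t (D t)) := by
    intro t
    have hDt := squarefree_of_squarefree_prod hsD t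
    have hθD : ∏ p ∈ (D t).primeFactors, θ p = θ (D t) :=
      prod_primeFactors_apply (θ : ℕ →* ℝ) hDt
    rw [← hθD, ← prod_primeFactors_apply _ hDt,
      ← Finset.prod_mul_distrib, ← Finset.prod_mul_distrib]
    refine Finset.prod_congr rfl fun p hp => ?_
    have hpd := Nat.dvd_of_mem_primeFactors hp
    have hpp := Nat.prime_of_mem_primeFactors hp
    rw [cellWeight, if_pos]
    constructor
    · by_contra ht
      rw [hD t ht] at hpd
      exact hpp.one_lt.ne' (Nat.dvd_one.mp hpd)
    · intro h
      exact Nat.not_coprime_of_dvd_of_dvd hpp.one_lt h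
        (hpd.trans (Finset.dvd_prod_of_mem _ (mem_univ t))) hco
  rw [Finset.prod_congr rfl fun t _ => h1 t, Finset.prod_mul_distrib, Finset.prod_mul_distrib,
    map_prod, mul_assoc, mul_assoc]
  congr 2
  rw [Finset.prod_congr rfl fun t _ => cellHom_apply Φ S T E t (D t), Finset.prod_mul_distrib,
    Finset.prod_ite_mem, Finset.univ_inter]
  congr 1
  rw [← Finset.prod_mul_prod_compl S (fun t => ∏ x ∈ Sᶜ, (jacobiSym (D t) (E x) : ℝ) ^ (Φ t x + Φ x t))]
  rw [Finset.prod_eq_one (s := Sᶜ), mul_one]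
  intro t ht
  refine Finset.prod_eq_one fun x _ => ?_
  rw [hD t (Finset.mem_compl.mp ht)]
  simp [jacobiSym.one_left]

theorem orderedTerm_mul {Φ : I → I → ℕ} (θ : ℕ →*₀ ℝ) (m : ℝ) {rk : I → ℕ} {S : Finset I}
    (T : Finset I) (hun : ∀ x ∈ S, ∀ y ∈ S, Even (Φ x y + Φ y x))
    (hrk : ∀ x ∈ S, ∀ y ∉ S, rk x < rk y) {E D : I → ℕ} (hE : ∀ t ∈ S, E t = 1)
    (hD : ∀ t ∉ S, D t = 1) (hs : Squarefree (∏ t, (E * D) t)) :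
    orderedTerm Φ θ m rk T (E * D) = (θ (∏ t, E t) * (∏ _p ∈ (∏ t, E t).primeFactors, m⁻¹) *
      (∏ x ∈ Sᶜ, ∏ y ∈ Sᶜ, if rk x < rk y then (jacobiSym (E x) (E y) : ℝ) ^ (Φ x y + Φ y x) else 1) *
      ∏ t ∈ T, oddChar true 1 (E t)) * ∏ t, ∏ p ∈ (D t).primeFactors, cellWeight Φ θ m S T E t p := by
  have hprod : ∏ t, (E * D) t = (∏ t, E t) * ∏ t, D t := Finset.prod_mul_distrib
  have hs' : Squarefree ((∏ t, E t) * ∏ t, D t) := hprod ▸ hs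
  obtain ⟨hco, -, hsD⟩ := Nat.squarefree_mul_iff.mp hs'
  have hW : ∏ _p ∈ ((∏ t, E t) * ∏ t, D t).primeFactors, m⁻¹ =
      (∏ _p ∈ (∏ t, E t).primeFactors, m⁻¹) * ∏ t, ∏ _p ∈ (D t).primeFactors, m⁻¹ := by
    rw [← prod_primeFactors_prod hsD (fun _ => m⁻¹), hco.primeFactors_mul,
      Finset.prod_union hco.disjoint_primeFactors]
  have hJ : (∏ x, ∏ y, if rk x < rk y then
        (jacobiSym ((E * D) x) ((E * D) y) : ℝ) ^ (Φ x y + Φ y x) else 1) =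
      (∏ x ∈ Sᶜ, ∏ y ∈ Sᶜ, if rk x < rk y then (jacobiSym (E x) (E y) : ℝ) ^ (Φ x y + Φ y x) else 1) *
      ∏ t ∈ S, ∏ x ∈ Sᶜ, (jacobiSym (D t) (E x) : ℝ) ^ (Φ t x + Φ x t) := by
    rw [← Finset.prod_mul_prod_compl S, mul_comm]
    congr 1
    · refine Finset.prod_congr rfl fun x hx => ?_
      have hx := Finset.mem_compl.mp hx
      rw [← Finset.prod_mul_prod_compl S, Finset.prod_eq_one (s := S), one_mul]
      · refine Finset.prod_congr rfl fun y hy => ?_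
        have hy := Finset.mem_compl.mp hy
        simp only [Pi.mul_apply, hD x hx, hD y hy, mul_one]
      · intro y hy
        rw [if_neg (hrk y hy x hx).not_gt]
    · refine Finset.prod_congr rfl fun x hx => ?_
      rw [← Finset.prod_mul_prod_compl S, Finset.prod_eq_one (s := S), one_mul]
      · refine Finset.prod_congr rfl fun y hy => ?_
        have hy := Finset.mem_compl.mp hy
        rw [if_pos (hrk x hx y hy)]
        simp only [Pi.mul_apply, hE x hx, hD y hy, mul_one, one_mul]
      · intro y hy
        split_ifs with h
        · have hxy : x ≠ y := by rintro rfl; exact lt_irrefl _ h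
          obtain ⟨k, hk⟩ := hun x hx y hy
          rw [hk, ← two_mul, pow_mul, jacobiSym_cast_sq_eq_one (coprime_of_squarefree_prod hs hxy),
            one_pow]
        · rfl
  rw [prod_cellWeight Φ θ m S T hD hs, orderedTerm, hJ, hprod, hW, map_mul]
  simp only [Pi.mul_apply, map_mul, Finset.prod_mul_distrib]
  ring

theorem prod_cellWeight_eq_zero (Φ : I → I → ℕ) (θ : ℕ →*₀ ℝ) (m : ℝ) (S T : Finset I)
    {E D : I → ℕ} {t : I} {p : ℕ} (hp : p.Prime) (hDt : D t ≠ 0) (hpt : p ∣ D t)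
    (h : t ∉ S ∨ p ∣ ∏ t, E t) :
    ∏ t, ∏ p ∈ (D t).primeFactors, cellWeight Φ θ m S T E t p = 0 := by
  refine Finset.prod_eq_zero (mem_univ t) (Finset.prod_eq_zero (Nat.mem_primeFactors.mpr
    ⟨hp, hpt, hDt⟩) ?_)
  rw [cellWeight, if_neg]
  tauto

theorem sum_orderedTerm_mul {Φ : I → I → ℕ} (θ : ℕ →*₀ ℝ) (m : ℝ) {rk : I → ℕ} {S : Finset I}
    (T : Finset I) (hun : ∀ x ∈ S, ∀ y ∈ S, Even (Φ x y + Φ y x))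
    (hrk : ∀ x ∈ S, ∀ y ∉ S, rk x < rk y) {N : ℕ} {E : I → ℕ} (hEN : E ∈ tuplesLT I N)
    (hE : ∀ t ∈ S, E t = 1) :
    ∑ D ∈ (tuplesLT I N).filter (fun D => ∀ t ∉ S, D t = 1),
      (if E * D ∈ tuplesLT I N then orderedTerm Φ θ m rk T (E * D) else 0) =
    (θ (∏ t, E t) * (∏ _p ∈ (∏ t, E t).primeFactors, m⁻¹) *
      (∏ x ∈ Sᶜ, ∏ y ∈ Sᶜ, if rk x < rk y then (jacobiSym (E x) (E y) : ℝ) ^ (Φ x y + Φ y x) else 1) *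
      ∏ t ∈ T, oddChar true 1 (E t)) *
      ∑ n ∈ sqfreeLT ((N - 1) / (∏ t, E t) + 1), ∏ p ∈ n.primeFactors,
        ∑ t, cellWeight Φ θ m S T E t p := by
  obtain ⟨hEs, hEN'⟩ := mem_tuplesLT.mp hEN
  have hq : 0 < ∏ t, E t := hEs.ne_zero.bot_lt
  have hlt : ∀ k, k < (N - 1) / (∏ t, E t) + 1 ↔ (∏ t, E t) * k < N := fun k => by
    rw [Nat.lt_succ_iff, Nat.le_div_iff_mul_le hq, mul_comm]; omega
  rw [← sum_tuplesLT_prod, Finset.mul_sum]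
  have hsub : (tuplesLT I ((N - 1) / (∏ t, E t) + 1)).filter (fun D => ∀ t ∉ S, D t = 1) ⊆
      (tuplesLT I N).filter (fun D => ∀ t ∉ S, D t = 1) := by
    intro D hD
    rw [Finset.mem_filter, mem_tuplesLT] at hD ⊢
    refine ⟨⟨hD.1.1, ?_⟩, hD.2⟩
    have := (hlt _).mp hD.1.2
    exact (Nat.le_mul_of_pos_left _ hq).trans_lt this
  rw [← Finset.sum_subset hsub]
  · symm
    rw [← Finset.sum_subset (Finset.filter_subset (fun D : I → ℕ => ∀ t ∉ S, D t = 1) _)]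
    · refine Finset.sum_congr rfl fun D hD => ?_
      obtain ⟨hDm, hDS⟩ := Finset.mem_filter.mp hD
      obtain ⟨hDs, hDN⟩ := mem_tuplesLT.mp hDm
      have hprod : ∏ t, (E * D) t = (∏ t, E t) * ∏ t, D t := Finset.prod_mul_distrib
      have hlt' := (hlt _).mp hDN
      by_cases hco : (∏ t, E t).Coprime (∏ t, D t)
      · have hs : Squarefree (∏ t, (E * D) t) := by
          rw [hprod]; exact Nat.squarefree_mul_iff.mpr ⟨hco, hEs, hDs⟩
        rw [if_pos (mem_tuplesLT.mpr ⟨hs, hprod ▸ hlt'⟩), orderedTerm_mul θ m T hun hrk hE hDS hs]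
      · obtain ⟨p, hp, hpE, hpD⟩ := Nat.Prime.not_coprime_iff_dvd.mp hco
        obtain ⟨t, -, ht⟩ := hp.prime.dvd_finsetProd_iff _ |>.mp hpD
        rw [prod_cellWeight_eq_zero Φ θ m S T hp (squarefree_of_squarefree_prod hDs t).ne_zero ht
          (Or.inr hpE), mul_zero, if_neg]
        intro h
        have := (mem_tuplesLT.mp h).1
        rw [hprod] at this
        exact hco (Nat.squarefree_mul_iff.mp this).1
    · intro D hD hD'
      have hDs := (mem_tuplesLT.mp hD).1
      rw [Finset.mem_filter, not_and] at hD'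
      obtain ⟨t, htS, ht⟩ : ∃ t, t ∉ S ∧ D t ≠ 1 := by
        by_contra! h; exact hD' hD h
      obtain ⟨p, hp, hpd⟩ := Nat.exists_prime_and_dvd ht
      rw [prod_cellWeight_eq_zero Φ θ m S T hp (squarefree_of_squarefree_prod hDs t).ne_zero hpd
        (Or.inl htS), mul_zero]
  · intro D hD hD'
    rw [if_neg]
    intro h
    obtain ⟨hDm, hDS⟩ := Finset.mem_filter.mp hD
    refine hD' (Finset.mem_filter.mpr ⟨mem_tuplesLT.mpr ⟨(mem_tuplesLT.mp hDm).1, ?_⟩, hDS⟩)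
    rw [hlt, ← Finset.prod_mul_distrib]
    exact (mem_tuplesLT.mp h).2

end

section

variable {I : Type*} [Fintype I]

/-- The saving obtained from a maximal unlinked set of large variables when the small ones are
at most `z`. -/
def maxUnlinkedSaving (i m : ℕ) (N z : ℕ) : ℝ :=
  (m : ℝ)⁻¹ * (1 / 2 * (1 / 2 * Real.log (1 / 2 * Real.log N) -
    Real.log (Real.log (4 * (z : ℝ) ^ i) + 3)) - 2)

theorem odd_of_map_prod_ne_zero {θ : ℕ →*₀ ℝ} (hθ2 : θ 2 = 0) {D : I → ℕ} (h : θ (∏ t, D t) ≠ 0)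
    (t : I) : Odd (D t) := by
  rw [← Nat.not_even_iff_odd]
  intro he
  obtain ⟨k, hk⟩ := (even_iff_two_dvd.mp he).trans (Finset.dvd_prod_of_mem D (mem_univ t))
  exact h (by rw [hk, map_mul, hθ2, zero_mul])

theorem exists_sum_cellWeight_le (I : Type*) [Fintype I] {m : ℕ} (hm : 2 ≤ m) :
    ∃ C : ℝ, 0 < C ∧ ∀ (Φ : I → I → ℕ) (θ : ℕ →*₀ ℝ), (∀ n, |θ n| ≤ 1) → θ 2 = 0 →
      ∀ S T : Finset I, S.card = m → ∀ u ∉ S, ∀ v ∈ S, ∀ w ∈ S,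
      Odd (Φ u v + Φ v u + Φ u w + Φ w u) → ∀ N z : ℕ, 9 ≤ N → z ^ (2 * Fintype.card I) ≤ N →
      ∀ E : I → ℕ, (∀ t, E t ∈ Ioc 0 z) → Squarefree (∏ t, E t) → (∀ t, Odd (E t)) → E u ≠ 1 →
      |∑ n ∈ sqfreeLT ((N - 1) / (∏ t, E t) + 1), ∏ p ∈ n.primeFactors,
        ∑ t, cellWeight Φ θ m S T E t p| ≤
        C * N * ((∏ t, E t : ℕ) : ℝ)⁻¹ * Real.exp (-maxUnlinkedSaving (Fintype.card I) m N z) := by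
  obtain ⟨C, hC, h⟩ := exists_sum_sqfree_le (M := 1) zero_le_one
  refine ⟨2 * C, by positivity, fun Φ θ hθ hθ2 S T hS u hu v hv w hw hodd N z hN hz E hE hsq hEo hEu => ?_⟩
  have hvw : v ≠ w := by
    rintro rfl
    rw [← Nat.not_even_iff_odd] at hodd
    exact hodd ⟨Φ u v + Φ v u, by ring⟩
  have hE0 : ∀ t, E t ≠ 0 := fun t => (Finset.mem_Ioc.mp (hE t)).1.ne'
  set q := ∏ t, E t with hq
  have hq0 : 0 < q := hsq.ne_zero.bot_lt
  set N' := (N - 1) / q + 1 with hN'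
  set V := Sᶜ.filter fun x => Odd (Φ x v + Φ v x + Φ x w + Φ w x) with hV
  set Q := ∏ x ∈ V, E x with hQ
  have hQq : Q ∣ q := Finset.prod_dvd_prod_of_subset _ _ _ (Finset.subset_univ _)
  have hqz : q ≤ z ^ Fintype.card I := by
    rw [hq]
    refine (Finset.prod_le_prod' fun t _ => (Finset.mem_Ioc.mp (hE t)).2).trans ?_
    simp
  have hQ1 : Q ≠ 1 := by
    intro h1
    have : E u ∣ Q := Finset.dvd_prod_of_mem E (by simp [hV, hu, hodd])
    rw [h1] at this
    exact hEu (Nat.dvd_one.mp this)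
  have hQo : Odd Q := by
    rw [hQ]
    exact Finset.prod_induction _ Odd (fun _ _ => Odd.mul) odd_one fun x _ => hEo x
  have hQs : Squarefree Q := hsq.squarefree_of_dvd hQq
  have hQ0 : 0 < Q := hQs.ne_zero.bot_lt
  have hNq : N ≤ q * N' := by
    have := Nat.lt_mul_div_succ (N - 1) hq0
    rw [← hN'] at this
    omega
  have hqN : q * q ≤ N := by
    refine le_trans ?_ hz
    rw [mul_comm, pow_mul, pow_right_comm, sq]
    exact Nat.mul_le_mul hqz hqz
  have hNN : N ≤ N' * N' := by
    by_contra! hlt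
    nlinarith
  have hN3 : 3 ≤ N' := by nlinarith
  have hN2 : (N' : ℝ) ≤ 2 * N * (q : ℝ)⁻¹ := by
    rw [← div_eq_mul_inv, le_div_iff₀ (by exact_mod_cast hq0)]
    have h1 : (N - 1) / q * q ≤ N - 1 := Nat.div_mul_le_self _ _
    have h2 : q ≤ N := (Nat.le_mul_self q).trans hqN
    have : N' * q ≤ 2 * N := by rw [hN', add_mul]; omega
    exact_mod_cast this
  set η := decide ¬(v ∈ T ↔ w ∈ T) with hη
  have hcell := fun (p : ℕ) (hp : p.Prime) =>
    abs_sum_cellWeight_le Φ hθ hθ2 S T hS hE0 hv hw hvw (m := m) hp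
  have hm0 : (0 : ℝ) < (m : ℝ)⁻¹ := by positivity
  have hψ1 := fun p => abs_oddChar_le η Q p
  have hA := h (fun p => |∑ t, cellWeight Φ θ m S T E t p|) (fun _ _ => abs_nonneg _)
    (fun p hp => by
      have h1 := hcell p hp
      have h2 := (abs_le.mp (hψ1 p)).2
      have : 0 ≤ (m : ℝ)⁻¹ * (1 - oddChar η Q p) := mul_nonneg hm0.le (by linarith)
      exact h1.trans (by linarith)) N' (by omega)
  have hL := le_sum_primesLE_one_sub (ψ := oddChar η Q) (q := 4 * Q) hψ1 (by omega)
    (fun y => abs_sum_oddChar_le η hQo hQs hQ1 y) hN3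
  have hS1 : maxUnlinkedSaving (Fintype.card I) m N z ≤
      ∑ p ∈ Nat.primesLE N', (1 - |∑ t, cellWeight Φ θ m S T E t p|) / p := by
    have h1 : (m : ℝ)⁻¹ * ∑ p ∈ Nat.primesLE N', (1 - oddChar η Q p) / p ≤
        ∑ p ∈ Nat.primesLE N', (1 - |∑ t, cellWeight Φ θ m S T E t p|) / p := by
      rw [Finset.mul_sum]
      refine Finset.sum_le_sum fun p hp => ?_
      rw [← mul_div_assoc]
      gcongr
      have := hcell p (Nat.prime_of_mem_primesLE hp)
      linarith
    refine le_trans (mul_le_mul_of_nonneg_left ?_ hm0.le) h1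
    refine le_trans ?_ hL
    have hlogN : (1 : ℝ) / 2 * Real.log N ≤ Real.log N' := by
      have : Real.log N ≤ Real.log ((N' : ℝ) * N') :=
        Real.log_le_log (by positivity) (by exact_mod_cast hNN)
      rw [Real.log_mul (by positivity) (by positivity)] at this
      linarith
    have hlN : 0 < Real.log N := Real.log_pos (by exact_mod_cast (by omega : 1 < N))
    have h2 : Real.log (1 / 2 * Real.log N) ≤ Real.log (Real.log N') :=
      Real.log_le_log (by positivity) hlogN
    have h4 : (0 : ℝ) < 4 * Q := by positivity
    have h5 : (1 : ℝ) ≤ 4 * Q := by exact_mod_cast (by omega : 1 ≤ 4 * Q)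
    have h6 : (4 * Q : ℝ) ≤ 4 * (z : ℝ) ^ Fintype.card I := by
      exact_mod_cast Nat.mul_le_mul_left 4 ((Nat.le_of_dvd hq0 hQq).trans hqz)
    have h3 : Real.log (Real.log ((4 * Q : ℕ) : ℝ) + 3) ≤
        Real.log (Real.log (4 * (z : ℝ) ^ Fintype.card I) + 3) := by
      push_cast
      have := Real.log_nonneg h5
      exact Real.log_le_log (by linarith) (by linarith [Real.log_le_log h4 h6])
    linarith
  calc _ ≤ ∑ n ∈ sqfreeLT N', ∏ p ∈ n.primeFactors, |∑ t, cellWeight Φ θ m S T E t p| :=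
        (Finset.abs_sum_le_sum_abs _ _).trans_eq (Finset.sum_congr rfl fun n _ => Finset.abs_prod _ _)
    _ ≤ C * N' * Real.exp (-∑ p ∈ Nat.primesLE N', (1 - |∑ t, cellWeight Φ θ m S T E t p|) / p) := hA
    _ ≤ C * (2 * N * (q : ℝ)⁻¹) * Real.exp (-maxUnlinkedSaving (Fintype.card I) m N z) := by
        gcongr
    _ = _ := by ring

theorem exists_sum_symbProd_bigSet_subset_le (I : Type*) [Fintype I] {m : ℕ} (hm : 2 ≤ m) :
    ∃ C : ℝ, 0 < C ∧ ∀ (Φ : I → I → ℕ) (θ : ℕ →*₀ ℝ), (∀ x, Φ x x = 0) → (∀ n, |θ n| ≤ 1) →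
      θ 2 = 0 → ∀ S : Finset I, S.card = m → (∀ x ∈ S, ∀ y ∈ S, Even (Φ x y + Φ y x)) →
      ∀ good : Finset I → Prop, (∀ U, S ⊆ U → good U → ∃ u ∈ U, u ∉ S ∧ ∃ v ∈ S, ∃ w ∈ S,
        Odd (Φ u v + Φ v u + Φ u w + Φ w u)) →
      ∀ N z : ℕ, 9 ≤ N → 1 ≤ z → z ^ (2 * Fintype.card I) ≤ N →
      |∑ D ∈ (tuplesLT I N).filter (fun D => bigSet z D ⊆ S),
        θ (∏ t, D t) * (∏ _p ∈ (∏ t, D t).primeFactors, (m : ℝ)⁻¹) *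
          (if good (S ∪ suppSet D) then 1 else 0) * symbProd Φ D| ≤
        C * N * (1 + Real.log z) ^ Fintype.card I *
          Real.exp (-maxUnlinkedSaving (Fintype.card I) m N z) := by
  obtain ⟨C, hC, hcell⟩ := exists_sum_cellWeight_le I hm
  refine ⟨2 ^ Fintype.card I * C, by positivity,
    fun Φ θ hΦ hθ hθ2 S hS hun good h2 N z hN hz hzN => ?_⟩
  set A := (tuplesLT I N).filter (fun D => bigSet z D ⊆ S) with hA
  set e := Real.exp (-maxUnlinkedSaving (Fintype.card I) m N z) with he
  obtain ⟨rk, hinj, hrk⟩ : ∃ rk : I → ℕ, Function.Injective rk ∧ ∀ x ∈ S, ∀ y ∉ S, rk x < rk y := by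
    let f := Fintype.equivFin I
    refine ⟨fun t => f t + if t ∈ S then 0 else Fintype.card I, fun x y hxy => ?_, fun x hx y hy => ?_⟩
    · have h1 := (f x).2
      have h3 := (f y).2
      dsimp only at hxy
      apply f.injective
      apply Fin.ext
      split_ifs at hxy <;> omega
    · have h1 := (f x).2
      simp only [if_pos hx, if_neg hy]
      omega
  set κ : Finset I → ℝ := fun R =>
    ∏ x, ∏ y, if rk x < rk y then recipSign R x y ^ Φ y x else 1 with hκ
  set g : (I → ℕ) → ℝ := fun D => θ (∏ t, D t) * (∏ _p ∈ (∏ t, D t).primeFactors, (m : ℝ)⁻¹) *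
    (if good (S ∪ suppSet D) then 1 else 0) *
    ∏ x, ∏ y, if rk x < rk y then (jacobiSym (D x) (D y) : ℝ) ^ (Φ x y + Φ y x) else 1 with hg
  have hgodd : ∀ D, g D ≠ 0 → ∀ t, Odd (D t) := fun D hD =>
    odd_of_map_prod_ne_zero hθ2 (by
      intro h0
      apply hD
      simp only [hg, h0, zero_mul])
  have h1 : ∑ D ∈ A, θ (∏ t, D t) * (∏ _p ∈ (∏ t, D t).primeFactors, (m : ℝ)⁻¹) *
      (if good (S ∪ suppSet D) then 1 else 0) * symbProd Φ D =
      ∑ D ∈ A, g D * κ (univ.filter fun t => D t % 4 = 3) := by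
    refine Finset.sum_congr rfl fun D _ => ?_
    by_cases h0 : θ (∏ t, D t) = 0
    · simp only [hg, h0, zero_mul]
    · rw [symbProd_eq_recipSign_mul hΦ hinj (odd_of_map_prod_ne_zero hθ2 h0)]
      simp only [hg, hκ, mul_assoc]
  have hbd : ∀ T : Finset I, |∑ D ∈ A, g D * ∏ t ∈ T, oddChar true 1 (D t)| ≤
      C * N * (1 + Real.log z) ^ Fintype.card I * e := by
    intro T
    set c : (I → ℕ) → Prop := fun D => (∀ t ∉ S, D t ≤ z) ∧ good (S ∪ suppSet D) with hc
    have hF : ∑ D ∈ A, g D * ∏ t ∈ T, oddChar true 1 (D t) =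
        ∑ D ∈ tuplesLT I N, if c D then orderedTerm Φ θ m rk T D else 0 := by
      rw [hA, Finset.sum_filter]
      refine Finset.sum_congr rfl fun D _ => ?_
      have hb : bigSet z D ⊆ S ↔ ∀ t ∉ S, D t ≤ z := by
        simp only [bigSet, Finset.subset_iff, Finset.mem_filter, Finset.mem_univ, true_and]
        exact forall_congr' fun t => by rw [← not_lt, not_imp_not]
      by_cases hb' : bigSet z D ⊆ S
      · by_cases hgd : good (S ∪ suppSet D)
        · rw [if_pos hb', if_pos ⟨hb.mp hb', hgd⟩, orderedTerm, hg]
          simp only [if_pos hgd, mul_one]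
        · rw [if_pos hb', if_neg (fun h => hgd h.2), hg]
          simp only [if_neg hgd, mul_zero, zero_mul]
      · rw [if_neg hb', if_neg (fun h => hb' (hb.mpr h.1))]
    rw [hF, sum_tuplesLT_split S]
    have hin : ∀ E ∈ (tuplesLT I N).filter (fun D => ∀ t ∈ S, D t = 1),
        |∑ D ∈ (tuplesLT I N).filter (fun D => ∀ t ∉ S, D t = 1), if E * D ∈ tuplesLT I N then
          (if c (E * D) then orderedTerm Φ θ m rk T (E * D) else 0) else 0| ≤
        if E ∈ Fintype.piFinset (fun _ : I => Ioc 0 z) then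
          C * N * ((∏ t, E t : ℕ) : ℝ)⁻¹ * e else 0 := by
      intro E hE
      obtain ⟨hEm, hES⟩ := Finset.mem_filter.mp hE
      obtain ⟨hEs, -⟩ := mem_tuplesLT.mp hEm
      have hE0 : ∀ t, 0 < E t := fun t => (squarefree_of_squarefree_prod hEs t).ne_zero.bot_lt
      have hcc : ∀ D ∈ (tuplesLT I N).filter (fun D => ∀ t ∉ S, D t = 1), c (E * D) ↔ c E := by
        intro D hD
        have hDS := (Finset.mem_filter.mp hD).2
        have hs : S ∪ suppSet (E * D) = S ∪ suppSet E := by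
          ext t
          by_cases ht : t ∈ S
          · simp [ht]
          · simp [ht, suppSet, hDS t ht]
        simp only [hc, hs, Pi.mul_apply]
        refine and_congr_left fun _ => forall₂_congr fun t ht => by rw [hDS t ht, mul_one]
      have hnn : (0 : ℝ) ≤ if E ∈ Fintype.piFinset (fun _ : I => Ioc 0 z) then
          C * N * ((∏ t, E t : ℕ) : ℝ)⁻¹ * e else 0 := by
        split_ifs <;> positivity
      by_cases hcE : c E
      · have hEz : ∀ t, E t ∈ Ioc 0 z := fun t => Finset.mem_Ioc.mpr ⟨hE0 t, by
          by_cases ht : t ∈ S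
          · rw [hES t ht]; exact hz
          · exact hcE.1 t ht⟩
        rw [Finset.sum_congr rfl fun D hD => by rw [if_pos ((hcc D hD).mpr hcE)],
          sum_orderedTerm_mul θ m T hun hrk hEm hES]
        rw [if_pos (Fintype.mem_piFinset.mpr hEz)]
        by_cases h0 : θ (∏ t, E t) = 0
        · rw [h0]
          simp only [zero_mul, abs_zero]
          positivity
        obtain ⟨u, hu, huS, v, hv, w, hw, hodd⟩ := h2 _ Finset.subset_union_left hcE.2
        have hEu : E u ≠ 1 := by
          simpa [huS, suppSet] using hu
        have := hcell Φ θ hθ hθ2 S T hS u huS v hv w hw hodd N z hN hzN E hEz hEs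
          (odd_of_map_prod_ne_zero hθ2 h0) hEu
        rw [abs_mul]
        refine le_trans (mul_le_of_le_one_left (abs_nonneg _) ?_) this
        have hw1 : |∏ _p ∈ (∏ t, E t).primeFactors, (m : ℝ)⁻¹| ≤ 1 := by
          rw [Finset.abs_prod]
          refine Finset.prod_le_one (fun _ _ => abs_nonneg _) fun _ _ => ?_
          rw [abs_of_nonneg (by positivity)]
          exact inv_le_one_of_one_le₀ (by exact_mod_cast (by omega : 1 ≤ m))
        have hw2 : |∏ x ∈ Sᶜ, ∏ y ∈ Sᶜ, if rk x < rk y then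
            (jacobiSym (E x) (E y) : ℝ) ^ (Φ x y + Φ y x) else 1| ≤ 1 := by
          simp only [Finset.abs_prod]
          refine Finset.prod_le_one (fun _ _ => Finset.prod_nonneg fun _ _ => abs_nonneg _)
            fun x _ => Finset.prod_le_one (fun _ _ => abs_nonneg _) fun y _ => ?_
          split_ifs
          · rw [abs_pow]
            exact pow_le_one₀ (abs_nonneg _) (abs_jacobiSym_le _ _)
          · simp
        have hw3 : |∏ t ∈ T, oddChar true 1 (E t)| ≤ 1 := by
          rw [Finset.abs_prod]
          exact Finset.prod_le_one (fun _ _ => abs_nonneg _) fun _ _ => abs_oddChar_le _ _ _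
        rw [abs_mul, abs_mul, abs_mul]
        exact mul_le_one₀ (mul_le_one₀ (mul_le_one₀ (hθ _) (abs_nonneg _) hw1) (abs_nonneg _) hw2)
          (abs_nonneg _) hw3
      · rw [Finset.sum_eq_zero, abs_zero]
        · exact hnn
        · intro D hD
          rw [if_neg (fun h => hcE ((hcc D hD).mp h)), ite_self]
    refine (Finset.abs_sum_le_sum_abs _ _).trans ((Finset.sum_le_sum hin).trans ?_)
    rw [← Finset.sum_filter]
    calc _ ≤ ∑ E ∈ Fintype.piFinset (fun _ : I => Ioc 0 z), C * N * ((∏ t, E t : ℕ) : ℝ)⁻¹ * e :=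
          Finset.sum_le_sum_of_subset_of_nonneg
            (fun E hE => (Finset.mem_filter.mp hE).2) fun _ _ _ => by positivity
      _ = C * N * (∑ E ∈ Fintype.piFinset (fun _ : I => Ioc 0 z), ((∏ t, E t : ℕ) : ℝ)⁻¹) * e := by
          rw [Finset.mul_sum, Finset.sum_mul]
      _ ≤ _ := by
          gcongr
          exact sum_piFinset_inv_le z
  rw [h1]
  refine (abs_sum_mul_residues_le A g κ (fun R => abs_prod_recipSign_le Φ rk R)
    (fun D _ => hgodd D)).trans ((Finset.sum_le_sum fun T _ => hbd T).trans_eq ?_)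
  rw [Finset.sum_const, Finset.card_univ, Fintype.card_finset, nsmul_eq_mul]
  push_cast
  ring

end

section

variable {I : Type*} [Fintype I]

/-- The symbols between a variable `a` in position `u` and fixed entries `E` outside `S`. -/
def edgeSymb (Φ : I → I → ℕ) (S : Finset I) (E : I → ℕ) (u : I) (a : ℕ) : ℝ :=
  ∏ x ∈ Sᶜ, (jacobiSym (E x) a : ℝ) ^ Φ x u * (jacobiSym a (E x) : ℝ) ^ Φ u x

theorem abs_edgeSymb_le (Φ : I → I → ℕ) (S : Finset I) (E : I → ℕ) (u : I) (a : ℕ) :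
    |edgeSymb Φ S E u a| ≤ 1 := by
  rw [edgeSymb, Finset.abs_prod]
  refine Finset.prod_le_one (fun _ _ => abs_nonneg _) fun x _ => ?_
  rw [abs_mul, abs_pow, abs_pow]
  exact mul_le_one₀ (pow_le_one₀ (abs_nonneg _) (abs_jacobiSym_le _ _))
    (by positivity) (pow_le_one₀ (abs_nonneg _) (abs_jacobiSym_le _ _))

theorem symbProd_mul_pair {Φ : I → I → ℕ} (hΦ : ∀ x, Φ x x = 0) {u v : I} (huv : u ≠ v)
    (ho : Odd (Φ u v)) (he : Even (Φ v u)) {E D : I → ℕ} (hE : ∀ t ∈ ({u, v} : Finset I), E t = 1)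
    (hD : ∀ t ∉ ({u, v} : Finset I), D t = 1) (hs : Squarefree (∏ t, (E * D) t)) :
    symbProd Φ (E * D) = (∏ x ∈ ({u, v} : Finset I)ᶜ, ∏ y ∈ ({u, v} : Finset I)ᶜ,
      (jacobiSym (E x) (E y) : ℝ) ^ Φ x y) * edgeSymb Φ {u, v} E u (D u) *
      edgeSymb Φ {u, v} E v (D v) * jacobiSym (D u) (D v) := by
  have hu : (E * D) u = D u := by rw [Pi.mul_apply, hE u (by simp), one_mul]
  have hv : (E * D) v = D v := by rw [Pi.mul_apply, hE v (by simp), one_mul]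
  have hx : ∀ x ∈ ({u, v} : Finset I)ᶜ, (E * D) x = E x := fun x hx => by
    rw [Pi.mul_apply, hD x (Finset.mem_compl.mp hx), mul_one]
  have hc := coprime_of_squarefree_prod hs huv
  rw [hu, hv] at hc
  have h1 : (jacobiSym (D u) (D v) : ℝ) ^ Φ u v = jacobiSym (D u) (D v) := by
    obtain ⟨k, hk⟩ := ho
    rw [hk, pow_succ, pow_mul, jacobiSym_cast_sq_eq_one hc, one_pow, one_mul]
  have h2 : (jacobiSym (D v) (D u) : ℝ) ^ Φ v u = 1 := by
    obtain ⟨k, hk⟩ := he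
    rw [hk, ← two_mul, pow_mul, jacobiSym_cast_sq_eq_one hc.symm, one_pow]
  have hrow : ∀ x, ∏ y, (jacobiSym ((E * D) x) ((E * D) y) : ℝ) ^ Φ x y =
      ((jacobiSym ((E * D) x) (D u) : ℝ) ^ Φ x u * (jacobiSym ((E * D) x) (D v) : ℝ) ^ Φ x v) *
        ∏ y ∈ ({u, v} : Finset I)ᶜ, (jacobiSym ((E * D) x) (E y) : ℝ) ^ Φ x y := by
    intro x
    rw [← Finset.prod_mul_prod_compl {u, v}, Finset.prod_pair huv, hu, hv]
    congr 1
    exact Finset.prod_congr rfl fun y hy => by rw [hx y hy]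
  rw [symbProd, Finset.prod_congr rfl fun x _ => hrow x, ← Finset.prod_mul_prod_compl {u, v},
    Finset.prod_pair huv, hu, hv, hΦ, hΦ, h1, h2]
  have hcol : ∀ x ∈ ({u, v} : Finset I)ᶜ, (jacobiSym ((E * D) x) (D u) : ℝ) ^ Φ x u *
      (jacobiSym ((E * D) x) (D v) : ℝ) ^ Φ x v *
        ∏ y ∈ ({u, v} : Finset I)ᶜ, (jacobiSym ((E * D) x) (E y) : ℝ) ^ Φ x y =
      (jacobiSym (E x) (D u) : ℝ) ^ Φ x u * (jacobiSym (E x) (D v) : ℝ) ^ Φ x v *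
        ∏ y ∈ ({u, v} : Finset I)ᶜ, (jacobiSym (E x) (E y) : ℝ) ^ Φ x y :=
    fun x hx' => by rw [hx x hx']
  rw [Finset.prod_congr rfl hcol, Finset.prod_mul_distrib,
    Finset.prod_mul_distrib, edgeSymb, edgeSymb, Finset.prod_mul_distrib, Finset.prod_mul_distrib]
  ring

/-- The coefficient of the variable `a` in position `u` of a linked pair of large variables. -/
def linkCoeff (Φ : I → I → ℕ) (θ : ℕ →*₀ ℝ) (m : ℝ) (z : ℕ) (S : Finset I) (E : I → ℕ) (u : I)
    (a : ℕ) : ℝ :=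
  if z < a ∧ Odd a ∧ Squarefree a ∧ (∏ t, E t).Coprime a then
    θ a * (∏ _p ∈ a.primeFactors, m⁻¹) * edgeSymb Φ S E u a else 0

theorem abs_prod_inv_le_one {m : ℝ} (hm : 1 ≤ m) (s : Finset ℕ) : |∏ _p ∈ s, m⁻¹| ≤ 1 := by
  rw [Finset.abs_prod]
  refine Finset.prod_le_one (fun _ _ => abs_nonneg _) fun _ _ => ?_
  rw [abs_of_nonneg (by positivity)]
  exact inv_le_one_of_one_le₀ hm

theorem abs_linkCoeff_le (Φ : I → I → ℕ) {θ : ℕ →*₀ ℝ} (hθ : ∀ n, |θ n| ≤ 1) {m : ℝ} (hm : 1 ≤ m)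
    (z : ℕ) (S : Finset I) (E : I → ℕ) (u : I) (a : ℕ) : |linkCoeff Φ θ m z S E u a| ≤ 1 := by
  rw [linkCoeff]
  split_ifs
  · rw [abs_mul, abs_mul]
    exact mul_le_one₀ (mul_le_one₀ (hθ a) (abs_nonneg _) (abs_prod_inv_le_one hm _))
      (abs_nonneg _) (abs_edgeSymb_le _ _ _ _ _)
  · simp

theorem linkCoeff_ne_zero {Φ : I → I → ℕ} {θ : ℕ →*₀ ℝ} {m : ℝ} {z : ℕ} {S : Finset I} {E : I → ℕ}
    {u : I} {a : ℕ} (h : linkCoeff Φ θ m z S E u a ≠ 0) :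
    z < a ∧ Odd a ∧ Squarefree a ∧ (∏ t, E t).Coprime a := by
  by_contra hn
  exact h (if_neg hn)

/-- The factor independent of the linked pair `u, v` of large variables. -/
def linkConst (Φ : I → I → ℕ) (θ : ℕ →*₀ ℝ) (m : ℝ) (z : ℕ) (B : Finset I) (good : Finset I → Prop)
    (S : Finset I) (E : I → ℕ) : ℝ :=
  (if (∀ t ∉ S, z < E t ↔ t ∈ B) ∧ good (suppSet E ∪ S) then 1 else 0) *
    (θ (∏ t, E t) * (∏ _p ∈ (∏ t, E t).primeFactors, m⁻¹) *
      ∏ x ∈ Sᶜ, ∏ y ∈ Sᶜ, (jacobiSym (E x) (E y) : ℝ) ^ Φ x y)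

theorem abs_linkConst_le (Φ : I → I → ℕ) {θ : ℕ →*₀ ℝ} (hθ : ∀ n, |θ n| ≤ 1) {m : ℝ} (hm : 1 ≤ m)
    (z : ℕ) (B : Finset I) (good : Finset I → Prop) (S : Finset I) (E : I → ℕ) :
    |linkConst Φ θ m z B good S E| ≤ 1 := by
  rw [linkConst, abs_mul, abs_mul, abs_mul]
  refine mul_le_one₀ (by split_ifs <;> simp) (by positivity) (mul_le_one₀ (mul_le_one₀ (hθ _)
    (abs_nonneg _) (abs_prod_inv_le_one hm _)) (abs_nonneg _) ?_)
  simp only [Finset.abs_prod]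
  refine Finset.prod_le_one (fun _ _ => Finset.prod_nonneg fun _ _ => abs_nonneg _)
    fun x _ => Finset.prod_le_one (fun _ _ => abs_nonneg _) fun y _ => ?_
  rw [abs_pow]
  exact pow_le_one₀ (abs_nonneg _) (abs_jacobiSym_le _ _)

theorem ite_bigSet_mul_pair {Φ : I → I → ℕ} (hΦ : ∀ x, Φ x x = 0) {θ : ℕ →*₀ ℝ} (hθ2 : θ 2 = 0)
    (m : ℝ) {z : ℕ} (hz : 1 ≤ z) {B : Finset I} {u v : I} (hu : u ∈ B) (hv : v ∈ B)
    (ho : Odd (Φ u v)) (he : Even (Φ v u)) (good : Finset I → Prop) {E D : I → ℕ}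
    (hE : ∀ t ∈ ({u, v} : Finset I), E t = 1)
    (hD : ∀ t ∉ ({u, v} : Finset I), D t = 1) (hs : Squarefree (∏ t, (E * D) t)) :
    (if bigSet z (E * D) = B then θ (∏ t, (E * D) t) *
      (∏ _p ∈ (∏ t, (E * D) t).primeFactors, m⁻¹) *
      (if good (suppSet (E * D)) then 1 else 0) * symbProd Φ (E * D) else 0) =
    linkConst Φ θ m z B good {u, v} E * (linkCoeff Φ θ m z {u, v} E u (D u) *
      linkCoeff Φ θ m z {u, v} E v (D v) * jacobiSym (D u) (D v)) := by
  have huv : u ≠ v := by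
    rintro rfl
    rw [hΦ] at ho
    exact absurd ho (by decide)
  have hDp : ∏ t, D t = D u * D v := by
    rw [← Finset.prod_pair huv]
    exact (Finset.prod_subset (Finset.subset_univ _) fun t _ ht => hD t ht).symm
  have hprod : ∏ t, (E * D) t = (∏ t, E t) * (D u * D v) := by
    rw [← hDp]; exact Finset.prod_mul_distrib
  have hs' := hprod ▸ hs
  obtain ⟨hco, -, hsD⟩ := Nat.squarefree_mul_iff.mp hs'
  obtain ⟨hab, hsa, hsb⟩ := Nat.squarefree_mul_iff.mp hsD
  have hcu : (∏ t, E t).Coprime (D u) := hco.coprime_mul_right_right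
  have hcv : (∏ t, E t).Coprime (D v) := hco.coprime_mul_left_right
  have hEu := hE u (by simp)
  have hEv := hE v (by simp)
  by_cases h0 : θ (∏ t, (E * D) t) = 0
  · have h0' := h0
    rw [hprod, map_mul, map_mul, mul_eq_zero, mul_eq_zero] at h0'
    have hR : θ (∏ t, E t) = 0 ∨ linkCoeff Φ θ m z {u, v} E u (D u) = 0 ∨
        linkCoeff Φ θ m z {u, v} E v (D v) = 0 := by
      rcases h0' with h | h | h
      · exact Or.inl h
      · right; left; rw [linkCoeff, h]; simp
      · right; right; rw [linkCoeff, h]; simp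
    rw [h0]
    rcases hR with h | h | h
    · rw [linkConst, h]; simp
    · rw [h]; simp
    · rw [h]; simp
  have hodd := odd_of_map_prod_ne_zero hθ2 h0
  have hou : Odd (D u) := by simpa [hEu] using hodd u
  have hov : Odd (D v) := by simpa [hEv] using hodd v
  have hbig : bigSet z (E * D) = B ↔ z < D u ∧ z < D v ∧ ∀ t ∉ ({u, v} : Finset I), z < E t ↔ t ∈ B := by
    simp only [Finset.ext_iff, bigSet, Finset.mem_filter, Finset.mem_univ, true_and, Pi.mul_apply]
    constructor
    · intro h
      refine ⟨?_, ?_, fun t ht => ?_⟩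
      · simpa [hEu] using (h u).mpr hu
      · simpa [hEv] using (h v).mpr hv
      · simpa [hD t ht] using h t
    · rintro ⟨h1, h2, h3⟩ t
      by_cases ht : t ∈ ({u, v} : Finset I)
      · rcases Finset.mem_insert.mp ht with rfl | ht
        · simp [hEu, h1, hu]
        · rw [Finset.mem_singleton] at ht
          subst ht
          simp [hEv, h2, hv]
      · simpa [hD t ht] using h3 t ht
  by_cases hb : z < D u ∧ z < D v
  · have hsupp : suppSet (E * D) = suppSet E ∪ {u, v} := by
      ext t
      simp only [suppSet, Finset.mem_filter, Finset.mem_univ, true_and, Finset.mem_union, Pi.mul_apply]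
      by_cases ht : t ∈ ({u, v} : Finset I)
      · rcases Finset.mem_insert.mp ht with rfl | ht
        · simp only [hEu, one_mul, ht, or_true, iff_true]; omega
        · rw [Finset.mem_singleton] at ht
          subst ht
          simp only [hEv, one_mul]
          simp
          omega
      · simp only [hD t ht, mul_one, ht, or_false]
    have hW : ∏ _p ∈ ((∏ t, E t) * (D u * D v)).primeFactors, m⁻¹ =
        (∏ _p ∈ (∏ t, E t).primeFactors, m⁻¹) * ((∏ _p ∈ (D u).primeFactors, m⁻¹) *
          ∏ _p ∈ (D v).primeFactors, m⁻¹) := by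
      rw [hco.primeFactors_mul, Finset.prod_union hco.disjoint_primeFactors,
        hab.primeFactors_mul, Finset.prod_union hab.disjoint_primeFactors]
    have hcfu : linkCoeff Φ θ m z {u, v} E u (D u) = θ (D u) * (∏ _p ∈ (D u).primeFactors, m⁻¹) *
        edgeSymb Φ {u, v} E u (D u) := if_pos ⟨hb.1, hou, hsa, hcu⟩
    have hcfv : linkCoeff Φ θ m z {u, v} E v (D v) = θ (D v) * (∏ _p ∈ (D v).primeFactors, m⁻¹) *
        edgeSymb Φ {u, v} E v (D v) := if_pos ⟨hb.2, hov, hsb, hcv⟩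
    rw [hcfu, hcfv, linkConst,
      symbProd_mul_pair hΦ huv ho he hE hD hs, hprod, hW, map_mul, map_mul, hsupp]
    by_cases h3 : ∀ t ∉ ({u, v} : Finset I), z < E t ↔ t ∈ B
    · rw [if_pos (hbig.mpr ⟨hb.1, hb.2, h3⟩)]
      by_cases hg : good (suppSet E ∪ {u, v})
      · rw [if_pos hg, if_pos ⟨h3, hg⟩]
        ring
      · rw [if_neg hg, if_neg (fun h => hg h.2)]
        ring
    · rw [if_neg (fun h => h3 (hbig.mp h).2.2), if_neg (fun h => h3 h.1), zero_mul, zero_mul]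
  · rw [if_neg (fun h => hb ⟨(hbig.mp h).1, (hbig.mp h).2.1⟩)]
    have hR : linkCoeff Φ θ m z {u, v} E u (D u) = 0 ∨ linkCoeff Φ θ m z {u, v} E v (D v) = 0 := by
      by_contra! h
      exact hb ⟨(linkCoeff_ne_zero h.1).1, (linkCoeff_ne_zero h.2).1⟩
    rcases hR with h | h <;> rw [h] <;> simp

theorem sum_bigSet_mul_pair {Φ : I → I → ℕ} (hΦ : ∀ x, Φ x x = 0) {θ : ℕ →*₀ ℝ} (hθ2 : θ 2 = 0)
    (m : ℝ) {z : ℕ} (hz : 1 ≤ z) {B : Finset I} {u v : I} (hu : u ∈ B) (hv : v ∈ B)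
    (ho : Odd (Φ u v)) (he : Even (Φ v u)) (good : Finset I → Prop) {N : ℕ} {E : I → ℕ}
    (hEN : E ∈ tuplesLT I N) (hE : ∀ t ∈ ({u, v} : Finset I), E t = 1) :
    ∑ D ∈ (tuplesLT I N).filter (fun D => ∀ t ∉ ({u, v} : Finset I), D t = 1),
      (if E * D ∈ tuplesLT I N then (if bigSet z (E * D) = B then θ (∏ t, (E * D) t) *
        (∏ _p ∈ (∏ t, (E * D) t).primeFactors, m⁻¹) *
        (if good (suppSet (E * D)) then 1 else 0) * symbProd Φ (E * D) else 0) else 0) =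
    linkConst Φ θ m z B good {u, v} E * ∑ a ∈ Ioc 0 ((N - 1) / ∏ t, E t),
      ∑ b ∈ Ioc 0 ((N - 1) / (∏ t, E t) / a), linkCoeff Φ θ m z {u, v} E u a *
        linkCoeff Φ θ m z {u, v} E v b * jacobiSym a b := by
  have huv : u ≠ v := by
    rintro rfl
    rw [hΦ] at ho
    exact absurd ho (by decide)
  obtain ⟨hEs, hEN'⟩ := mem_tuplesLT.mp hEN
  set q := ∏ t, E t with hqdef
  have hq : 0 < q := hEs.ne_zero.bot_lt
  set Y := (N - 1) / q with hY
  have hlt : ∀ k, k ≤ Y ↔ q * k < N := fun k => by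
    rw [Nat.le_div_iff_mul_le hq, mul_comm]; omega
  have hpair : ∀ D : I → ℕ, (∀ t ∉ ({u, v} : Finset I), D t = 1) → ∏ t, D t = D u * D v := by
    intro D hD
    rw [← Finset.prod_pair huv]
    exact (Finset.prod_subset (Finset.subset_univ _) fun t _ ht => hD t ht).symm
  have hsub : (tuplesLT I (Y + 1)).filter (fun D => ∀ t ∉ ({u, v} : Finset I), D t = 1) ⊆
      (tuplesLT I N).filter (fun D => ∀ t ∉ ({u, v} : Finset I), D t = 1) := by
    intro D hD
    rw [Finset.mem_filter, mem_tuplesLT] at hD ⊢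
    refine ⟨⟨hD.1.1, ?_⟩, hD.2⟩
    have := (hlt _).mp (Nat.lt_succ_iff.mp hD.1.2)
    exact (Nat.le_mul_of_pos_left _ hq).trans_lt this
  rw [← Finset.sum_subset hsub]
  · rw [Finset.mul_sum]
    simp_rw [Finset.mul_sum]
    rw [Finset.sum_sigma']
    refine Finset.sum_of_injOn (fun D => ⟨D u, D v⟩) ?_ ?_ ?_ ?_
    · intro D hD D' hD' h
      simp only [Finset.mem_coe, Finset.mem_filter] at hD hD'
      simp only [Sigma.mk.injEq, heq_eq_eq] at h
      funext t
      by_cases ht : t ∈ ({u, v} : Finset I)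
      · rcases Finset.mem_insert.mp ht with rfl | ht
        · exact h.1
        · rw [Finset.mem_singleton.mp ht]; exact h.2
      · rw [hD.2 t ht, hD'.2 t ht]
    · intro D hD
      obtain ⟨hDm, hDS⟩ := Finset.mem_filter.mp (Finset.mem_coe.mp hD)
      obtain ⟨hDs, hDY⟩ := mem_tuplesLT.mp hDm
      have hu0 : 0 < D u := (squarefree_of_squarefree_prod hDs u).ne_zero.bot_lt
      have hv0 : 0 < D v := (squarefree_of_squarefree_prod hDs v).ne_zero.bot_lt
      rw [hpair D hDS] at hDY
      have hle := Nat.lt_succ_iff.mp hDY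
      rw [Finset.mem_coe, Finset.mem_sigma, Finset.mem_Ioc, Finset.mem_Ioc]
      refine ⟨⟨hu0, (Nat.le_mul_of_pos_right _ hv0).trans hle⟩, hv0, ?_⟩
      rw [Nat.le_div_iff_mul_le hu0, mul_comm]
      exact hle
    · rintro ⟨a, b⟩ hab hni
      rw [Finset.mem_sigma, Finset.mem_Ioc, Finset.mem_Ioc] at hab
      dsimp only at hab ⊢
      by_contra hne
      obtain ⟨-, hne⟩ := mul_ne_zero_iff.mp hne
      obtain ⟨hne, hJ⟩ := mul_ne_zero_iff.mp hne
      obtain ⟨ha, hb⟩ := mul_ne_zero_iff.mp hne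
      have hsa := (linkCoeff_ne_zero ha).2.2.1
      have hsb := (linkCoeff_ne_zero hb).2.2.1
      have hco : a.Coprime b := by
        by_contra hco
        have hJ0 : jacobiSym a b = 0 := by
          rw [jacobiSym.eq_zero_iff]
          exact ⟨hsb.ne_zero, by simpa using hco⟩
        exact hJ (by rw [hJ0, Int.cast_zero])
      have hoff : ∀ t ∉ ({u, v} : Finset I), (if t = u then a else if t = v then b else 1) = 1 := by
        intro t ht
        rw [Finset.mem_insert, Finset.mem_singleton, not_or] at ht
        rw [if_neg ht.1, if_neg ht.2]
      refine hni ⟨fun t => if t = u then a else if t = v then b else 1, ?_, ?_⟩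
      · rw [Finset.mem_coe, Finset.mem_filter, mem_tuplesLT, hpair _ hoff, if_pos rfl,
          if_neg huv.symm, if_pos rfl]
        refine ⟨⟨Nat.squarefree_mul_iff.mpr ⟨hco, hsa, hsb⟩, Nat.lt_succ_iff.mpr ?_⟩, hoff⟩
        rw [mul_comm]
        exact (Nat.le_div_iff_mul_le hab.1.1).mp hab.2.2
      · simp [huv.symm]
    · intro D hD
      obtain ⟨hDm, hDS⟩ := Finset.mem_filter.mp hD
      obtain ⟨hDs, hDY⟩ := mem_tuplesLT.mp hDm
      have hlt' := (hlt _).mp (Nat.lt_succ_iff.mp hDY)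
      have hprod : ∏ t, (E * D) t = q * ∏ t, D t := Finset.prod_mul_distrib
      by_cases hco : q.Coprime (∏ t, D t)
      · have hs : Squarefree (∏ t, (E * D) t) := by
          rw [hprod]; exact Nat.squarefree_mul_iff.mpr ⟨hco, hEs, hDs⟩
        rw [if_pos (mem_tuplesLT.mpr ⟨hs, hprod ▸ hlt'⟩)]
        exact ite_bigSet_mul_pair hΦ hθ2 m hz hu hv ho he good hE hDS hs
      · rw [if_neg]
        · have : linkCoeff Φ θ m z {u, v} E u (D u) * linkCoeff Φ θ m z {u, v} E v (D v) = 0 := by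
            by_contra hne
            obtain ⟨ha, hb⟩ := mul_ne_zero_iff.mp hne
            refine hco ?_
            rw [hpair D hDS]
            exact (linkCoeff_ne_zero ha).2.2.2.mul_right (linkCoeff_ne_zero hb).2.2.2
          dsimp only
          rw [this]
          simp
        · intro h
          have := (mem_tuplesLT.mp h).1
          rw [hprod] at this
          exact hco (Nat.squarefree_mul_iff.mp this).1
  · intro D hD hD'
    rw [if_neg]
    intro h
    obtain ⟨hDm, hDS⟩ := Finset.mem_filter.mp hD
    refine hD' (Finset.mem_filter.mpr ⟨mem_tuplesLT.mpr ⟨(mem_tuplesLT.mp hDm).1, ?_⟩, hDS⟩)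
    rw [Nat.lt_succ_iff, hlt, hqdef, ← Finset.prod_mul_distrib]
    exact (mem_tuplesLT.mp h).2

theorem abs_sum_bigSet_eq_le {Φ : I → I → ℕ} (hΦ : ∀ x, Φ x x = 0) {θ : ℕ →*₀ ℝ}
    (hθ : ∀ n, |θ n| ≤ 1) (hθ2 : θ 2 = 0) {m : ℝ} (hm : 1 ≤ m) {z : ℕ} (hz : 1 ≤ z) {B : Finset I}
    {u v : I} (hu : u ∈ B) (hv : v ∈ B) (ho : Odd (Φ u v)) (he : Even (Φ v u))
    (good : Finset I → Prop) {N : ℕ} (hN : 1 ≤ N) :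
    |∑ D ∈ (tuplesLT I N).filter (fun D => bigSet z D = B), θ (∏ t, D t) *
      (∏ _p ∈ (∏ t, D t).primeFactors, m⁻¹) * (if good (suppSet D) then 1 else 0) * symbProd Φ D| ≤
      15 * N * (1 + Real.log N) ^ Fintype.card I * (1 + Real.log ((3 * N) ^ 4)) ^ 33 *
        (z : ℝ) ^ (-(1 / 32) : ℝ) := by
  rw [Finset.sum_filter, sum_tuplesLT_split {u, v}]
  set H := 1 + Real.log ((3 * (N : ℝ)) ^ 4) with hH
  have hH0 : 0 ≤ H := by
    have : (1 : ℝ) ≤ (3 * (N : ℝ)) ^ 4 := one_le_pow₀ (by exact_mod_cast (by omega : 1 ≤ 3 * N))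
    have := Real.log_nonneg this
    linarith
  have hin : ∀ E ∈ (tuplesLT I N).filter (fun D => ∀ t ∈ ({u, v} : Finset I), D t = 1),
      |∑ D ∈ (tuplesLT I N).filter (fun D => ∀ t ∉ ({u, v} : Finset I), D t = 1),
        (if E * D ∈ tuplesLT I N then (if bigSet z (E * D) = B then θ (∏ t, (E * D) t) *
          (∏ _p ∈ (∏ t, (E * D) t).primeFactors, m⁻¹) *
          (if good (suppSet (E * D)) then 1 else 0) * symbProd Φ (E * D) else 0) else 0)| ≤
        15 * N * ((∏ t, E t : ℕ) : ℝ)⁻¹ * H ^ 33 * (z : ℝ) ^ (-(1 / 32) : ℝ) := by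
    intro E hE
    obtain ⟨hEm, hES⟩ := Finset.mem_filter.mp hE
    obtain ⟨hEs, hEN⟩ := mem_tuplesLT.mp hEm
    rw [sum_bigSet_mul_pair hΦ hθ2 m hz hu hv ho he good hEm hES, abs_mul]
    set q := ∏ t, E t with hqdef
    have hq : 0 < q := hEs.ne_zero.bot_lt
    have hY : 1 ≤ (N - 1) / q := by
      rw [Nat.one_le_div_iff hq]; omega
    have hYN : (((N - 1) / q : ℕ) : ℝ) ≤ N * (q : ℝ)⁻¹ := by
      rw [← div_eq_mul_inv]
      refine Nat.cast_div_le.trans ?_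
      gcongr
      exact Nat.sub_le _ _
    have hYN' : (((N - 1) / q : ℕ) : ℝ) ≤ N := by
      exact_mod_cast (Nat.div_le_self _ _).trans (Nat.sub_le _ _)
    have hY0 : (0 : ℝ) < (((N - 1) / q : ℕ) : ℝ) := by exact_mod_cast hY
    refine (mul_le_of_le_one_left (abs_nonneg _) (abs_linkConst_le Φ hθ hm z B good _ E)).trans ?_
    refine (abs_sum_hyperbola_le (z := z) (H := H) (by exact_mod_cast hz) hY ?_
      (fun a => abs_linkCoeff_le Φ hθ hm z _ E u a) (fun a => abs_linkCoeff_le Φ hθ hm z _ E v a)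
      ?_ ?_).trans ?_
    · rw [hH]
      gcongr
    · intro a ha
      have := linkCoeff_ne_zero ha
      exact ⟨by exact_mod_cast this.1, this.2.1, this.2.2.1⟩
    · intro a ha
      have := linkCoeff_ne_zero ha
      exact ⟨by exact_mod_cast this.1, this.2.1, this.2.2.1⟩
    · rw [mul_assoc 15 (N : ℝ)]
      gcongr
  refine (Finset.abs_sum_le_sum_abs _ _).trans ((Finset.sum_le_sum hin).trans ?_)
  have hsub : (tuplesLT I N).filter (fun D => ∀ t ∈ ({u, v} : Finset I), D t = 1) ⊆
      Fintype.piFinset (fun _ : I => Ioc 0 N) := by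
    intro E hE
    obtain ⟨hEs, hEN⟩ := mem_tuplesLT.mp (Finset.mem_filter.mp hE).1
    refine Fintype.mem_piFinset.mpr fun t => Finset.mem_Ioc.mpr
      ⟨(squarefree_of_squarefree_prod hEs t).ne_zero.bot_lt, ?_⟩
    exact (Nat.le_of_dvd hEs.ne_zero.bot_lt (Finset.dvd_prod_of_mem E (mem_univ t))).trans hEN.le
  calc _ ≤ ∑ E ∈ Fintype.piFinset (fun _ : I => Ioc 0 N),
        15 * N * ((∏ t, E t : ℕ) : ℝ)⁻¹ * H ^ 33 * (z : ℝ) ^ (-(1 / 32) : ℝ) :=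
        Finset.sum_le_sum_of_subset_of_nonneg hsub fun _ _ _ => by positivity
    _ = 15 * N * (∑ E ∈ Fintype.piFinset (fun _ : I => Ioc 0 N), ((∏ t, E t : ℕ) : ℝ)⁻¹) *
        H ^ 33 * (z : ℝ) ^ (-(1 / 32) : ℝ) := by
        rw [Finset.mul_sum, Finset.sum_mul, Finset.sum_mul]
    _ ≤ _ := by
        gcongr
        exact sum_piFinset_inv_le N

end

theorem tendsto_log_log_natCast : Tendsto (fun N : ℕ => Real.log (Real.log N)) atTop atTop :=
  Real.tendsto_log_atTop.comp (Real.tendsto_log_atTop.comp tendsto_natCast_atTop_atTop)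

theorem tendsto_sq_add_two_pow_mul_exp (k : ℕ) {c : ℝ} (hc : 0 < c) (A : ℝ) :
    Tendsto (fun l : ℝ => A * (l ^ 2 + 2) ^ k * Real.exp (-(c * l))) atTop (nhds 0) := by
  have h1 : Tendsto (fun l : ℝ => |A| * 3 ^ k * (l ^ (2 * k) / Real.exp (c * l))) atTop (nhds 0) := by
    have := (isLittleO_pow_exp_pos_mul_atTop (k := 2 * k) hc).tendsto_div_nhds_zero.const_mul
      (|A| * 3 ^ k)
    rwa [mul_zero] at this
  refine squeeze_zero_norm' ?_ h1
  filter_upwards [eventually_ge_atTop 1] with l hl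
  rw [Real.norm_eq_abs, abs_mul, abs_mul, abs_of_pos (Real.exp_pos _),
    abs_of_nonneg (by positivity : 0 ≤ (l ^ 2 + 2) ^ k), Real.exp_neg, pow_mul, div_eq_mul_inv]
  have : (l ^ 2 + 2) ^ k ≤ 3 ^ k * (l ^ 2) ^ k := by
    rw [← mul_pow]
    gcongr
    nlinarith
  calc |A| * (l ^ 2 + 2) ^ k * (Real.exp (c * l))⁻¹ ≤
      |A| * (3 ^ k * (l ^ 2) ^ k) * (Real.exp (c * l))⁻¹ := by gcongr
    _ = _ := by ring

/-- The threshold between small and large variables. -/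
def sizeCutoff (N : ℕ) : ℕ := ⌈Real.exp (Real.log (Real.log N) ^ 2)⌉₊

theorem exp_le_sizeCutoff (N : ℕ) : Real.exp (Real.log (Real.log N) ^ 2) ≤ sizeCutoff N :=
  Nat.le_ceil _

theorem one_le_sizeCutoff (N : ℕ) : 1 ≤ sizeCutoff N := Nat.ceil_pos.mpr (Real.exp_pos _)

theorem sizeCutoff_le (N : ℕ) : (sizeCutoff N : ℝ) ≤ Real.exp (Real.log (Real.log N) ^ 2 + 1) := by
  have h1 : (sizeCutoff N : ℝ) ≤ Real.exp (Real.log (Real.log N) ^ 2) + 1 :=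
    (Nat.ceil_lt_add_one (Real.exp_nonneg _)).le
  have h2 : (1 : ℝ) ≤ Real.exp (Real.log (Real.log N) ^ 2) := Real.one_le_exp (sq_nonneg _)
  have h3 : (2 : ℝ) ≤ Real.exp 1 := by linarith [Real.add_one_le_exp (1 : ℝ)]
  rw [Real.exp_add]
  nlinarith

theorem log_sizeCutoff_le (N : ℕ) : Real.log (sizeCutoff N) ≤ Real.log (Real.log N) ^ 2 + 1 := by
  rw [Real.log_le_iff_le_exp (by exact_mod_cast one_le_sizeCutoff N)]
  exact sizeCutoff_le N

theorem log_eq_exp_log_log {N : ℕ} (hN : 3 ≤ N) : Real.log N = Real.exp (Real.log (Real.log N)) :=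
  (Real.exp_log (Real.log_pos (by exact_mod_cast (by omega : 1 < N)))).symm

theorem tendsto_exp_quadratic (A a : ℝ) {c : ℝ} (hc : 0 < c) :
    Tendsto (fun l : ℝ => A * Real.exp (a * l - c * l ^ 2)) atTop (nhds 0) := by
  have h1 : Tendsto (fun l : ℝ => l * (c * l - a)) atTop atTop :=
    tendsto_id.atTop_mul_atTop₀ (tendsto_atTop_add_const_right _ _ (tendsto_id.const_mul_atTop hc))
  have := ((Real.tendsto_exp_neg_atTop_nhds_zero).comp h1).const_mul A
  rw [mul_zero] at this
  refine this.congr fun l => ?_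
  simp only [Function.comp_apply]
  congr 2
  ring

theorem tendsto_bilinear_bound (i : ℕ) :
    Tendsto (fun N : ℕ => 15 * (1 + Real.log N) ^ i * (1 + Real.log ((3 * N) ^ 4)) ^ 33 *
      (sizeCutoff N : ℝ) ^ (-(1 / 32) : ℝ)) atTop (nhds 0) := by
  refine squeeze_zero' ?_ ?_ ((tendsto_exp_quadratic (15 * 2 ^ i * 20 ^ 33) (i + 33 : ℕ)
    (by norm_num : (0 : ℝ) < 1 / 32)).comp tendsto_log_log_natCast)
  · filter_upwards [eventually_ge_atTop 3] with N hN
    have h1 : 0 ≤ Real.log N := Real.log_natCast_nonneg N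
    have h2 : 0 ≤ Real.log ((3 * (N : ℝ)) ^ 4) :=
      Real.log_nonneg (one_le_pow₀ (by exact_mod_cast (by omega : 1 ≤ 3 * N)))
    positivity
  filter_upwards [eventually_ge_atTop 3,
    tendsto_log_log_natCast.eventually_ge_atTop 1] with N hN hl
  simp only [Function.comp_apply]
  have hN0 : (0 : ℝ) < N := by positivity
  have h0 := exp_le_sizeCutoff N
  have hlog : Real.log ((3 * (N : ℝ)) ^ 4) = 4 * (Real.log 3 + Real.log N) := by
    rw [Real.log_pow, Real.log_mul (by norm_num) hN0.ne']
    norm_num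
  have h3 : Real.log 3 ≤ 2 := by
    have := Real.log_le_sub_one_of_pos (by norm_num : (0 : ℝ) < 3)
    linarith
  rw [hlog, log_eq_exp_log_log hN]
  set l := Real.log (Real.log N) with hldef
  have he : 2 ≤ Real.exp l := by linarith [Real.add_one_le_exp l]
  have hz : (sizeCutoff N : ℝ) ^ (-(1 / 32) : ℝ) ≤ Real.exp (-(1 / 32 * l ^ 2)) := by
    have : Real.exp (-(1 / 32 * l ^ 2)) = Real.exp (l ^ 2) ^ (-(1 / 32) : ℝ) := by
      rw [← Real.exp_mul]
      congr 1
      ring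
    rw [this]
    exact Real.rpow_le_rpow_of_nonpos (Real.exp_pos _) h0 (by norm_num)
  have h30 : 0 ≤ Real.log 3 := Real.log_nonneg (by norm_num)
  calc 15 * (1 + Real.exp l) ^ i * (1 + 4 * (Real.log 3 + Real.exp l)) ^ 33 *
        (sizeCutoff N : ℝ) ^ (-(1 / 32) : ℝ) ≤
      15 * (2 * Real.exp l) ^ i * (20 * Real.exp l) ^ 33 * Real.exp (-(1 / 32 * l ^ 2)) := by
        gcongr <;> linarith
    _ = 15 * 2 ^ i * 20 ^ 33 * (Real.exp l ^ (i + 33) * Real.exp (-(1 / 32 * l ^ 2))) := by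
        rw [mul_pow, mul_pow, pow_add]
        generalize (20 : ℝ) ^ 33 = E
        generalize Real.exp l ^ 33 = G
        ring
    _ = _ := by
        rw [← Real.exp_nat_mul, ← Real.exp_add, Real.log_exp, sub_eq_add_neg]

theorem le_sum_primesLE_inv {N : ℕ} (hN : 3 ≤ N) :
    1 / 8 * Real.log (Real.log N) - 2 ≤ ∑ p ∈ Nat.primesLE N, (1 : ℝ) / p := by
  have h := le_sum_primesLE_one_sub (ψ := oddChar true 1) (q := 4) (abs_oddChar_le true 1)
    (by norm_num) abs_sum_oddChar_one_le hN
  have h1 : ∑ p ∈ Nat.primesLE N, (1 - oddChar true 1 p) / p ≤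
      2 * ∑ p ∈ Nat.primesLE N, (1 : ℝ) / p := by
    rw [Finset.mul_sum]
    refine Finset.sum_le_sum fun p _ => ?_
    rw [← mul_div_assoc]
    gcongr
    have := (abs_le.mp (abs_oddChar_le true 1 p)).1
    linarith
  have h4 : Real.log ((4 : ℕ) : ℝ) ≤ 3 := by
    have := Real.log_le_sub_one_of_pos (by norm_num : (0 : ℝ) < 4)
    push_cast
    linarith
  have h40 : 0 ≤ Real.log ((4 : ℕ) : ℝ) := Real.log_natCast_nonneg 4
  have h5 : Real.log (Real.log ((4 : ℕ) : ℝ) + 3) ≤ 4 := by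
    have h6 : Real.log (Real.log ((4 : ℕ) : ℝ) + 3) ≤ Real.log 6 :=
      Real.log_le_log (by linarith) (by linarith)
    have h7 : Real.log 6 ≤ 4 := by
      rw [Real.log_le_iff_le_exp (by norm_num)]
      have h2 : (2 : ℝ) ≤ Real.exp 1 := by linarith [Real.add_one_le_exp (1 : ℝ)]
      have : Real.exp 4 = Real.exp 1 ^ 4 := by rw [← Real.exp_nat_mul]; norm_num
      rw [this]
      calc (6 : ℝ) ≤ 2 ^ 4 := by norm_num
        _ ≤ _ := by gcongr
    linarith
  push_cast at h h5
  linarith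

theorem tendsto_few_large_bound (i : ℕ) {m : ℝ} (hm : 1 ≤ m) :
    Tendsto (fun N : ℕ => Real.exp (i + 1) ^ Real.log (Real.log (sizeCutoff N)) *
      Real.exp (-(m⁻¹ * ∑ p ∈ Nat.primesLE N, (1 : ℝ) / p))) atTop (nhds 0) := by
  have hm0 : 0 < m⁻¹ := by positivity
  have hm1 : m⁻¹ ≤ 1 := inv_le_one_of_one_le₀ hm
  refine squeeze_zero' (Eventually.of_forall fun N => by positivity) ?_
    ((tendsto_sq_add_two_pow_mul_exp (i + 1) (c := m⁻¹ * (1 / 8)) (by positivity)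
      (Real.exp 2)).comp tendsto_log_log_natCast)
  filter_upwards [eventually_ge_atTop 3,
    tendsto_log_log_natCast.eventually_ge_atTop 1] with N hN hl
  simp only [Function.comp_apply]
  have h1 := le_sum_primesLE_inv hN
  have h2 := log_sizeCutoff_le N
  have h3 : Real.log (Real.log N) ^ 2 ≤ Real.log (sizeCutoff N) := by
    rw [Real.le_log_iff_exp_le (by exact_mod_cast one_le_sizeCutoff N)]
    exact exp_le_sizeCutoff N
  set l := Real.log (Real.log N) with hldef
  have h4 : Real.log (Real.log (sizeCutoff N)) ≤ Real.log (l ^ 2 + 2) :=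
    Real.log_le_log (by nlinarith) (by linarith)
  calc _ ≤ Real.exp (i + 1) ^ Real.log (l ^ 2 + 2) * Real.exp (2 - m⁻¹ * (1 / 8) * l) := by
        gcongr
        · exact Real.one_le_exp (by positivity)
        · nlinarith
    _ = _ := by
        have h5 : Real.exp (i + 1) ^ Real.log (l ^ 2 + 2) = (l ^ 2 + 2) ^ (i + 1) := by
          rw [← Real.exp_mul, mul_comm, Real.exp_mul, Real.exp_log (by positivity)]
          rw [← Real.rpow_natCast (l ^ 2 + 2) (i + 1)]
          push_cast
          rfl
        rw [h5, sub_eq_add_neg, Real.exp_add]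
        ring

theorem tendsto_max_unlinked_bound (i : ℕ) {m : ℕ} (hm : 1 ≤ m) :
    Tendsto (fun N : ℕ => (1 + Real.log (sizeCutoff N)) ^ i *
      Real.exp (-maxUnlinkedSaving i m N (sizeCutoff N))) atTop (nhds 0) := by
  have hm1 : (1 : ℝ) ≤ m := by exact_mod_cast hm
  have hmi0 : (0 : ℝ) < (m : ℝ)⁻¹ := by positivity
  have hmi1 : (m : ℝ)⁻¹ ≤ 1 := inv_le_one_of_one_le₀ hm1
  have hz : ∀ N, 0 ≤ Real.log (sizeCutoff N : ℝ) := fun N => Real.log_natCast_nonneg _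
  refine squeeze_zero' (Eventually.of_forall fun N => ?_) ?_
    ((tendsto_sq_add_two_pow_mul_exp (i + 1) (c := (m : ℝ)⁻¹ * (1 / 4)) (by positivity)
      (Real.exp 3 * (i + 7))).comp tendsto_log_log_natCast)
  · have := hz N
    positivity
  filter_upwards [eventually_ge_atTop 3,
    tendsto_log_log_natCast.eventually_ge_atTop 1] with N hN hl
  simp only [Function.comp_apply]
  have h2 := log_sizeCutoff_le N
  have hzN := hz N
  have hz1 : (1 : ℝ) ≤ sizeCutoff N := by exact_mod_cast one_le_sizeCutoff N
  have hsav : Real.exp (-maxUnlinkedSaving i m N (sizeCutoff N)) ≤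
      Real.exp 3 * (i + 7) * (Real.log (Real.log N) ^ 2 + 2) *
        Real.exp (-((m : ℝ)⁻¹ * (1 / 4) * Real.log (Real.log N))) := by
    rw [maxUnlinkedSaving, log_eq_exp_log_log hN, Real.log_mul (by norm_num) (Real.exp_pos _).ne',
      Real.log_exp, Real.log_mul (by norm_num) (by positivity), Real.log_pow]
    set l := Real.log (Real.log N) with hldef
    set K := (i + 7 : ℝ) * (l ^ 2 + 2) with hK
    have hK1 : 1 ≤ K := by rw [hK]; nlinarith [sq_nonneg l]
    have h4 : Real.log 4 ≤ 3 := by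
      have := Real.log_le_sub_one_of_pos (by norm_num : (0 : ℝ) < 4)
      linarith
    have h40 : 0 ≤ Real.log 4 := Real.log_nonneg (by norm_num)
    have h5 : Real.log (Real.log 4 + i * Real.log (sizeCutoff N) + 3) ≤ Real.log K := by
      refine Real.log_le_log (by positivity) ?_
      have : (i : ℝ) * Real.log (sizeCutoff N) ≤ i * (l ^ 2 + 1) := by gcongr
      rw [hK]
      nlinarith [sq_nonneg l]
    have hK0 : 0 ≤ Real.log K := Real.log_nonneg hK1
    have h6 : -1 ≤ Real.log (1 / 2) := by
      have := Real.one_sub_inv_le_log_of_pos (by norm_num : (0 : ℝ) < 1 / 2)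
      norm_num at this ⊢
      linarith
    calc _ ≤ Real.exp (3 + Real.log K + -((m : ℝ)⁻¹ * (1 / 4) * l)) := by
          rw [Real.exp_le_exp]
          have h7 : (m : ℝ)⁻¹ * (1 / 2 * Real.log (Real.log 4 + i * Real.log (sizeCutoff N) + 3)) ≤
              Real.log K := by
            have : (m : ℝ)⁻¹ * (1 / 2 * Real.log (Real.log 4 + i * Real.log (sizeCutoff N) + 3)) ≤
              (m : ℝ)⁻¹ * Real.log K := by
              gcongr
              linarith
            exact this.trans (mul_le_of_le_one_left hK0 hmi1)
          nlinarith
      _ = _ := by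
          rw [Real.exp_add, Real.exp_add, Real.exp_log (by linarith), hK]
          ring
  calc _ ≤ (Real.log (Real.log N) ^ 2 + 2) ^ i * (Real.exp 3 * (i + 7) *
        (Real.log (Real.log N) ^ 2 + 2) * Real.exp (-((m : ℝ)⁻¹ * (1 / 4) * Real.log (Real.log N)))) := by
        have : 1 + Real.log (sizeCutoff N) ≤ Real.log (Real.log N) ^ 2 + 2 := by linarith
        gcongr
    _ = _ := by ring

theorem eventually_sizeCutoff_pow_le (k : ℕ) : ∀ᶠ N : ℕ in atTop, sizeCutoff N ^ k ≤ N := by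
  have h1 : Tendsto (fun l : ℝ => k * (l ^ 2 + 2) ^ 1 * Real.exp (-(1 * l))) atTop (nhds 0) :=
    tendsto_sq_add_two_pow_mul_exp 1 one_pos k
  have h2 := (h1.comp tendsto_log_log_natCast).eventually_le_const zero_lt_one
  filter_upwards [h2, eventually_ge_atTop 3] with N hN h3
  simp only [Function.comp_apply, pow_one, one_mul, Real.exp_neg] at hN
  rw [← log_eq_exp_log_log h3, ← div_eq_mul_inv, div_le_one (Real.log_pos
    (by exact_mod_cast (by omega : 1 < N)))] at hN
  have hN0 : (0 : ℝ) < N := by positivity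
  have : (sizeCutoff N : ℝ) ^ k ≤ N := by
    calc (sizeCutoff N : ℝ) ^ k ≤ Real.exp (Real.log (Real.log N) ^ 2 + 1) ^ k := by
          gcongr
          exact sizeCutoff_le N
      _ = Real.exp (k * (Real.log (Real.log N) ^ 2 + 1)) := by rw [← Real.exp_nat_mul]
      _ ≤ Real.exp (Real.log N) := by
          rw [Real.exp_le_exp]
          refine le_trans ?_ hN
          gcongr
          norm_num
      _ = N := Real.exp_log hN0
  exact_mod_cast this

section

variable {I : Type*} [Fintype I]

/-- No two indices of `S` are linked, so reciprocity makes the symbols inside `S` trivial. -/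
def IsUnlinked {J : Type*} (Φ : J → J → ℕ) (S : Finset J) : Prop :=
  ∀ x ∈ S, ∀ y ∈ S, Even (Φ x y + Φ y x)

/-- A weighted symbol product, restricted to tuples whose support is `good`. -/
def charTerm (Φ : I → I → ℕ) (θ : ℕ →*₀ ℝ) (m : ℝ) (good : Finset I → Prop) (D : I → ℕ) : ℝ :=
  θ (∏ t, D t) * (∏ _p ∈ (∏ t, D t).primeFactors, m⁻¹) * (if good (suppSet D) then 1 else 0) *
    symbProd Φ D

theorem abs_weighted_symbProd_le (Φ : I → I → ℕ) {θ : ℕ →*₀ ℝ} (hθ : ∀ n, |θ n| ≤ 1) {m : ℝ}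
    (hm : 0 ≤ m) (P : Prop) (D : I → ℕ) :
    |θ (∏ t, D t) * (∏ _p ∈ (∏ t, D t).primeFactors, m⁻¹) * (if P then 1 else 0) * symbProd Φ D| ≤
      ∏ _p ∈ (∏ t, D t).primeFactors, m⁻¹ := by
  have h0 : 0 ≤ ∏ _p ∈ (∏ t, D t).primeFactors, m⁻¹ :=
    Finset.prod_nonneg fun _ _ => inv_nonneg.mpr hm
  have h1 : |symbProd Φ D| ≤ 1 := by
    simp only [symbProd, Finset.abs_prod]
    refine Finset.prod_le_one (fun _ _ => Finset.prod_nonneg fun _ _ => abs_nonneg _)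
      fun x _ => Finset.prod_le_one (fun _ _ => abs_nonneg _) fun y _ => ?_
    rw [abs_pow]
    exact pow_le_one₀ (abs_nonneg _) (abs_jacobiSym_le _ _)
  have h2 : |(if P then 1 else 0 : ℝ)| ≤ 1 := by split_ifs <;> simp
  rw [abs_mul, abs_mul, abs_mul, abs_of_nonneg h0]
  refine (mul_le_of_le_one_right (by positivity) h1).trans
    ((mul_le_of_le_one_right (by positivity) h2).trans (mul_le_of_le_one_left h0 (hθ _)))

theorem tendsto_sum_charTerm_linked {Φ : I → I → ℕ} (hΦ : ∀ x, Φ x x = 0) {θ : ℕ →*₀ ℝ}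
    (hθ : ∀ n, |θ n| ≤ 1) (hθ2 : θ 2 = 0) {m : ℝ} (hm : 1 ≤ m) (good : Finset I → Prop)
    {B : Finset I} (hB : ¬IsUnlinked Φ B) :
    Tendsto (fun N : ℕ => (∑ D ∈ (tuplesLT I N).filter (fun D => bigSet (sizeCutoff N) D = B),
      charTerm Φ θ m good D) / N) atTop (nhds 0) := by
  obtain ⟨u, hu, v, hv, ho, he⟩ : ∃ u ∈ B, ∃ v ∈ B, Odd (Φ u v) ∧ Even (Φ v u) := by
    simp only [IsUnlinked, not_forall, Nat.not_even_iff_odd] at hB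
    obtain ⟨x, hx, y, hy, h⟩ := hB
    rcases Nat.even_or_odd (Φ x y) with h1 | h1
    · exact ⟨y, hy, x, hx, (Nat.odd_add.mp (add_comm (Φ x y) _ ▸ h)).mpr h1, h1⟩
    · exact ⟨x, hx, y, hy, h1, (Nat.odd_add.mp h).mp h1⟩
  refine squeeze_zero_norm' ?_ (tendsto_bilinear_bound (Fintype.card I))
  filter_upwards [eventually_ge_atTop 1] with N hN
  have hN0 : (0 : ℝ) < N := by exact_mod_cast hN
  have := abs_sum_bigSet_eq_le hΦ hθ hθ2 hm (one_le_sizeCutoff N) hu hv ho he good hN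
  rw [Real.norm_eq_abs, abs_div, abs_of_pos hN0, div_le_iff₀ hN0]
  refine this.trans_eq ?_
  obtain ⟨E, hE⟩ : ∃ E, E = (1 + Real.log ((3 * (N : ℝ)) ^ 4)) ^ 33 := ⟨_, rfl⟩
  rw [← hE]
  ring

theorem tendsto_sum_weight_few_large (I : Type*) [Fintype I] {m : ℝ} (hm : 1 ≤ m) {B : Finset I}
    (hB : (B.card : ℝ) + 1 ≤ m) :
    Tendsto (fun N : ℕ => (∑ D ∈ (tuplesLT I N).filter (fun D => bigSet (sizeCutoff N) D ⊆ B),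
      ∏ _p ∈ (∏ t, D t).primeFactors, m⁻¹) / N) atTop (nhds 0) := by
  obtain ⟨C, hC, h⟩ := exists_sum_bigSet_subset_le I hm
  have h1 := (tendsto_few_large_bound (Fintype.card I) hm).const_mul C
  rw [mul_zero] at h1
  refine squeeze_zero' (Eventually.of_forall fun N => div_nonneg (Finset.sum_nonneg fun _ _ =>
    Finset.prod_nonneg fun _ _ => by positivity) (by positivity)) ?_ h1
  filter_upwards [eventually_ge_atTop 3,
    tendsto_log_log_natCast.eventually_ge_atTop 1] with N hN hl
  have hN0 : (0 : ℝ) < N := by positivity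
  have hz : 2 ≤ sizeCutoff N := by
    have h2 : (2 : ℝ) ≤ sizeCutoff N := by
      have := exp_le_sizeCutoff N
      have := Real.add_one_le_exp (Real.log (Real.log N) ^ 2)
      nlinarith
    exact_mod_cast h2
  rw [div_le_iff₀ hN0]
  refine (h N (sizeCutoff N) (by omega) hz B hB).trans_eq ?_
  ring

theorem tendsto_sum_charTerm_few_large (Φ : I → I → ℕ) {θ : ℕ →*₀ ℝ}
    (hθ : ∀ n, |θ n| ≤ 1) {m : ℝ} (hm : 1 ≤ m) (good : (I → ℕ) → Prop)
    {B : Finset I} (hB : (B.card : ℝ) + 1 ≤ m) :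
    Tendsto (fun N : ℕ => (∑ D ∈ (tuplesLT I N).filter (fun D => bigSet (sizeCutoff N) D = B),
      θ (∏ t, D t) * (∏ _p ∈ (∏ t, D t).primeFactors, m⁻¹) * (if good D then 1 else 0) *
        symbProd Φ D) / N) atTop (nhds 0) := by
  refine squeeze_zero_norm (fun N => ?_) (tendsto_sum_weight_few_large I hm hB)
  rw [Real.norm_eq_abs, abs_div, abs_of_nonneg (by positivity : (0 : ℝ) ≤ N)]
  gcongr
  refine (Finset.abs_sum_le_sum_abs _ _).trans ((Finset.sum_le_sum fun D _ =>
    abs_weighted_symbProd_le Φ hθ (zero_le_one.trans hm) (good D) D).trans ?_)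
  refine Finset.sum_le_sum_of_subset_of_nonneg (fun D hD => ?_) fun _ _ _ =>
    Finset.prod_nonneg fun _ _ => by positivity
  rw [Finset.mem_filter] at hD ⊢
  exact ⟨hD.1, hD.2.le⟩

/-- The supports of a maximal unlinked set can only be enlarged to a `good` set by an index
that is linked to some, but not all, of its elements. -/
def BreaksMaxUnlinked {J : Type*} (Φ : J → J → ℕ) (m : ℕ) (good : Finset J → Prop) : Prop :=
  ∀ S : Finset J, S.card = m → IsUnlinked Φ S → ∀ U, S ⊆ U → good U → ∃ u ∈ U, u ∉ S ∧
    ∃ v ∈ S, ∃ w ∈ S, Odd (Φ u v + Φ v u + Φ u w + Φ w u)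

theorem tendsto_sum_charTerm_max_unlinked {Φ : I → I → ℕ} (hΦ : ∀ x, Φ x x = 0) {θ : ℕ →*₀ ℝ}
    (hθ : ∀ n, |θ n| ≤ 1) (hθ2 : θ 2 = 0) {m : ℕ} (hm : 2 ≤ m) {good : Finset I → Prop}
    (hg : BreaksMaxUnlinked Φ m good) {S : Finset I} (hS : S.card = m) (hun : IsUnlinked Φ S) :
    Tendsto (fun N : ℕ => (∑ D ∈ (tuplesLT I N).filter (fun D => bigSet (sizeCutoff N) D = S),
      charTerm Φ θ m good D) / N) atTop (nhds 0) := by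
  have hm1 : (1 : ℝ) ≤ m := by exact_mod_cast (by omega : 1 ≤ m)
  set F : (I → ℕ) → ℝ := fun D => θ (∏ t, D t) * (∏ _p ∈ (∏ t, D t).primeFactors, (m : ℝ)⁻¹) *
    (if good (S ∪ suppSet D) then 1 else 0) * symbProd Φ D with hF
  have h1 : Tendsto (fun N : ℕ => (∑ D ∈ (tuplesLT I N).filter
      (fun D => bigSet (sizeCutoff N) D ⊆ S), F D) / N) atTop (nhds 0) := by
    obtain ⟨C, hC, h⟩ := exists_sum_symbProd_bigSet_subset_le I hm
    have h1 := (tendsto_max_unlinked_bound (Fintype.card I) (by omega : 1 ≤ m)).const_mul C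
    rw [mul_zero] at h1
    refine squeeze_zero_norm' ?_ h1
    filter_upwards [eventually_ge_atTop 9, eventually_sizeCutoff_pow_le (2 * Fintype.card I)]
      with N hN hz
    have hN0 : (0 : ℝ) < N := by positivity
    rw [Real.norm_eq_abs, abs_div, abs_of_pos hN0, div_le_iff₀ hN0]
    refine (h Φ θ hΦ hθ hθ2 S hS hun good (hg S hS hun) N _ hN (one_le_sizeCutoff N) hz).trans_eq ?_
    ring
  have h2 : Tendsto (fun N : ℕ => ∑ B ∈ S.ssubsets, (∑ D ∈ (tuplesLT I N).filter
      (fun D => bigSet (sizeCutoff N) D = B), F D) / N) atTop (nhds 0) := by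
    rw [← Finset.sum_const_zero (s := S.ssubsets)]
    refine tendsto_finsetSum _ fun B hB => ?_
    refine tendsto_sum_charTerm_few_large Φ hθ hm1 (fun D => good (S ∪ suppSet D)) ?_
    have := Finset.card_lt_card (Finset.mem_ssubsets.mp hB)
    exact_mod_cast (by omega : B.card + 1 ≤ m)
  have h3 := h1.sub h2
  rw [sub_zero] at h3
  refine h3.congr fun N => ?_
  rw [← Finset.sum_div, ← sub_div]
  congr 1
  have hfib : ∑ D ∈ (tuplesLT I N).filter (fun D => bigSet (sizeCutoff N) D ⊆ S), F D =
      ∑ B ∈ S.powerset, ∑ D ∈ (tuplesLT I N).filter (fun D => bigSet (sizeCutoff N) D = B), F D := by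
    rw [← Finset.sum_fiberwise_of_maps_to (g := bigSet (sizeCutoff N)) (t := S.powerset)]
    · refine Finset.sum_congr rfl fun B hB => ?_
      rw [Finset.filter_filter]
      congr 1
      ext D
      simp only [Finset.mem_filter]
      have := Finset.mem_powerset.mp hB
      constructor
      · rintro ⟨h, -, h'⟩; exact ⟨h, h'⟩
      · rintro ⟨h, h'⟩; exact ⟨h, h' ▸ this, h'⟩
    · intro D hD
      exact Finset.mem_powerset.mpr (Finset.mem_filter.mp hD).2
  have hpow : S.powerset = insert S S.ssubsets := by
    rw [Finset.ssubsets, Finset.insert_erase (Finset.mem_powerset_self S)]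
  rw [hfib, hpow, Finset.sum_insert (by simp [Finset.mem_ssubsets]), add_sub_cancel_right]
  refine Finset.sum_congr rfl fun D hD => ?_
  have hsub : S ⊆ suppSet D := by
    rw [← (Finset.mem_filter.mp hD).2]
    intro t ht
    have h1 := (Finset.mem_filter.mp ht).2
    have h2 := one_le_sizeCutoff N
    exact Finset.mem_filter.mpr ⟨mem_univ t, by omega⟩
  rw [charTerm, hF]
  simp only [Finset.union_eq_right.mpr hsub]

theorem tendsto_sum_charTerm {Φ : I → I → ℕ} (hΦ : ∀ x, Φ x x = 0) {θ : ℕ →*₀ ℝ}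
    (hθ : ∀ n, |θ n| ≤ 1) (hθ2 : θ 2 = 0) {m : ℕ} (hm : 2 ≤ m)
    (hmax : ∀ S, IsUnlinked Φ S → S.card ≤ m) {good : Finset I → Prop}
    (hg : BreaksMaxUnlinked Φ m good) :
    Tendsto (fun N : ℕ => (∑ D ∈ tuplesLT I N, charTerm Φ θ m good D) / N) atTop (nhds 0) := by
  have hm1 : (1 : ℝ) ≤ m := by exact_mod_cast (by omega : 1 ≤ m)
  have h : Tendsto (fun N : ℕ => ∑ B : Finset I, (∑ D ∈ (tuplesLT I N).filter
      (fun D => bigSet (sizeCutoff N) D = B), charTerm Φ θ m good D) / N) atTop (nhds 0) := by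
    rw [← Finset.sum_const_zero (s := (univ : Finset (Finset I)))]
    refine tendsto_finsetSum _ fun B _ => ?_
    by_cases hB : IsUnlinked Φ B
    · rcases (hmax B hB).eq_or_lt with hc | hc
      · exact tendsto_sum_charTerm_max_unlinked hΦ hθ hθ2 hm hg hc hB
      · exact tendsto_sum_charTerm_few_large Φ hθ hm1 (fun D => good (suppSet D))
          (by exact_mod_cast (by omega : B.card + 1 ≤ m))
    · exact tendsto_sum_charTerm_linked hΦ hθ hθ2 hm1 good hB
  refine h.congr fun N => ?_
  rw [← Finset.sum_div]
  congr 1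
  exact Finset.sum_fiberwise _ _ _

end

/-- The exponent of the symbol of an entry in position `a` over an entry in position `b`, for a
triple of discriminants whose prime factors carry a choice of summand. -/
def tripleExp (a b : Fin 3 × Bool) : ℕ := if a.1 ≠ b.1 ∧ a.2 = true then 1 else 0

/-- The exponent attached to a product of `K` copies of a sum over triples. -/
def tripleExpPow (K : ℕ) (u v : Fin K → Fin 3 × Bool) : ℕ := ∑ j, tripleExp (u j) (v j)

theorem tripleExpPow_self {K : ℕ} (u : Fin K → Fin 3 × Bool) : tripleExpPow K u u = 0 := by
  simp [tripleExpPow, tripleExp]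

/-- Two indices are linked when this number is odd. -/
def linkNum (K : ℕ) (u v : Fin K → Fin 3 × Bool) : ℕ := tripleExpPow K u v + tripleExpPow K v u

theorem even_tripleExp_add (a b : Fin 3 × Bool) :
    Even (tripleExp a b + tripleExp b a) ↔ a.1 = b.1 ∨ a.2 = b.2 := by
  obtain ⟨i, e⟩ := a
  obtain ⟨j, e'⟩ := b
  by_cases hij : i = j
  · simp [tripleExp, hij]
  · have hji : ¬ j = i := fun h => hij h.symm
    cases e <;> cases e' <;> simp [tripleExp, hij, hji]

theorem linkNum_eq_sum {K : ℕ} (u v : Fin K → Fin 3 × Bool) :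
    linkNum K u v = ∑ j, (tripleExp (u j) (v j) + tripleExp (v j) (u j)) :=
  Finset.sum_add_distrib.symm

theorem linkNum_cons {K : ℕ} (a b : Fin 3 × Bool) (s t : Fin K → Fin 3 × Bool) :
    linkNum (K + 1) (Fin.cons a s) (Fin.cons b t) =
      (tripleExp a b + tripleExp b a) + linkNum K s t := by
  rw [linkNum_eq_sum, linkNum_eq_sum, Fin.sum_univ_succ]
  simp

theorem even_linkNum_cons {K : ℕ} (a b : Fin 3 × Bool) (s t : Fin K → Fin 3 × Bool) :
    Even (linkNum (K + 1) (Fin.cons a s) (Fin.cons b t)) ↔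
      ((a.1 = b.1 ∨ a.2 = b.2) ↔ Even (linkNum K s t)) := by
  rw [linkNum_cons, Nat.even_add, even_tripleExp_add]

/-- The indices whose Boolean parts are prescribed. -/
def boolFiber {K : ℕ} (ε : Fin K → Bool) : Finset (Fin K → Fin 3 × Bool) :=
  univ.filter fun u => ∀ j, (u j).2 = ε j

theorem mem_boolFiber {K : ℕ} {ε : Fin K → Bool} {u : Fin K → Fin 3 × Bool} :
    u ∈ boolFiber ε ↔ ∀ j, (u j).2 = ε j := by
  simp [boolFiber]

theorem even_linkNum_of_mem_boolFiber {K : ℕ} {ε : Fin K → Bool} {u v : Fin K → Fin 3 × Bool}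
    (hu : u ∈ boolFiber ε) (hv : v ∈ boolFiber ε) : Even (linkNum K u v) := by
  rw [linkNum_eq_sum]
  refine Finset.even_sum _ fun j _ => ?_
  rw [even_tripleExp_add]
  exact Or.inr ((mem_boolFiber.mp hu j).trans (mem_boolFiber.mp hv j).symm)

theorem even_linkNum_iff_of_forall_ne {K : ℕ} {u v : Fin K → Fin 3 × Bool} (c : Fin K)
    (h : ∀ j, j ≠ c → (u j).1 = (v j).1) :
    Even (linkNum K u v) ↔ (u c).1 = (v c).1 ∨ (u c).2 = (v c).2 := by
  rw [linkNum_eq_sum, ← Finset.add_sum_erase _ _ (mem_univ c), Nat.even_add, even_tripleExp_add]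
  have : Even (∑ x ∈ univ.erase c, (tripleExp (u x) (v x) + tripleExp (v x) (u x))) := by
    refine Finset.even_sum _ fun j hj => ?_
    rw [even_tripleExp_add]
    exact Or.inl (h j (Finset.ne_of_mem_erase hj))
  simp [this]

theorem boolFiber_label_unique {K : ℕ} {ε ε' : Fin K → Bool} {f g : (Fin K → Fin 3 × Bool) → Bool}
    (h : ∀ s ∈ boolFiber ε, ∀ t ∈ boolFiber ε', f s = g t ↔ Even (linkNum K s t)) : ε = ε' := by
  by_contra hne
  obtain ⟨c, hc⟩ := Function.ne_iff.mp hne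
  let p (ε : Fin K → Bool) (i : Fin 3) : Fin K → Fin 3 × Bool := fun j => (if j = c then i else 0, ε j)
  have hp : ∀ ε i, p ε i ∈ boolFiber ε := fun ε i => mem_boolFiber.mpr fun j => rfl
  have key : ∀ i i', f (p ε i) = g (p ε' i') ↔ i = i' := by
    intro i i'
    rw [h _ (hp ε i) _ (hp ε' i'), even_linkNum_iff_of_forall_ne c]
    · simp [p, hc]
    · intro j hj
      simp [p, hj]
  have h00 := key 0 0
  have h02 := key 0 2
  have h10 := key 1 0
  have h12 := key 1 2
  simp only [Fin.reduceEq, iff_false, iff_true] at h00 h02 h10 h12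
  revert h00 h02 h10 h12
  generalize f (p ε 0) = a
  generalize f (p ε 1) = b
  generalize g (p ε' 0) = a'
  generalize g (p ε' 2) = b'
  revert a b a' b'
  decide

/-- The elements of `S` with first entry `a`, with that entry removed. -/
def consSlice {K : ℕ} (S : Finset (Fin (K + 1) → Fin 3 × Bool)) (a : Fin 3 × Bool) :
    Finset (Fin K → Fin 3 × Bool) :=
  univ.filter fun t => (Fin.cons a t : Fin (K + 1) → Fin 3 × Bool) ∈ S

theorem mem_consSlice {K : ℕ} {S : Finset (Fin (K + 1) → Fin 3 × Bool)} {a : Fin 3 × Bool}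
    {t : Fin K → Fin 3 × Bool} :
    t ∈ consSlice S a ↔ (Fin.cons a t : Fin (K + 1) → Fin 3 × Bool) ∈ S := by
  simp [consSlice]

theorem card_eq_sum_consSlice {K : ℕ} (S : Finset (Fin (K + 1) → Fin 3 × Bool)) :
    S.card = ∑ i, ((consSlice S (i, false)).card + (consSlice S (i, true)).card) := by
  have h1 : S.card = ∑ a, (consSlice S a).card := by
    rw [← Finset.card_sigma]
    refine Finset.card_bij' (fun u _ => ⟨u 0, Fin.tail u⟩) (fun x _ => Fin.cons x.1 x.2) ?_ ?_ ?_ ?_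
    · intro u hu
      simp [mem_consSlice, hu]
    · rintro ⟨a, t⟩ h
      simpa [mem_consSlice] using h
    · intro u hu
      simp
    · rintro ⟨a, t⟩ h
      simp
  rw [h1, Fintype.sum_prod_type]
  refine Finset.sum_congr rfl fun i _ => ?_
  rw [Fintype.sum_bool, add_comm]

theorem card_le_of_isUnlinked {K : ℕ} : ∀ {S : Finset (Fin K → Fin 3 × Bool)},
    IsUnlinked (tripleExpPow K) S → S.card ≤ 3 ^ K ∧ (S.card = 3 ^ K → ∃ ε, S = boolFiber ε) := by
  induction K with
  | zero =>
    intro S _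
    have h : S.card ≤ 1 := (Finset.card_le_univ S).trans (by simp)
    refine ⟨by simpa using h, fun hS => ⟨fun _ => true, ?_⟩⟩
    have : S = univ := (Finset.card_eq_iff_eq_univ S).mp (by simpa using hS)
    rw [this]
    ext u
    simp only [mem_univ, mem_boolFiber, true_iff]
    exact fun j => j.elim0
  | succ K ih =>
    intro S hS
    have hS' : ∀ a b s t, s ∈ consSlice S a → t ∈ consSlice S b →
        ((a.1 = b.1 ∨ a.2 = b.2) ↔ Even (linkNum K s t)) := by
      intro a b s t hs ht
      exact (even_linkNum_cons a b s t).mp (hS _ (mem_consSlice.mp hs) _ (mem_consSlice.mp ht))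
    have hun : ∀ i, IsUnlinked (tripleExpPow K) (consSlice S (i, false) ∪ consSlice S (i, true)) := by
      intro i s hs t ht
      rw [Finset.mem_union] at hs ht
      rcases hs with hs | hs <;> rcases ht with ht | ht <;>
        exact (hS' _ _ s t hs ht).mp (Or.inl rfl)
    have hpos : 0 < 3 ^ K := by positivity
    by_cases hdis : ∀ i, Disjoint (consSlice S (i, false)) (consSlice S (i, true))
    · have hcard : S.card = ∑ i, (consSlice S (i, false) ∪ consSlice S (i, true)).card := by
        rw [card_eq_sum_consSlice]
        exact Finset.sum_congr rfl fun i _ => (Finset.card_union_of_disjoint (hdis i)).symm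
      have hle := fun i => (ih (hun i)).1
      refine ⟨?_, fun heq => ?_⟩
      · rw [hcard]
        refine (Finset.sum_le_sum fun i _ => hle i).trans_eq ?_
        simp [pow_succ, mul_comm]
      have hT : ∀ i, ∃ ε, consSlice S (i, false) ∪ consSlice S (i, true) = boolFiber ε := by
        intro i
        refine (ih (hun i)).2 ?_
        have h0 := hle 0
        have h1 := hle 1
        have h2 := hle 2
        rw [heq, Fin.sum_univ_three, pow_succ] at hcard
        fin_cases i <;> simp only [Fin.zero_eta, Fin.mk_one, Fin.reduceFinMk] <;> omega
      choose ε hε using hT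
      let lab (i : Fin 3) (s : Fin K → Fin 3 × Bool) : Bool := decide (s ∈ consSlice S (i, true))
      have hlab : ∀ i, ∀ s ∈ boolFiber (ε i), s ∈ consSlice S (i, lab i s) := by
        intro i s hs
        rw [← hε i, Finset.mem_union] at hs
        by_cases h : s ∈ consSlice S (i, true)
        · simp [lab, h]
        · simpa [lab, h] using hs.resolve_right h
      have hij : ∀ i j, i ≠ j → ∀ s ∈ boolFiber (ε i), ∀ t ∈ boolFiber (ε j),
          lab i s = lab j t ↔ Even (linkNum K s t) := by
        intro i j hne s hs t ht
        rw [← hS' _ _ s t (hlab i s hs) (hlab j t ht)]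
        simp [hne]
      have hεε : ∀ i j, ε i = ε j := by
        intro i j
        by_cases hne : i = j
        · rw [hne]
        · exact boolFiber_label_unique (hij i j hne)
      have hconst : ∀ i j, i ≠ j → ∀ s ∈ boolFiber (ε 0), ∀ t ∈ boolFiber (ε 0),
          lab i s = lab j t := by
        intro i j hne s hs t ht
        rw [hij i j hne s (by rwa [hεε i 0]) t (by rwa [hεε j 0])]
        exact even_linkNum_of_mem_boolFiber hs ht
      let s₀ : Fin K → Fin 3 × Bool := fun j => (0, ε 0 j)
      have hs₀ : s₀ ∈ boolFiber (ε 0) := mem_boolFiber.mpr fun j => rfl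
      have hall : ∀ i, ∀ s ∈ boolFiber (ε 0), lab i s = lab 0 s₀ := by
        intro i s hs
        by_cases hi : i = 0
        · subst hi
          rw [hconst 0 1 (by decide) s hs s₀ hs₀, hconst 0 1 (by decide) s₀ hs₀ s₀ hs₀]
        · exact hconst i 0 hi s hs s₀ hs₀
      refine ⟨Fin.cons (lab 0 s₀) (ε 0), ?_⟩
      ext u
      obtain ⟨a, t, rfl⟩ : ∃ a t, u = Fin.cons a t := ⟨u 0, Fin.tail u, (Fin.cons_self_tail u).symm⟩
      obtain ⟨i, e⟩ := a
      rw [← mem_consSlice, mem_boolFiber, Fin.forall_fin_succ]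
      simp only [Fin.cons_zero, Fin.cons_succ]
      rw [← mem_boolFiber]
      constructor
      · intro h
        have ht : t ∈ boolFiber (ε 0) := by
          rw [hεε 0 i, ← hε i, Finset.mem_union]
          cases e
          · exact Or.inl h
          · exact Or.inr h
        refine ⟨?_, ht⟩
        rw [← hall i t ht]
        cases e
        · have := Finset.disjoint_left.mp (hdis i) h
          simp [lab, this]
        · simp [lab, h]
      · rintro ⟨rfl, ht⟩
        rw [← hall i t ht]
        exact hlab i t (by rwa [hεε i 0])
    · simp only [not_forall] at hdis
      obtain ⟨i, hi⟩ := hdis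
      obtain ⟨s, hs, hs'⟩ := Finset.not_disjoint_iff.mp hi
      have hemp : ∀ j, j ≠ i → ∀ e, consSlice S (j, e) = ∅ := by
        intro j hj e
        refine Finset.eq_empty_of_forall_notMem fun t ht => ?_
        have h1 := hS' _ _ s t hs ht
        have h2 := hS' _ _ s t hs' ht
        rw [← h1] at h2
        cases e <;> simp [hj.symm] at h2
      have hslice : ∀ e, (consSlice S (i, e)).card ≤ 3 ^ K := fun e => by
        refine (Finset.card_le_card ?_).trans (ih (hun i)).1
        cases e
        · exact Finset.subset_union_left
        · exact Finset.subset_union_right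
      have hlt : S.card < 3 ^ (K + 1) := by
        rw [card_eq_sum_consSlice, Finset.sum_eq_single i]
        · have h1 := hslice false
          have h2 := hslice true
          rw [pow_succ]
          omega
        · intro j _ hj
          simp [hemp j hj]
        · simp
      exact ⟨hlt.le, fun h => absurd h hlt.ne⟩

theorem breaksMaxUnlinked_tripleExpPow {K : ℕ} {good : Finset (Fin K → Fin 3 × Bool) → Prop}
    (c : Fin K) (hgood : ∀ U, good U → ∀ e, ∃ u ∈ U, (u c).2 = e) :
    BreaksMaxUnlinked (tripleExpPow K) (3 ^ K) good := by
  intro S hS hun U _ hU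
  obtain ⟨ε, rfl⟩ := (card_le_of_isUnlinked hun).2 hS
  obtain ⟨u, hu, huc⟩ := hgood U hU (!ε c)
  have huc' : (u c).2 ≠ ε c := by rw [huc]; cases ε c <;> decide
  refine ⟨u, hu, fun h => huc' (mem_boolFiber.mp h c), ?_⟩
  let p (i : Fin 3) : Fin K → Fin 3 × Bool := fun j => (if j = c then i else (u j).1, ε j)
  have hp : ∀ i, p i ∈ boolFiber ε := fun i => mem_boolFiber.mpr fun j => rfl
  have hl : ∀ i, Even (linkNum K u (p i)) ↔ (u c).1 = i := by
    intro i
    rw [even_linkNum_iff_of_forall_ne c]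
    · simp [p, huc']
    · intro j hj
      simp [p, hj]
  refine ⟨p (u c).1, hp _, p ((u c).1 + 1), hp _, ?_⟩
  have h1 := (hl (u c).1).mpr rfl
  have h2 := (hl ((u c).1 + 1)).not.mpr (by simp)
  rw [Nat.not_even_iff_odd] at h2
  rw [add_assoc]
  exact h1.add_odd h2

/-- The integer `≡ 1 (mod 4)` of absolute value `n`, for odd `n`. -/
def starDisc (n : ℕ) : ℤ := if n % 4 = 1 then n else -n

theorem natAbs_starDisc (n : ℕ) : (starDisc n).natAbs = n := by
  unfold starDisc
  split_ifs <;> simp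

theorem starDisc_mod_four {n : ℕ} (hn : Odd n) : starDisc n % 4 = 1 := by
  have := Nat.odd_iff.mp hn
  unfold starDisc
  split_ifs <;> omega

theorem eq_of_natAbs_eq_of_mod_four {a b : ℤ} (h : a.natAbs = b.natAbs) (ha : a % 4 = 1)
    (hb : b % 4 = 1) : a = b := by
  rcases Int.natAbs_eq_natAbs_iff.mp h with h | h
  · exact h
  · omega

theorem starDisc_mul {a b : ℕ} (ha : Odd a) (hb : Odd b) :
    starDisc (a * b) = starDisc a * starDisc b := by
  refine eq_of_natAbs_eq_of_mod_four ?_ (starDisc_mod_four (ha.mul hb)) ?_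
  · rw [Int.natAbs_mul]
    simp only [natAbs_starDisc]
  · rw [Int.mul_emod, starDisc_mod_four ha, starDisc_mod_four hb]
    rfl

theorem jacobiSym_starDisc {m p : ℕ} (hm : Odd m) (hp : Odd p) :
    jacobiSym (starDisc m) p = jacobiSym p m := by
  unfold starDisc
  split_ifs with h
  · exact jacobiSym.quadratic_reciprocity_one_mod_four h hp
  · have hm3 : m % 4 = 3 := by have := Nat.odd_iff.mp hm; omega
    rw [jacobiSym.neg _ hp]
    by_cases h' : p % 4 = 1
    · rw [ZMod.χ₄_nat_one_mod_four h', one_mul,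
        jacobiSym.quadratic_reciprocity_one_mod_four' hm h']
    · have hp3 : p % 4 = 3 := by have := Nat.odd_iff.mp hp; omega
      rw [ZMod.χ₄_nat_three_mod_four hp3, jacobiSym.quadratic_reciprocity_three_mod_four hm3 hp3]
      ring

theorem isFundDisc_starDisc {n : ℕ} (hn : Odd n) (hs : Squarefree n) : IsFundDisc (starDisc n) := by
  refine Or.inl ⟨starDisc_mod_four hn, ?_⟩
  rwa [← Int.squarefree_natAbs, natAbs_starDisc]

theorem eq_starDisc {D : ℤ} (h : IsFundDisc D) (ho : Odd D.natAbs) : D = starDisc D.natAbs := by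
  refine eq_of_natAbs_eq_of_mod_four (natAbs_starDisc _).symm ?_ (starDisc_mod_four ho)
  rcases h with h | ⟨m, rfl, -⟩
  · exact h.1
  · rw [Int.natAbs_mul] at ho
    exact absurd ho (by rw [Nat.not_odd_iff_even]; exact (by decide : Even 4).mul_right _)

/-- The triple of odd fundamental discriminants with the given absolute values. -/
def discTriple (F : Fin 3 → ℕ) : ℤ × ℤ × ℤ := (starDisc (F 0), starDisc (F 1), starDisc (F 2))

theorem facTuple_ne_one_iff {J : Type*} {n : ℕ} (a : n.primeFactors → J) (u : J) :
    facTuple n a u ≠ 1 ↔ ∃ p, a p = u := by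
  constructor
  · intro h
    by_contra! h'
    exact h (Finset.prod_eq_one fun p _ => if_neg (h' p))
  · rintro ⟨p, hp⟩ h
    have h1 := (dvd_facTuple_iff a p u).mpr hp
    rw [h] at h1
    exact (Nat.prime_of_mem_primeFactors p.2).one_lt.ne' (Nat.dvd_one.mp h1)

theorem natAbs_mem_Icc {a : ℤ} {n : ℕ} (hn : n ≠ 0) (h : a.natAbs ∣ n) :
    a ∈ Finset.Icc (-(n : ℤ)) n := by
  have := Nat.le_of_dvd hn.bot_lt h
  rw [Finset.mem_Icc]
  omega

theorem discTriple_mem_fdTriples {n : ℕ} (hs : Squarefree n) (hn : n % 4 = 3) {F : Fin 3 → ℕ}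
    (hF : ∏ i, F i = n) (h1 : ∀ i, F i ≠ 1) : discTriple F ∈ fdTriples (-(n : ℤ)) := by
  have hsF : Squarefree (∏ i, F i) := hF ▸ hs
  have hno : Odd n := Nat.odd_iff.mpr (by omega)
  have hdvd : ∀ i, F i ∣ n := fun i => hF ▸ Finset.dvd_prod_of_mem _ (mem_univ i)
  have hodd : ∀ i, Odd (F i) := fun i => hno.of_dvd_nat (hdvd i)
  have hco : ∀ i j, i ≠ j → IsCoprime (starDisc (F i)) (starDisc (F j)) := fun i j hij => by
    rw [Int.isCoprime_iff_gcd_eq_one, Int.gcd, natAbs_starDisc, natAbs_starDisc]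
    exact coprime_of_squarefree_prod hsF hij
  have hfd : ∀ i, IsFundDisc (starDisc (F i)) := fun i =>
    isFundDisc_starDisc (hodd i) (squarefree_of_squarefree_prod hsF i)
  have hne : ∀ i, starDisc (F i) ≠ 1 := fun i h => h1 i (by
    rw [← natAbs_starDisc (F i), h]; rfl)
  have hmem : ∀ i, starDisc (F i) ∈ Finset.Icc (-(n : ℤ)) n := fun i =>
    natAbs_mem_Icc hs.ne_zero (by rw [natAbs_starDisc]; exact hdvd i)
  have hprod : starDisc (F 0) * starDisc (F 1) * starDisc (F 2) = -(n : ℤ) := by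
    rw [← starDisc_mul (hodd 0) (hodd 1), ← starDisc_mul ((hodd 0).mul (hodd 1)) (hodd 2),
      ← Fin.prod_univ_three, hF, starDisc, if_neg (by omega)]
  rw [fdTriples, Finset.mem_filter, Finset.mem_product, Finset.mem_product]
  simp only [Int.natAbs_neg, Int.natAbs_natCast, discTriple]
  exact ⟨⟨hmem 0, hmem 1, hmem 2⟩, hfd 0, hfd 1, hfd 2, hne 0, hne 1, hne 2,
    hco 0 1 (by decide), hco 0 2 (by decide), hco 1 2 (by decide), hprod⟩

theorem exists_discTriple_eq {n : ℕ} (hn : n % 4 = 3) {t : ℤ × ℤ × ℤ}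
    (ht : t ∈ fdTriples (-(n : ℤ))) :
    ∃ F : Fin 3 → ℕ, ∏ i, F i = n ∧ (∀ i, F i ≠ 1) ∧ discTriple F = t := by
  obtain ⟨a, b, c⟩ := t
  obtain ⟨-, ha, hb, hc, ha1, hb1, hc1, -, -, -, hprod⟩ := Finset.mem_filter.mp ht
  simp only at ha hb hc ha1 hb1 hc1 hprod
  have habs : a.natAbs * b.natAbs * c.natAbs = n := by
    rw [← Int.natAbs_mul, ← Int.natAbs_mul, hprod, Int.natAbs_neg, Int.natAbs_natCast]
  have hno : Odd n := Nat.odd_iff.mpr (by omega)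
  rw [← habs, Nat.odd_mul, Nat.odd_mul] at hno
  have ha' := eq_starDisc ha hno.1.1
  have hb' := eq_starDisc hb hno.1.2
  have hc' := eq_starDisc hc hno.2
  have hne : ∀ {x : ℤ}, x = starDisc x.natAbs → x ≠ 1 → x.natAbs ≠ 1 := by
    intro x hx hx1 h
    rw [h] at hx
    exact hx1 (by rw [hx]; rfl)
  refine ⟨![a.natAbs, b.natAbs, c.natAbs], ?_, ?_, ?_⟩
  · rw [Fin.prod_univ_three]
    exact habs
  · intro i
    fin_cases i
    · exact hne ha' ha1
    · exact hne hb' hb1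
    · exact hne hc' hc1
  · simp only [discTriple, Matrix.cons_val]
    rw [← ha', ← hb', ← hc']

theorem discTriple_injective : Function.Injective discTriple := by
  intro F G h
  simp only [discTriple, Prod.mk.injEq] at h
  have h' : ∀ {a b}, starDisc a = starDisc b → a = b := fun {a b} hab => by
    rw [← natAbs_starDisc a, hab, natAbs_starDisc]
  funext i
  fin_cases i
  · exact h' h.1
  · exact h' h.2.1
  · exact h' h.2.2

theorem sum_fdTriples {n : ℕ} (hs : Squarefree n) (hn : n % 4 = 3) (f : ℤ × ℤ × ℤ → ℝ) :
    ∑ t ∈ fdTriples (-(n : ℤ)), f t =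
      ∑ b : n.primeFactors → Fin 3 with Function.Surjective b, f (discTriple (facTuple n b)) := by
  symm
  refine Finset.sum_nbij (fun b => discTriple (facTuple n b)) ?_ ?_ ?_ fun _ _ => rfl
  · intro b hb
    refine discTriple_mem_fdTriples hs hn (prod_facTuple hs b) fun i => ?_
    exact (facTuple_ne_one_iff b i).mpr ((Finset.mem_filter.mp hb).2 i)
  · exact (discTriple_injective.comp (facTuple_injective n)).injOn
  · intro t ht
    obtain ⟨F, hF, h1, rfl⟩ := exists_discTriple_eq hn (mem_coe.mp ht)
    obtain ⟨b, rfl⟩ := exists_facTuple_eq hs hF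
    refine ⟨b, ?_, rfl⟩
    rw [Finset.mem_coe, Finset.mem_filter]
    exact ⟨mem_univ _, fun i => (facTuple_ne_one_iff b i).mp (h1 i)⟩

theorem kron_starDisc_mul {n : ℕ} (b : n.primeFactors → Fin 3) {i j k : Fin 3}
    (hijk : ∀ x, x = i ∨ x = j ∨ x = k) (hij : i ≠ j) (hik : i ≠ k) (hjk : j ≠ k)
    (p : ℕ) (hp : Odd p) (hoj : Odd (facTuple n b j)) (hok : Odd (facTuple n b k)) :
    (kron (starDisc (facTuple n b j) * starDisc (facTuple n b k)) p : ℝ) =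
      ∏ q : n.primeFactors, (jacobiSym p (q : ℕ) : ℝ) ^ (if i ≠ b q then 1 else 0) := by
  have hp2 : p ≠ 2 := by rintro rfl; exact absurd hp (by decide)
  have hprod : facTuple n b j * facTuple n b k =
      ∏ q : n.primeFactors, if i ≠ b q then (q : ℕ) else 1 := by
    rw [facTuple, facTuple, ← Finset.prod_mul_distrib]
    refine Finset.prod_congr rfl fun q _ => ?_
    rcases hijk (b q) with h | h | h
    · simp [h, hij, hik]
    · simp [h, hij, hjk]
    · simp [h, hik, hjk.symm]
  rw [kron, if_neg hp2, ← starDisc_mul hoj hok, jacobiSym_starDisc (hoj.mul hok) hp, hprod,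
    jacobiSym_prod_right]
  · push_cast
    refine Finset.prod_congr rfl fun q _ => ?_
    split_ifs <;> simp
  · intro q _
    split_ifs
    · exact (Nat.prime_of_mem_primeFactors q.2).ne_zero
    · exact one_ne_zero

theorem tripleTerm_discTriple {n : ℕ} (hs : Squarefree n) (hn : n % 4 = 3)
    (b : n.primeFactors → Fin 3) :
    (tripleTerm (discTriple (facTuple n b)) : ℝ) = ∏ p : n.primeFactors,
      (1 + ∏ q : n.primeFactors, (jacobiSym (p : ℕ) (q : ℕ) : ℝ) ^ (if b p ≠ b q then 1 else 0)) := by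
  have hno : Odd n := Nat.odd_iff.mpr (by omega)
  have hodd : ∀ i, Odd (facTuple n b i) := fun i => hno.of_dvd_nat (by
    conv_rhs => rw [← prod_facTuple hs b]
    exact Finset.dvd_prod_of_mem _ (mem_univ i))
  have hpo : ∀ i, ∀ p ∈ (facTuple n b i).primeFactors, Odd p := fun i p hp =>
    (hodd i).of_dvd_nat (Nat.dvd_of_mem_primeFactors hp)
  rw [← prod_prod_primeFactors_facTuple hs b (fun i p =>
    1 + ∏ q : n.primeFactors, (jacobiSym p (q : ℕ) : ℝ) ^ (if i ≠ b q then 1 else 0)),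
    Fin.prod_univ_three]
  simp only [tripleTerm, discTriple, natAbs_starDisc]
  push_cast
  rw [mul_comm, ← mul_assoc, mul_right_comm]
  congr 1
  · congr 1
    · refine Finset.prod_congr rfl fun p hp => ?_
      rw [kron_starDisc_mul b (i := 0) (j := 1) (k := 2) (by decide) (by decide) (by decide)
        (by decide) p (hpo _ p hp) (hodd _) (hodd _)]
    · refine Finset.prod_congr rfl fun p hp => ?_
      rw [kron_starDisc_mul b (i := 1) (j := 0) (k := 2) (by decide) (by decide) (by decide)
        (by decide) p (hpo _ p hp) (hodd _) (hodd _)]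
  · refine Finset.prod_congr rfl fun p hp => ?_
    rw [kron_starDisc_mul b (i := 2) (j := 0) (k := 1) (by decide) (by decide) (by decide)
      (by decide) p (hpo _ p hp) (hodd _) (hodd _)]

/-- The product of symbols attached to a choice of positions and summands. -/
def pairWeight (n : ℕ) (a : n.primeFactors → Fin 3 × Bool) : ℝ :=
  ∏ p : n.primeFactors, ∏ q : n.primeFactors, (jacobiSym (p : ℕ) (q : ℕ) : ℝ) ^ tripleExp (a p) (a q)

theorem tripleTerm_eq_sum_pairWeight {n : ℕ} (hs : Squarefree n) (hn : n % 4 = 3)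
    (b : n.primeFactors → Fin 3) :
    (tripleTerm (discTriple (facTuple n b)) : ℝ) =
      ∑ ε : n.primeFactors → Bool, pairWeight n (fun p => (b p, ε p)) := by
  rw [tripleTerm_discTriple hs hn]
  have : ∀ p : n.primeFactors,
      (1 + ∏ q : n.primeFactors, (jacobiSym (p : ℕ) (q : ℕ) : ℝ) ^ (if b p ≠ b q then 1 else 0)) =
      ∑ e : Bool, ∏ q : n.primeFactors,
        (jacobiSym (p : ℕ) (q : ℕ) : ℝ) ^ (if b p ≠ b q ∧ e = true then 1 else 0) := by
    intro p
    rw [Fintype.sum_bool]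
    simp [add_comm]
  simp only [this]
  rw [Fintype.prod_sum]
  rfl

theorem sum_boolFun_eq {P : Type*} [Fintype P] [DecidableEq P] [Nonempty P] (f : (P → Bool) → ℝ) :
    ∑ ε, f ε = f (fun _ => false) + f (fun _ => true) +
      ∑ ε : P → Bool with ∀ e, ∃ p, ε p = e, f ε := by
  rw [← Finset.sum_filter_add_sum_filter_not univ (fun ε : P → Bool => ∀ e, ∃ p, ε p = e), add_comm]
  congr 1
  have hne : (fun _ : P => false) ≠ fun _ => true := fun h => by
    obtain ⟨p⟩ := ‹Nonempty P›
    exact absurd (congrFun h p) (by decide)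
  rw [← Finset.sum_pair hne]
  refine Finset.sum_congr ?_ fun _ _ => rfl
  ext ε
  rw [Finset.mem_filter, Finset.mem_insert, Finset.mem_singleton]
  constructor
  · rintro ⟨-, h⟩
    rw [not_forall] at h
    obtain ⟨e, he⟩ := h
    rw [not_exists] at he
    cases e
    · right; funext p; simpa using he p
    · left; funext p; simpa using he p
  · rintro (rfl | rfl)
    · exact ⟨mem_univ _, fun h => by simpa using h true⟩
    · exact ⟨mem_univ _, fun h => by simpa using h false⟩

/-- The part of the sum over triples in which both summands of the local factors occur. -/
def mixedSum (n : ℕ) : ℝ :=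
  ∑ a : n.primeFactors → Fin 3 × Bool with
    (∀ i, ∃ p, (a p).1 = i) ∧ ∀ e, ∃ p, (a p).2 = e, pairWeight n a

theorem sum_surjective_mixed (n : ℕ) :
    ∑ b : n.primeFactors → Fin 3 with Function.Surjective b,
      ∑ ε : n.primeFactors → Bool with ∀ e, ∃ p, ε p = e, pairWeight n (fun p => (b p, ε p)) =
      mixedSum n := by
  rw [mixedSum, ← Finset.sum_product']
  refine Finset.sum_nbij' (fun x p => (x.1 p, x.2 p)) (fun a => (fun p => (a p).1, fun p => (a p).2))
    ?_ ?_ ?_ ?_ ?_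
  · intro x hx
    rw [Finset.mem_product, Finset.mem_filter, Finset.mem_filter] at hx
    exact Finset.mem_filter.mpr ⟨mem_univ _, hx.1.2, hx.2.2⟩
  · intro a ha
    have := (Finset.mem_filter.mp ha).2
    rw [Finset.mem_product, Finset.mem_filter, Finset.mem_filter]
    exact ⟨⟨mem_univ _, this.1⟩, mem_univ _, this.2⟩
  · intro x _
    rfl
  · intro a _
    rfl
  · intro x _
    rfl

theorem card_not_surjective_le (P : Type*) [Fintype P] [DecidableEq P] :
    (univ.filter fun b : P → Fin 3 => ¬Function.Surjective b).card ≤ 3 * 2 ^ Fintype.card P := by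
  have hsub : (univ.filter fun b : P → Fin 3 => ¬Function.Surjective b) ⊆
      univ.biUnion fun i : Fin 3 => Fintype.piFinset fun _ : P => univ.erase i := by
    intro b hb
    have h := (Finset.mem_filter.mp hb).2
    rw [Function.Surjective, not_forall] at h
    obtain ⟨i, hi⟩ := h
    rw [Finset.mem_biUnion]
    refine ⟨i, mem_univ _, ?_⟩
    rw [Fintype.mem_piFinset]
    exact fun p => Finset.mem_erase.mpr ⟨fun hp => hi ⟨p, hp⟩, mem_univ _⟩
  refine (Finset.card_le_card hsub).trans (Finset.card_biUnion_le.trans ?_)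
  simp [Fintype.card_piFinset, Finset.card_erase_of_mem]

theorem pairWeight_false (n : ℕ) (b : n.primeFactors → Fin 3) :
    pairWeight n (fun p => (b p, false)) = 1 := by
  simp [pairWeight, tripleExp]

theorem jacobiSym_mul_swap {a b : ℕ} (ha : Odd a) (hb : Odd b) (hab : a.Coprime b) :
    (jacobiSym a b : ℝ) * jacobiSym b a =
      (1 + oddChar true 1 a + oddChar true 1 b - oddChar true 1 a * oddChar true 1 b) / 2 := by
  have hsq : (jacobiSym b a : ℝ) * jacobiSym b a = 1 := by
    have := jacobiSym.sq_one (a := b) (b := a) (by simpa [Int.gcd] using hab.symm)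
    rw [← sq]
    exact_mod_cast this
  have ha' := Nat.odd_iff.mp ha
  have hb' := Nat.odd_iff.mp hb
  by_cases h1 : a % 4 = 1
  · rw [jacobiSym.quadratic_reciprocity_one_mod_four h1 hb, hsq, chi_one_mod_four h1]
    ring
  · have h3 : a % 4 = 3 := by omega
    rw [chi_three_mod_four h3]
    by_cases h1' : b % 4 = 1
    · rw [jacobiSym.quadratic_reciprocity_one_mod_four' ha h1', hsq, chi_one_mod_four h1']
      ring
    · have h3' : b % 4 = 3 := by omega
      rw [jacobiSym.quadratic_reciprocity_three_mod_four h3 h3', chi_three_mod_four h3']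
      push_cast
      linear_combination -hsq

theorem pairWeight_true {n : ℕ} (hs : Squarefree n) (hn : n % 4 = 3) (b : n.primeFactors → Fin 3) :
    pairWeight n (fun p => (b p, true)) =
      (1 + ∑ i, oddChar true 1 (facTuple n b i)) / 2 := by
  have hno : Odd n := Nat.odd_iff.mpr (by omega)
  have hprod := prod_facTuple hs b
  have hodd : ∀ i, Odd (facTuple n b i) := fun i => hno.of_dvd_nat (by
    conv_rhs => rw [← hprod]
    exact Finset.dvd_prod_of_mem _ (mem_univ i))
  have hco : ∀ i j, i ≠ j → (facTuple n b i).Coprime (facTuple n b j) := fun i j hij =>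
    coprime_of_squarefree_prod (by rwa [hprod]) hij
  have h1 : pairWeight n (fun p => (b p, true)) =
      symbProd (fun x y => if x ≠ y then 1 else 0) (facTuple n b) := by
    rw [symbProd_facTuple]
    simp [pairWeight, tripleExp]
  have hχ : ∀ i, oddChar true 1 (facTuple n b i) = 1 ∨ oddChar true 1 (facTuple n b i) = -1 := by
    intro i
    have := Nat.odd_iff.mp (hodd i)
    rcases (by omega : facTuple n b i % 4 = 1 ∨ facTuple n b i % 4 = 3) with h | h
    · exact Or.inl (chi_one_mod_four h)
    · exact Or.inr (chi_three_mod_four h)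
  have hχn : oddChar true 1 (facTuple n b 0) * oddChar true 1 (facTuple n b 1) *
      oddChar true 1 (facTuple n b 2) = -1 := by
    rw [← map_mul, ← map_mul, ← Fin.prod_univ_three, hprod, chi_three_mod_four hn]
  have h01 := jacobiSym_mul_swap (hodd 0) (hodd 1) (hco 0 1 (by decide))
  have h02 := jacobiSym_mul_swap (hodd 0) (hodd 2) (hco 0 2 (by decide))
  have h12 := jacobiSym_mul_swap (hodd 1) (hodd 2) (hco 1 2 (by decide))
  rw [h1]
  simp only [symbProd, Fin.prod_univ_three, Fin.sum_univ_three]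
  simp only [ne_eq, Fin.reduceEq, not_false_eq_true, not_true_eq_false, if_true, if_false, pow_one,
    pow_zero, one_mul, mul_one]
  have hre : ∀ x y z x' y' z' : ℝ, x * y * (x' * z) * (y' * z') = x * x' * (y * y') * (z * z') := by
    intros; ring
  rw [hre, h01, h02, h12]
  revert hχn
  rcases hχ 0 with h | h <;> rcases hχ 1 with h' | h' <;> rcases hχ 2 with h'' | h'' <;>
    rw [h, h', h''] <;> norm_num

theorem sum_oddChar_facTuple {n : ℕ} (hs : Squarefree n) (i : Fin 3) :
    ∑ b : n.primeFactors → Fin 3, oddChar true 1 (facTuple n b i) =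
      ∏ p ∈ n.primeFactors, (2 + oddChar true 1 p) := by
  have h := sum_prod_facTuple hs (fun (t : Fin 3) p => if t = i then oddChar true 1 p else 1)
  have h1 : ∀ p, ∑ t : Fin 3, (if t = i then oddChar true 1 p else 1) = 2 + oddChar true 1 p := by
    intro p
    fin_cases i <;> rw [Fin.sum_univ_three] <;> simp <;> ring
  simp only [h1] at h
  rw [← h]
  refine Finset.sum_congr rfl fun b _ => ?_
  rw [Finset.prod_eq_single i]
  · simp only [if_true]
    have hsq : Squarefree (facTuple n b i) :=
      squarefree_of_squarefree_prod (by rwa [prod_facTuple hs b]) i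
    rw [← map_prod, Nat.prod_primeFactors_of_squarefree hsq]
  · intro j _ hj
    exact Finset.prod_eq_one fun p _ => if_neg hj
  · simp

theorem abs_sum_tripleTerm_sub_le {n : ℕ} (hs : Squarefree n) (hn : n % 4 = 3) :
    |∑ t ∈ fdTriples (-(n : ℤ)), (tripleTerm t : ℝ) - mixedSum n -
      3 / 2 * (3 ^ n.primeFactors.card + ∏ p ∈ n.primeFactors, (2 + oddChar true 1 p))| ≤
      6 * 2 ^ n.primeFactors.card := by
  have hne : Nonempty n.primeFactors := by
    rw [nonempty_subtype]
    exact Nat.nonempty_primeFactors.mpr (by omega)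
  have h1 : ∑ t ∈ fdTriples (-(n : ℤ)), (tripleTerm t : ℝ) =
      ∑ b : n.primeFactors → Fin 3 with Function.Surjective b,
        (1 + (1 + ∑ i, oddChar true 1 (facTuple n b i)) / 2) + mixedSum n := by
    rw [sum_fdTriples hs hn, ← sum_surjective_mixed, ← Finset.sum_add_distrib]
    refine Finset.sum_congr rfl fun b _ => ?_
    rw [tripleTerm_eq_sum_pairWeight hs hn, sum_boolFun_eq, pairWeight_false,
      pairWeight_true hs hn]
  have h2 : ∑ b : n.primeFactors → Fin 3, (1 + (1 + ∑ i, oddChar true 1 (facTuple n b i)) / 2) =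
      3 / 2 * (3 ^ n.primeFactors.card + ∏ p ∈ n.primeFactors, (2 + oddChar true 1 p)) := by
    have : ∀ b : n.primeFactors → Fin 3, (1 + (1 + ∑ i, oddChar true 1 (facTuple n b i)) / 2) =
        3 / 2 + 1 / 2 * ∑ i, oddChar true 1 (facTuple n b i) := fun b => by ring
    simp only [this]
    rw [Finset.sum_add_distrib, ← Finset.mul_sum, Finset.sum_comm]
    simp only [sum_oddChar_facTuple hs]
    simp
    ring
  rw [← h2, h1, ← Finset.sum_filter_add_sum_filter_not univ
    (fun b : n.primeFactors → Fin 3 => Function.Surjective b)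
    (fun b => 1 + (1 + ∑ i, oddChar true 1 (facTuple n b i)) / 2)]
  rw [show ∀ x y z : ℝ, x + y - y - (x + z) = -z by intros; ring, abs_neg]
  refine (Finset.abs_sum_le_sum_abs _ _).trans ?_
  refine (Finset.sum_le_card_nsmul _ _ 2 fun b hb => ?_).trans ?_
  · have h3 : |pairWeight n (fun p => (b p, true))| ≤ 1 := by
      rw [pairWeight]
      simp only [Finset.abs_prod]
      refine Finset.prod_le_one (fun _ _ => Finset.prod_nonneg fun _ _ => abs_nonneg _)
        fun x _ => Finset.prod_le_one (fun _ _ => abs_nonneg _) fun y _ => ?_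
      rw [abs_pow]
      exact pow_le_one₀ (abs_nonneg _) (abs_jacobiSym_le _ _)
    rw [pairWeight_true hs hn] at h3
    rw [abs_le] at h3 ⊢
    constructor <;> linarith
  · have h4 : ((univ.filter fun b : n.primeFactors → Fin 3 => ¬Function.Surjective b).card : ℝ) ≤
        3 * 2 ^ n.primeFactors.card := by
      have := card_not_surjective_le n.primeFactors
      rw [Fintype.card_coe] at this
      exact_mod_cast this
    rw [nsmul_eq_mul]
    linarith

theorem ftilde_div_eq {n : ℕ} (hn : 0 < n) :
    ftilde (-(n : ℤ)) / 3 ^ omegaZ (-(n : ℤ)) =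
      1 / 48 * (∑ t ∈ fdTriples (-(n : ℤ)), (tripleTerm t : ℝ)) / 3 ^ n.primeFactors.card := by
  have : ¬ 0 < -(n : ℤ) := by omega
  rw [ftilde, omegaZ, alphaFD, if_neg this, Int.natAbs_neg, Int.natAbs_natCast]
  norm_num

theorem abs_ftilde_sub_le {n : ℕ} (hs : Squarefree n) (hn : n % 4 = 3) :
    |ftilde (-(n : ℤ)) / 3 ^ omegaZ (-(n : ℤ)) - 1 / 32| ≤
      |mixedSum n / 3 ^ n.primeFactors.card| + ∏ p ∈ n.primeFactors, (2 + oddChar true 1 p) / 3 +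
        ∏ _p ∈ n.primeFactors, (2 / 3 : ℝ) := by
  have h := abs_sum_tripleTerm_sub_le hs hn
  have hpos : (0 : ℝ) < 3 ^ n.primeFactors.card := by positivity
  have hprod : ∏ p ∈ n.primeFactors, (2 + oddChar true 1 p) / 3 =
      (∏ p ∈ n.primeFactors, (2 + oddChar true 1 p)) / 3 ^ n.primeFactors.card := by
    rw [Finset.prod_div_distrib, Finset.prod_const]
  have hnn : 0 ≤ ∏ p ∈ n.primeFactors, (2 + oddChar true 1 p) :=
    Finset.prod_nonneg fun p _ => by linarith [(abs_le.mp (abs_oddChar_le true 1 p)).1]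
  rw [ftilde_div_eq (by omega), hprod, Finset.prod_const, div_pow, abs_div, abs_of_pos hpos,
    div_sub' hpos.ne', abs_div, abs_of_pos hpos, ← add_div, ← add_div]
  refine div_le_div_of_nonneg_right ?_ hpos.le
  generalize ∑ t ∈ fdTriples (-(n : ℤ)), (tripleTerm t : ℝ) = T at h ⊢
  generalize ∏ p ∈ n.primeFactors, (2 + oddChar true 1 p) = Q at h hnn ⊢
  generalize (3 : ℝ) ^ n.primeFactors.card = E at h hpos ⊢
  have h2 : (0 : ℝ) < 2 ^ n.primeFactors.card := by positivity
  generalize (2 : ℝ) ^ n.primeFactors.card = W at h h2 ⊢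
  have hm := neg_abs_le (mixedSum n)
  have hm' := le_abs_self (mixedSum n)
  rw [abs_le] at h ⊢
  constructor <;> linarith [abs_nonneg (mixedSum n)]

/-- Every coordinate of the indices in `U` takes all positions and both summands. -/
def MixedSupport (K : ℕ) (U : Finset (Fin K → Fin 3 × Bool)) : Prop :=
  ∀ j, (∀ i, ∃ u ∈ U, (u j).1 = i) ∧ ∀ e, ∃ u ∈ U, (u j).2 = e

theorem mixedSupport_suppSet_iff {K n : ℕ} (A : n.primeFactors → Fin K → Fin 3 × Bool) :
    MixedSupport K (suppSet (facTuple n A)) ↔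
      ∀ j, (∀ i, ∃ p, (A p j).1 = i) ∧ ∀ e, ∃ p, (A p j).2 = e := by
  have h : ∀ P : (Fin K → Fin 3 × Bool) → Prop,
      (∃ u ∈ suppSet (facTuple n A), P u) ↔ ∃ p, P (A p) := by
    intro P
    simp only [suppSet, Finset.mem_filter, Finset.mem_univ, true_and, facTuple_ne_one_iff]
    exact ⟨fun ⟨u, ⟨p, hp⟩, hu⟩ => ⟨p, hp ▸ hu⟩, fun ⟨p, hp⟩ => ⟨_, ⟨p, rfl⟩, hp⟩⟩
  simp only [MixedSupport, h]

theorem prod_pairWeight {K n : ℕ} (A : n.primeFactors → Fin K → Fin 3 × Bool) :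
    ∏ j, pairWeight n (fun p => A p j) = symbProd (tripleExpPow K) (facTuple n A) := by
  rw [symbProd_facTuple]
  simp only [pairWeight, tripleExpPow]
  rw [Finset.prod_comm]
  refine Finset.prod_congr rfl fun p _ => ?_
  rw [Finset.prod_comm]
  exact Finset.prod_congr rfl fun q _ => Finset.prod_pow_eq_pow_sum _ _ _

theorem mixedSum_pow (K n : ℕ) :
    mixedSum n ^ K = ∑ A : n.primeFactors → Fin K → Fin 3 × Bool,
      (if MixedSupport K (suppSet (facTuple n A)) then 1 else 0) *
        symbProd (tripleExpPow K) (facTuple n A) := by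
  rw [mixedSum, Finset.sum_filter, Fintype.sum_pow]
  refine Fintype.sum_equiv (Equiv.piComm _) _ _ fun B => ?_
  rw [← prod_pairWeight]
  by_cases h : MixedSupport K (suppSet (facTuple n (fun p j => B j p)))
  · have h' := (mixedSupport_suppSet_iff _).mp h
    have : (if MixedSupport K (suppSet (facTuple n (Equiv.piComm _ B))) then 1 else 0 : ℝ) = 1 :=
      if_pos h
    rw [this, one_mul]
    exact Finset.prod_congr rfl fun j _ => if_pos (h' j)
  · have : (if MixedSupport K (suppSet (facTuple n (Equiv.piComm _ B))) then 1 else 0 : ℝ) = 0 :=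
      if_neg h
    rw [this, zero_mul]
    rw [mixedSupport_suppSet_iff, not_forall] at h
    obtain ⟨j, hj⟩ := h
    exact Finset.prod_eq_zero (mem_univ j) (if_neg hj)

theorem sum_mixedSum_pow (θ : ℕ →*₀ ℝ) (K N : ℕ) :
    ∑ n ∈ sqfreeLT N, θ n * (mixedSum n / 3 ^ n.primeFactors.card) ^ K =
      ∑ D ∈ tuplesLT (Fin K → Fin 3 × Bool) N,
        charTerm (tripleExpPow K) θ ((3 ^ K : ℕ) : ℝ) (MixedSupport K) D := by
  rw [← sum_facTuple]
  refine Finset.sum_congr rfl fun n hn => ?_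
  rw [div_pow, mixedSum_pow, Finset.sum_div, Finset.mul_sum]
  refine Finset.sum_congr rfl fun A _ => ?_
  rw [charTerm, prod_facTuple (mem_sqfreeLT.mp hn).2, Finset.prod_const, Nat.cast_pow, inv_pow,
    pow_right_comm, Nat.cast_ofNat, mul_assoc, mul_assoc, div_eq_inv_mul]

theorem tendsto_sum_oddChar_mixedSum_pow (η : Bool) {K : ℕ} (hK : 1 ≤ K) :
    Tendsto (fun N : ℕ => (∑ n ∈ sqfreeLT N,
      oddChar η 1 n * (mixedSum n / 3 ^ n.primeFactors.card) ^ K) / N) atTop (nhds 0) := by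
  simp only [sum_mixedSum_pow]
  have h3 : 2 ≤ 3 ^ K := (by norm_num : 2 ≤ 3 ^ 1).trans (Nat.pow_le_pow_right (by norm_num) hK)
  refine tendsto_sum_charTerm tripleExpPow_self (abs_oddChar_le η 1) ?_ h3
    (fun S hS => (card_le_of_isUnlinked hS).1)
    (breaksMaxUnlinked_tripleExpPow ⟨0, hK⟩ fun U hU => (hU _).2)
  have h2 : ZMod.χ₄ ((2 : ℕ) : ZMod 4) = 0 := by decide
  rw [oddChar_apply, h2]
  cases η <;> simp

/-- The absolute values of the negative odd fundamental discriminants greater than `-N`. -/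
def threeModFourLT (N : ℕ) : Finset ℕ := (sqfreeLT N).filter fun n => n % 4 = 3

theorem tendsto_sum_mixedSum_pow {K : ℕ} (hK : 1 ≤ K) :
    Tendsto (fun N : ℕ => (∑ n ∈ threeModFourLT N,
      (mixedSum n / 3 ^ n.primeFactors.card) ^ K) / N) atTop (nhds 0) := by
  have h := ((tendsto_sum_oddChar_mixedSum_pow false hK).sub
    (tendsto_sum_oddChar_mixedSum_pow true hK)).const_mul (1 / 2)
  rw [sub_zero, mul_zero] at h
  refine h.congr fun N => ?_
  rw [threeModFourLT, Finset.sum_filter, ← sub_div, ← Finset.sum_sub_distrib, ← mul_div_assoc,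
    Finset.mul_sum]
  congr 1
  refine Finset.sum_congr rfl fun n _ => ?_
  rw [← sub_mul, ← mul_assoc]
  have h4 := ZMod.χ₄_nat_eq_if_mod_four n
  rw [oddChar_apply, oddChar_apply, h4]
  simp only [Bool.false_eq_true, if_false, if_true, jacobiSym.one_right]
  by_cases h3 : n % 4 = 3
  · have ho : ¬ n % 2 = 0 := by omega
    have h1 : ¬ n % 4 = 1 := by omega
    simp [h3, ho]
    norm_num
  · rw [if_neg h3]
    by_cases ho : n % 2 = 0
    · simp [ho]
    · have h1 : n % 4 = 1 := by omega
      simp [ho, h1]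

theorem tendsto_sum_sqfreeLT_prod {h : ℕ → ℝ} (h0 : ∀ p, p.Prime → 0 ≤ h p)
    (h1 : ∀ p, p.Prime → h p ≤ 1) {c : ℝ} (hc : 0 < c) (B : ℝ)
    (hB : ∀ N : ℕ, 3 ≤ N → c * Real.log (Real.log N) - B ≤ ∑ p ∈ Nat.primesLE N, (1 - h p) / p) :
    Tendsto (fun N : ℕ => (∑ n ∈ sqfreeLT N, ∏ p ∈ n.primeFactors, h p) / N) atTop (nhds 0) := by
  obtain ⟨C, hC, hle⟩ := exists_sum_sqfree_le zero_le_one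
  have hlim : Tendsto (fun N : ℕ => C * Real.exp (B - c * Real.log (Real.log N))) atTop (nhds 0) := by
    rw [← mul_zero C]
    refine (Real.tendsto_exp_atBot.comp ?_).const_mul C
    exact tendsto_atBot_add_const_left _ _
      (tendsto_neg_atTop_atBot.comp (tendsto_log_log_natCast.const_mul_atTop hc))
  refine squeeze_zero' (Eventually.of_forall fun N => div_nonneg (Finset.sum_nonneg fun n _ =>
    Finset.prod_nonneg fun p hp => h0 p (Nat.prime_of_mem_primeFactors hp)) (by positivity)) ?_ hlim
  filter_upwards [eventually_ge_atTop 3] with N hN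
  have hN0 : (0 : ℝ) < N := by positivity
  rw [div_le_iff₀ hN0]
  refine (hle h h0 h1 N (by omega)).trans ?_
  rw [mul_right_comm]
  refine mul_le_mul_of_nonneg_right (mul_le_mul_of_nonneg_left (Real.exp_le_exp.mpr ?_) hC.le) hN0.le
  linarith [hB N hN]

theorem tendsto_sum_two_thirds :
    Tendsto (fun N : ℕ => (∑ n ∈ sqfreeLT N, ∏ _p ∈ n.primeFactors, (2 / 3 : ℝ)) / N) atTop
      (nhds 0) := by
  refine tendsto_sum_sqfreeLT_prod (fun _ _ => by norm_num) (fun _ _ => by norm_num)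
    (c := 1 / 24) (by norm_num) (2 / 3) fun N hN => ?_
  have h := le_sum_primesLE_inv hN
  have : ∑ p ∈ Nat.primesLE N, (1 - 2 / 3 : ℝ) / p = 1 / 3 * ∑ p ∈ Nat.primesLE N, (1 : ℝ) / p := by
    rw [Finset.mul_sum]
    exact Finset.sum_congr rfl fun p _ => by ring
  rw [this]
  linarith

theorem two_add_oddChar_div_three_nonneg (p : ℕ) : 0 ≤ (2 + oddChar true 1 p) / 3 := by
  linarith [(abs_le.mp (abs_oddChar_le true 1 p)).1]

theorem two_add_oddChar_div_three_le_one (p : ℕ) : (2 + oddChar true 1 p) / 3 ≤ 1 := by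
  linarith [(abs_le.mp (abs_oddChar_le true 1 p)).2]

theorem tendsto_sum_two_add_oddChar :
    Tendsto (fun N : ℕ => (∑ n ∈ sqfreeLT N, ∏ p ∈ n.primeFactors, (2 + oddChar true 1 p) / 3) / N)
      atTop (nhds 0) := by
  refine tendsto_sum_sqfreeLT_prod (fun p _ => two_add_oddChar_div_three_nonneg p)
    (fun p _ => two_add_oddChar_div_three_le_one p) (c := 1 / 12) (by norm_num)
    ((1 / 2 * Real.log (Real.log (4 : ℕ) + 3) + 2) / 3) fun N hN => ?_
  have h := le_sum_primesLE_one_sub (ψ := oddChar true 1) (q := 4) (abs_oddChar_le true 1)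
    (by norm_num) abs_sum_oddChar_one_le hN
  have : ∑ p ∈ Nat.primesLE N, (1 - (2 + oddChar true 1 p) / 3) / p =
      1 / 3 * ∑ p ∈ Nat.primesLE N, (1 - oddChar true 1 p) / p := by
    rw [Finset.mul_sum]
    exact Finset.sum_congr rfl fun p _ => by ring
  rw [this]
  linarith

theorem add_add_pow_le {a b c : ℝ} (ha : 0 ≤ a) (hb : 0 ≤ b) (hc : 0 ≤ c) (m : ℕ) :
    (a + b + c) ^ m ≤ 3 ^ m * (a ^ m + b ^ m + c ^ m) := by
  have key : ∀ x, 0 ≤ x → a ≤ x → b ≤ x → c ≤ x → (a + b + c) ^ m ≤ 3 ^ m * x ^ m := by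
    intro x hx h1 h2 h3
    rw [← mul_pow]
    exact pow_le_pow_left₀ (by positivity) (by linarith) m
  have ham := pow_nonneg ha m
  have hbm := pow_nonneg hb m
  have hcm := pow_nonneg hc m
  rcases le_total a b with hab | hab
  · rcases le_total b c with hbc | hbc
    · exact (key c hc (hab.trans hbc) hbc le_rfl).trans
        (mul_le_mul_of_nonneg_left (by linarith) (by positivity))
    · exact (key b hb hab le_rfl hbc).trans
        (mul_le_mul_of_nonneg_left (by linarith) (by positivity))
  · rcases le_total a c with hac | hac
    · exact (key c hc hac (hab.trans hac) le_rfl).trans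
        (mul_le_mul_of_nonneg_left (by linarith) (by positivity))
    · exact (key a ha le_rfl hab hac).trans
        (mul_le_mul_of_nonneg_left (by linarith) (by positivity))

/-- The deviation of the normalized count from its limiting value. -/
def deviation (n : ℕ) : ℝ := ftilde (-(n : ℤ)) / 3 ^ omegaZ (-(n : ℤ)) - 1 / 32

theorem deviation_pow_le {n : ℕ} (hs : Squarefree n) (hn : n % 4 = 3) {j : ℕ} (hj : 1 ≤ j) :
    deviation n ^ (2 * j) ≤ 3 ^ (2 * j) * ((mixedSum n / 3 ^ n.primeFactors.card) ^ (2 * j) +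
      ∏ p ∈ n.primeFactors, (2 + oddChar true 1 p) / 3 + ∏ _p ∈ n.primeFactors, (2 / 3 : ℝ)) := by
  have hQ0 : 0 ≤ ∏ p ∈ n.primeFactors, (2 + oddChar true 1 p) / 3 :=
    Finset.prod_nonneg fun p _ => two_add_oddChar_div_three_nonneg p
  have hQ1 : ∏ p ∈ n.primeFactors, (2 + oddChar true 1 p) / 3 ≤ 1 :=
    Finset.prod_le_one (fun p _ => two_add_oddChar_div_three_nonneg p)
      fun p _ => two_add_oddChar_div_three_le_one p
  have hW0 : 0 ≤ ∏ _p ∈ n.primeFactors, (2 / 3 : ℝ) := Finset.prod_nonneg fun _ _ => by norm_num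
  have hW1 : ∏ _p ∈ n.primeFactors, (2 / 3 : ℝ) ≤ 1 :=
    Finset.prod_le_one (fun _ _ => by norm_num) fun _ _ => by norm_num
  have h := abs_ftilde_sub_le hs hn
  change |deviation n| ≤ _ at h
  have he : Even (2 * j) := even_two_mul j
  rw [← he.pow_abs, ← he.pow_abs (mixedSum n / _)]
  refine (pow_le_pow_left₀ (abs_nonneg _) h _).trans ((add_add_pow_le (abs_nonneg _) hQ0 hW0 _).trans
    (mul_le_mul_of_nonneg_left ?_ (by positivity)))
  have h1 := pow_le_of_le_one hQ0 hQ1 (by omega : 2 * j ≠ 0)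
  have h2 := pow_le_of_le_one hW0 hW1 (by omega : 2 * j ≠ 0)
  linarith

theorem tendsto_sum_deviation_pow_even {j : ℕ} (hj : 1 ≤ j) :
    Tendsto (fun N : ℕ => (∑ n ∈ threeModFourLT N, deviation n ^ (2 * j)) / N) atTop (nhds 0) := by
  have hlim := (((tendsto_sum_mixedSum_pow (K := 2 * j) (by omega)).add
    tendsto_sum_two_add_oddChar).add tendsto_sum_two_thirds).const_mul ((3 : ℝ) ^ (2 * j))
  rw [add_zero, add_zero, mul_zero] at hlim
  refine squeeze_zero (fun N => div_nonneg (Finset.sum_nonneg fun n _ =>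
    (even_two_mul j).pow_nonneg _) (by positivity)) (fun N => ?_) hlim
  rw [← add_div, ← add_div, ← mul_div_assoc]
  refine div_le_div_of_nonneg_right ?_ (by positivity)
  have hsub : threeModFourLT N ⊆ sqfreeLT N := Finset.filter_subset _ _
  have h1 : ∑ n ∈ threeModFourLT N, ∏ p ∈ n.primeFactors, (2 + oddChar true 1 p) / 3 ≤
      ∑ n ∈ sqfreeLT N, ∏ p ∈ n.primeFactors, (2 + oddChar true 1 p) / 3 :=
    Finset.sum_le_sum_of_subset_of_nonneg hsub fun n _ _ =>
      Finset.prod_nonneg fun p _ => two_add_oddChar_div_three_nonneg p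
  have h2 : ∑ n ∈ threeModFourLT N, ∏ _p ∈ n.primeFactors, (2 / 3 : ℝ) ≤
      ∑ n ∈ sqfreeLT N, ∏ _p ∈ n.primeFactors, (2 / 3 : ℝ) :=
    Finset.sum_le_sum_of_subset_of_nonneg hsub fun n _ _ =>
      Finset.prod_nonneg fun p _ => by norm_num
  calc ∑ n ∈ threeModFourLT N, deviation n ^ (2 * j)
      ≤ ∑ n ∈ threeModFourLT N, 3 ^ (2 * j) * ((mixedSum n / 3 ^ n.primeFactors.card) ^ (2 * j) +
        ∏ p ∈ n.primeFactors, (2 + oddChar true 1 p) / 3 + ∏ _p ∈ n.primeFactors, (2 / 3 : ℝ)) := by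
        refine Finset.sum_le_sum fun n hn => ?_
        obtain ⟨hn1, hn2⟩ := Finset.mem_filter.mp hn
        exact deviation_pow_le (mem_sqfreeLT.mp hn1).2 hn2 hj
    _ ≤ _ := by
        rw [← Finset.mul_sum, Finset.sum_add_distrib, Finset.sum_add_distrib]
        exact mul_le_mul_of_nonneg_left (by linarith) (by positivity)

theorem card_threeModFourLT_le (N : ℕ) : (threeModFourLT N).card ≤ N :=
  (Finset.card_le_card ((Finset.filter_subset _ _).trans (Finset.filter_subset _ _))).trans_eq
    (Finset.card_range N)

theorem tendsto_sum_deviation_pow {j : ℕ} (hj : 1 ≤ j) :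
    Tendsto (fun N : ℕ => (∑ n ∈ threeModFourLT N, deviation n ^ j) / N) atTop (nhds 0) := by
  have h := (tendsto_sum_deviation_pow_even hj).sqrt
  rw [Real.sqrt_zero] at h
  refine squeeze_zero_norm' ?_ h
  filter_upwards [eventually_ge_atTop 1] with N hN
  have hN0 : (0 : ℝ) < N := by exact_mod_cast hN
  rw [Real.norm_eq_abs]
  refine Real.abs_le_sqrt ?_
  rw [div_pow, div_le_div_iff₀ (by positivity) hN0]
  have h1 := sq_sum_le_card_mul_sum_sq (s := threeModFourLT N) (f := fun n => deviation n ^ j)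
  have h2 : ((threeModFourLT N).card : ℝ) ≤ N := by exact_mod_cast card_threeModFourLT_le N
  simp only [← pow_mul, mul_comm j 2] at h1
  have h3 : 0 ≤ ∑ n ∈ threeModFourLT N, deviation n ^ (2 * j) :=
    Finset.sum_nonneg fun n _ => (even_two_mul j).pow_nonneg _
  have h4 := mul_le_mul_of_nonneg_right h2 h3
  calc (∑ n ∈ threeModFourLT N, deviation n ^ j) ^ 2 * N
      ≤ N * (∑ n ∈ threeModFourLT N, deviation n ^ (2 * j)) * N :=
        mul_le_mul_of_nonneg_right (h1.trans h4) hN0.le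
    _ = _ := by ring

theorem tendsto_sum_ftilde_pow_sub (k : ℕ) :
    Tendsto (fun N : ℕ => (∑ n ∈ threeModFourLT N,
      ((ftilde (-(n : ℤ)) / 3 ^ omegaZ (-(n : ℤ))) ^ k - (1 / 32) ^ k)) / N) atTop (nhds 0) := by
  have h : Tendsto (fun N : ℕ => ∑ i ∈ range k, (1 / 32 : ℝ) ^ (k - (i + 1)) * k.choose (i + 1) *
      ((∑ n ∈ threeModFourLT N, deviation n ^ (i + 1)) / N)) atTop (nhds 0) := by
    rw [← Finset.sum_const_zero (s := range k)]
    refine tendsto_finsetSum _ fun i _ => ?_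
    rw [← mul_zero ((1 / 32 : ℝ) ^ (k - (i + 1)) * k.choose (i + 1))]
    exact (tendsto_sum_deviation_pow (Nat.le_add_left 1 i)).const_mul _
  refine h.congr fun N => ?_
  simp only [← mul_div_assoc]
  rw [← Finset.sum_div]
  congr 1
  simp only [Finset.mul_sum]
  rw [Finset.sum_comm]
  refine Finset.sum_congr rfl fun n _ => ?_
  have : ftilde (-(n : ℤ)) / 3 ^ omegaZ (-(n : ℤ)) = deviation n + 1 / 32 := by
    rw [deviation, sub_add_cancel]
  rw [this, add_pow, Finset.sum_range_succ']
  simp only [pow_zero, Nat.sub_zero, Nat.choose_zero_right, Nat.cast_one, mul_one, one_mul,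
    add_sub_cancel_right]
  exact Finset.sum_congr rfl fun i _ => by ring

theorem card_filter_mod_four_le {N : ℕ} :
    N / 4 ≤ ((range N).filter fun n => n % 4 = 3).card := by
  calc N / 4 = ((range (N / 4)).image fun k => 4 * k + 3).card := by
        rw [Finset.card_image_of_injective _ fun a b h => by simpa using h, Finset.card_range]
    _ ≤ _ := by
        refine Finset.card_le_card fun n hn => ?_
        obtain ⟨k, hk, rfl⟩ := Finset.mem_image.mp hn
        rw [Finset.mem_range] at hk
        rw [Finset.mem_filter, Finset.mem_range]
        omega

theorem card_not_squarefree_le (N : ℕ) :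
    ((range N).filter fun n => n % 4 = 3 ∧ ¬Squarefree n).card ≤
      ∑ i ∈ range N.sqrt, (N / (2 * i + 3) ^ 2 / 4 + 1) := by
  have hsub : ((range N).filter fun n => n % 4 = 3 ∧ ¬Squarefree n) ⊆
      (range N.sqrt).biUnion fun i =>
        (range (N / (2 * i + 3) ^ 2 / 4 + 1)).image fun k => (2 * i + 3) ^ 2 * (4 * k + 3) := by
    intro n hn
    obtain ⟨hnN, hn3, hns⟩ := Finset.mem_filter.mp hn
    rw [Finset.mem_range] at hnN
    rw [Nat.squarefree_iff_prime_squarefree] at hns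
    push Not at hns
    obtain ⟨p, hp, m, hm⟩ := hns
    have hpo : p % 2 = 1 := by
      rcases hp.eq_two_or_odd with h | h
      · subst h
        omega
      · exact h
    have hp2 := hp.two_le
    obtain ⟨i, rfl⟩ : ∃ i, p = 2 * i + 3 := ⟨(p - 3) / 2, by omega⟩
    have hsq : (2 * i + 3) * (2 * i + 3) = 4 * (i * i + 3 * i + 2) + 1 := by ring
    have hm3 : m % 4 = 3 := by
      have : n = 4 * ((i * i + 3 * i + 2) * m) + m := by rw [hm, hsq]; ring
      omega
    have hle : (2 * i + 3) * (2 * i + 3) ≤ n := Nat.le_of_dvd (by omega) ⟨m, hm⟩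
    rw [Finset.mem_biUnion]
    refine ⟨i, ?_, Finset.mem_image.mpr ⟨m / 4, ?_, ?_⟩⟩
    · have := Nat.le_sqrt.mpr (hle.trans hnN.le)
      rw [Finset.mem_range]
      omega
    · have : m ≤ N / (2 * i + 3) ^ 2 := by
        rw [Nat.le_div_iff_mul_le (by positivity), sq, mul_comm, ← hm]
        exact hnN.le
      rw [Finset.mem_range]
      omega
    · rw [show 4 * (m / 4) + 3 = m by omega, sq, ← hm]
  refine (Finset.card_le_card hsub).trans (Finset.card_biUnion_le.trans ?_)
  exact Finset.sum_le_sum fun i _ => Finset.card_image_le.trans_eq (Finset.card_range _)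

theorem sum_inv_odd_sq_le (s : ℕ) :
    ∑ i ∈ range s, 1 / (2 * (i : ℝ) + 3) ^ 2 ≤ 1 / 4 - 1 / (4 * ((s : ℝ) + 1)) := by
  induction s with
  | zero => norm_num
  | succ s ih =>
    rw [Finset.sum_range_succ]
    refine (add_le_add_left ih _).trans ?_
    have h : 1 / (2 * (s : ℝ) + 3) ^ 2 ≤ 1 / (4 * ((s : ℝ) + 1)) - 1 / (4 * ((s : ℝ) + 1 + 1)) := by
      rw [div_sub_div _ _ (by positivity) (by positivity),
        div_le_div_iff₀ (by positivity) (by positivity)]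
      nlinarith [(Nat.cast_nonneg s : (0 : ℝ) ≤ s)]
    push_cast
    linarith

theorem le_card_threeModFourLT {N : ℕ} (hN : 100 ≤ N) :
    (N : ℝ) / 16 ≤ (threeModFourLT N).card := by
  have h1 : ((range N).filter fun n => n % 4 = 3).card =
      (threeModFourLT N).card + ((range N).filter fun n => n % 4 = 3 ∧ ¬Squarefree n).card := by
    rw [← Finset.card_filter_add_card_filter_not (s := (range N).filter fun n => n % 4 = 3)
      Squarefree, Finset.filter_filter, Finset.filter_filter, threeModFourLT, sqfreeLT,
      Finset.filter_filter]
    simp only [and_comm]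
  have h2 := card_filter_mod_four_le (N := N)
  have h3 := card_not_squarefree_le N
  have h4 : ((∑ i ∈ range N.sqrt, (N / (2 * i + 3) ^ 2 / 4 + 1) : ℕ) : ℝ) ≤ N / 16 + N.sqrt := by
    push_cast
    rw [Finset.sum_add_distrib, Finset.sum_const, Finset.card_range, nsmul_one]
    have : ∑ i ∈ range N.sqrt, ((N / (2 * i + 3) ^ 2 / 4 : ℕ) : ℝ) ≤
        N / 4 * ∑ i ∈ range N.sqrt, 1 / (2 * (i : ℝ) + 3) ^ 2 := by
      rw [Finset.mul_sum]
      refine Finset.sum_le_sum fun i _ => ?_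
      rw [Nat.div_div_eq_div_mul]
      refine Nat.cast_div_le.trans_eq ?_
      push_cast
      field_simp
    have h5 := sum_inv_odd_sq_le N.sqrt
    have h6 : 0 ≤ 1 / (4 * ((N.sqrt : ℝ) + 1)) := by positivity
    have h7 : (N : ℝ) / 4 * ∑ i ∈ range N.sqrt, 1 / (2 * (i : ℝ) + 3) ^ 2 ≤ N / 4 * (1 / 4) :=
      mul_le_mul_of_nonneg_left (by linarith) (by positivity)
    linarith
  have hs : 10 * N.sqrt ≤ N := by
    have h10 : 10 ≤ N.sqrt := Nat.le_sqrt.mpr hN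
    exact (Nat.mul_le_mul_right _ h10).trans (Nat.sqrt_le N)
  have h8 : (N : ℝ) ≤ 4 * (N / 4 : ℕ) + 3 := by
    exact_mod_cast (by omega : N ≤ 4 * (N / 4) + 3)
  have h9 : ((N / 4 : ℕ) : ℝ) ≤ (threeModFourLT N).card +
      ((range N).filter fun n => n % 4 = 3 ∧ ¬Squarefree n).card := by
    exact_mod_cast h2.trans_eq h1
  have h10 : (((range N).filter fun n => n % 4 = 3 ∧ ¬Squarefree n).card : ℝ) ≤ N / 16 + N.sqrt :=
    (Nat.cast_le.mpr h3).trans h4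
  have h11 : 10 * (N.sqrt : ℝ) ≤ N := by exact_mod_cast hs
  have h12 : (100 : ℝ) ≤ N := by exact_mod_cast hN
  linarith

theorem tendsto_mean_threeModFourLT (k : ℕ) :
    Tendsto (fun N : ℕ => (∑ n ∈ threeModFourLT N,
      (ftilde (-(n : ℤ)) / 3 ^ omegaZ (-(n : ℤ))) ^ k) / ((threeModFourLT N).card : ℝ)) atTop
      (nhds ((1 / 32 : ℝ) ^ k)) := by
  rw [← tendsto_sub_nhds_zero_iff]
  have h := (tendsto_sum_ftilde_pow_sub k).norm.const_mul 16
  rw [norm_zero, mul_zero] at h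
  refine squeeze_zero_norm' ?_ h
  filter_upwards [eventually_ge_atTop 100] with N hN
  have hN0 : (0 : ℝ) < N := by positivity
  have hS := le_card_threeModFourLT hN
  have hS0 : (0 : ℝ) < (threeModFourLT N).card := lt_of_lt_of_le (by positivity) hS
  rw [Finset.sum_sub_distrib, Finset.sum_const, nsmul_eq_mul, div_sub' hS0.ne', norm_div, norm_div,
    Real.norm_of_nonneg hS0.le, Real.norm_of_nonneg hN0.le, ← mul_div_assoc,
    div_le_div_iff₀ hS0 hN0]
  exact (mul_le_mul_of_nonneg_left (by linarith : (N : ℝ) ≤ 16 * (threeModFourLT N).card)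
    (norm_nonneg _)).trans_eq (by ring)

theorem sum_DnegOdd (X : ℝ) (f : ℤ → ℝ) :
    ∑ d ∈ DnegOdd X, f d = ∑ n ∈ threeModFourLT ⌈X⌉₊, f (-(n : ℤ)) := by
  symm
  refine Finset.sum_nbij' (fun n => -(n : ℤ)) Int.natAbs ?_ ?_ ?_ ?_ fun _ _ => rfl
  · intro n hn
    obtain ⟨hn1, hn3⟩ := Finset.mem_filter.mp hn
    obtain ⟨hnX, hs⟩ := mem_sqfreeLT.mp hn1
    rw [Nat.lt_ceil] at hnX
    have h1 : (n : ℤ) ≤ ⌈X⌉ := by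
      have : (n : ℝ) ≤ ⌈X⌉ := hnX.le.trans (Int.le_ceil X)
      exact_mod_cast this
    rw [DnegOdd, Finset.mem_filter, Finset.mem_Icc, ← Int.squarefree_natAbs, Int.natAbs_neg,
      Int.natAbs_natCast]
    refine ⟨by omega, by omega, hs, by omega, ?_⟩
    push_cast
    linarith
  · intro d hd
    obtain ⟨-, hd0, hs, hd1, hdX⟩ := Finset.mem_filter.mp hd
    rw [threeModFourLT, Finset.mem_filter, mem_sqfreeLT, Nat.lt_ceil, Int.squarefree_natAbs]
    have h1 : (d.natAbs : ℤ) = -d := by omega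
    have h2 : (d.natAbs : ℝ) = -d := by rw [← Int.cast_natCast, h1, Int.cast_neg]
    refine ⟨⟨by linarith, hs⟩, by omega⟩
  · intro n _
    simp
  · intro d hd
    obtain ⟨-, hd0, -⟩ := Finset.mem_filter.mp hd
    omega

theorem card_DnegOdd (X : ℝ) : ((DnegOdd X).card : ℝ) = (threeModFourLT ⌈X⌉₊).card := by
  have := sum_DnegOdd X fun _ => 1
  simpa using this

theorem moments_point_mass_neg (k : ℕ) (hk : 1 ≤ k) :
    Tendsto
      (fun X : ℝ =>
        (∑ d ∈ DnegOdd X, (ftilde d / 3 ^ omegaZ d) ^ k) / ((DnegOdd X).card : ℝ))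
      atTop (nhds ((1 / 32 : ℝ) ^ k)) := by
  refine ((tendsto_mean_threeModFourLT k).comp tendsto_nat_ceil_atTop).congr fun X => ?_
  rw [card_DnegOdd, sum_DnegOdd X fun d => (ftilde d / 3 ^ omegaZ d) ^ k]
  rfl
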